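/- Let α ∈ ℝ∖ℚ be of bounded type (with constant M) and let s > 2. Then there exist a map D : 𝕊¹ → SL(2,ℝ) whose matrix entries lie in G^s(𝕊¹), constants K > 0, λ > 1, ε = M^{−100} and δ = (1/4)M^{−20} (so δ ≫ ε), and a sequence of maps B_n : 𝕊¹ → SL(2,ℝ) with entries in G^{s,K}(𝕊¹) such that: |B_n − D|_{s,K} → 0 entrywise as n → ∞; L(D) ≥ (1 − 4ε)·log λ; and L(B_n) ≤ (1 − δ)·log λ for every n. In particular, the Lyapunov exponent is discontinuous at D in the G^s-topology. -/

import Mathlib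

open Real MeasureTheory Filter
open scoped ENNReal

noncomputable section

/-- The Gevrey `(s,K)` weighted sup-norm of `f` on the set `I` (valued in `ℝ≥0∞`):
`|f|_{s,K} = (4π²/3) · sup_k (1+k)²/(K^k (k!)^s) · sup_{x∈I} |f^{(k)}(x)|`. -/
def gevreyNormOn (s K : ℝ) (I : Set ℝ) (f : ℝ → ℝ) : ℝ≥0∞ :=
  ⨆ k : ℕ,
    ENNReal.ofReal (4 * π ^ 2 / 3 * ((1 + (k : ℝ)) ^ 2 / (K ^ k * ((k.factorial : ℝ)) ^ s))) *
      ⨆ x ∈ I, ENNReal.ofReal |iteratedDeriv k f x|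

/-- The Gevrey `(s,K)` norm of a function on the circle `𝕊¹ = ℝ/2πℤ`, viewed as a
`2π`-periodic function on `ℝ`. -/
def gevreyNorm (s K : ℝ) (f : ℝ → ℝ) : ℝ≥0∞ := gevreyNormOn s K Set.univ f

/-- `f` belongs to the Gevrey class `G^s(𝕊¹)`: it is smooth, `2π`-periodic and has finite
Gevrey `(s,K)` norm for some `K > 0`. -/
def GevreyCircle (s : ℝ) (f : ℝ → ℝ) : Prop :=
  ContDiff ℝ (⊤ : ℕ∞) f ∧ Function.Periodic f (2 * π) ∧ ∃ K > 0, gevreyNorm s K f < ⊤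

/-- The operator norm of a `2×2` real matrix acting on Euclidean `ℝ²`. -/
def mnorm (A : Matrix (Fin 2) (Fin 2) ℝ) : ℝ :=
  ‖Matrix.toEuclideanCLM (𝕜 := ℝ) A‖

/-- The iterates of the quasiperiodic cocycle `(α, A)`:
`A_n(x) = A(x + 2π(n-1)α) ⋯ A(x + 2πα) A(x)`. -/
def cocycleIter (α : ℝ) (A : ℝ → Matrix (Fin 2) (Fin 2) ℝ) : ℕ → ℝ → Matrix (Fin 2) (Fin 2) ℝ
  | 0, _ => 1
  | n + 1, x => A (x + 2 * π * n * α) * cocycleIter α A n x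

/-- The Lyapunov exponent of the quasiperiodic cocycle `(α, A)`:
`L(A) = inf_{n ≥ 1} (1/n) ∫_{𝕊¹} log ‖A_n(x)‖ dx` (normalized measure on the circle). -/
def lyapunovExp (α : ℝ) (A : ℝ → Matrix (Fin 2) (Fin 2) ℝ) : ℝ :=
  ⨅ n : ℕ, (1 / ((n : ℝ) + 1)) *
    ((2 * π)⁻¹ * ∫ x in (0 : ℝ)..(2 * π), Real.log (mnorm (cocycleIter α A (n + 1) x)))

/-- The denominator `q_n` of the `n`-th continued fraction convergent of `α`. -/
def cfDen (α : ℝ) (n : ℕ) : ℝ := (GenContFract.of α).dens n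

/-- `α` is of bounded type with constant `M`: the continued fraction convergent denominators
satisfy `q_{n+1} ≤ M q_n` for all `n`. -/
def BoundedType (α M : ℝ) : Prop := ∀ n : ℕ, cfDen α (n + 1) ≤ M * cfDen α n

/-- The Schrödinger cocycle map `S_{E,v}(x) = [[E - v x, -1], [1, 0]]`. -/
def schrodingerMap (E : ℝ) (v : ℝ → ℝ) (x : ℝ) : Matrix (Fin 2) (Fin 2) ℝ :=
  !![E - v x, -1; 1, 0]

/-- The weight sequence bounding the derivatives of a Gevrey function. -/
def gevWeight (s K : ℝ) (k : ℕ) : ℝ := K ^ k * (k.factorial : ℝ) ^ s / (16 * (1 + (k : ℝ)) ^ 2)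

/-- `f` is smooth with derivatives bounded by `C` times the Gevrey weight. -/
def GevB (s K C : ℝ) (f : ℝ → ℝ) : Prop :=
  ContDiff ℝ (⊤ : ℕ∞) f ∧ ∀ k x, |iteratedDeriv k f x| ≤ C * gevWeight s K k

lemma gevWeight_nonneg {s K : ℝ} (hK : 0 ≤ K) (k : ℕ) : 0 ≤ gevWeight s K k := by
  unfold gevWeight; positivity

lemma gevWeight_zero (s K : ℝ) : gevWeight s K 0 = 1 / 16 := by
  simp [gevWeight]

lemma sum_inv_sq_le (k : ℕ) :
    ∑ j ∈ Finset.range (k + 1), 1 / (1 + (j : ℝ)) ^ 2 ≤ 2 - 1 / (1 + (k : ℝ)) := by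
  induction k with
  | zero => norm_num
  | succ k ih =>
    rw [Finset.sum_range_succ]
    have h1 : (0 : ℝ) < 1 + k := by positivity
    have h2 : (0 : ℝ) < 1 + (k + 1) := by positivity
    have : 1 / (1 + ((k : ℝ) + 1)) ^ 2 ≤ 1 / (1 + (k : ℝ)) - 1 / (1 + ((k : ℝ) + 1)) := by
      rw [div_sub_div _ _ h1.ne' h2.ne', div_le_div_iff₀ (by positivity) (by positivity)]
      nlinarith
    push_cast
    linarith

lemma sum_inv_sq_mul_le (k : ℕ) :
    ∑ j ∈ Finset.range (k + 1), 1 / ((1 + (j : ℝ)) ^ 2 * (1 + ((k - j : ℕ) : ℝ)) ^ 2)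
      ≤ 8 / (1 + (k : ℝ)) ^ 2 := by
  have hk : (0 : ℝ) ≤ k := by positivity
  have h1 : ∀ j ∈ Finset.range (k + 1),
      1 / ((1 + (j : ℝ)) ^ 2 * (1 + ((k - j : ℕ) : ℝ)) ^ 2) ≤
        2 / (1 + (k : ℝ)) ^ 2 * (1 / (1 + (j : ℝ)) ^ 2 + 1 / (1 + ((k - j : ℕ) : ℝ)) ^ 2) := by
    intro j hj
    have hjk : j ≤ k := by simpa [Nat.lt_succ_iff] using hj
    have hk' : (k : ℝ) = j + (k - j : ℕ) := by rw [Nat.cast_sub hjk]; ring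
    have hb : (0 : ℝ) ≤ ((k - j : ℕ) : ℝ) := Nat.cast_nonneg _
    have ha : (0 : ℝ) ≤ j := Nat.cast_nonneg _
    generalize ((k - j : ℕ) : ℝ) = b at *
    generalize (j : ℝ) = a at *
    rw [hk', div_add_div _ _ (by positivity) (by positivity), div_mul_div_comm,
      div_le_div_iff₀ (by positivity) (by positivity)]
    have : (1 + (a + b)) ^ 2 ≤ 2 * ((1 + b) ^ 2 + (1 + a) ^ 2) := by nlinarith [sq_nonneg (a - b)]
    have h0 : 0 ≤ (1 + a) ^ 2 * (1 + b) ^ 2 := by positivity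
    nlinarith [mul_le_mul_of_nonneg_left this h0]
  refine (Finset.sum_le_sum h1).trans ?_
  rw [← Finset.mul_sum, Finset.sum_add_distrib]
  have h2 : ∑ j ∈ Finset.range (k + 1), 1 / (1 + ((k - j : ℕ) : ℝ)) ^ 2 =
      ∑ j ∈ Finset.range (k + 1), 1 / (1 + (j : ℝ)) ^ 2 := by
    rw [← Finset.sum_range_reflect]
    refine Finset.sum_congr rfl fun j hj => ?_
    have hjk : j ≤ k := by simpa [Nat.lt_succ_iff] using hj
    congr 4
    omega
  rw [h2]
  have h3 := sum_inv_sq_le k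
  have h4 : 0 < 1 / (1 + (k : ℝ)) := by positivity
  calc _ ≤ 2 / (1 + (k : ℝ)) ^ 2 * 4 := by gcongr; linarith
    _ = _ := by ring

lemma choose_mul_factorial_rpow_le {s : ℝ} (hs : 1 ≤ s) {k j : ℕ} (hj : j ≤ k) :
    (k.choose j : ℝ) * ((j.factorial : ℝ) ^ s * ((k - j).factorial : ℝ) ^ s)
      ≤ (k.factorial : ℝ) ^ s := by
  have h : (k.choose j : ℝ) * (j.factorial * (k - j).factorial) = k.factorial := by
    rw [← Nat.choose_mul_factorial_mul_factorial hj]; push_cast; ring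
  have hc : (1 : ℝ) ≤ k.choose j := by exact_mod_cast Nat.choose_pos hj
  rw [← h, Real.mul_rpow (by positivity) (by positivity),
    Real.mul_rpow (by positivity) (by positivity)]
  gcongr
  exact Real.self_le_rpow_of_one_le hc hs

namespace GevB

variable {s K C C₁ C₂ : ℝ} {f g : ℝ → ℝ}

lemma contDiffAt (hf : GevB s K C f) (k : ℕ) (x : ℝ) : ContDiffAt ℝ k f x :=
  (hf.1.of_le (by exact_mod_cast le_top)).contDiffAt

lemma mono (hf : GevB s K C₁ f) (hK : 0 ≤ K) (h : C₁ ≤ C₂) : GevB s K C₂ f :=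
  ⟨hf.1, fun k x => (hf.2 k x).trans (by have := gevWeight_nonneg (s := s) hK k; gcongr)⟩

lemma nonneg (hf : GevB s K C f) : 0 ≤ C := by
  have := (abs_nonneg _).trans (hf.2 0 0)
  rw [gevWeight_zero] at this
  linarith

lemma abs_le (hf : GevB s K C f) (x : ℝ) : |f x| ≤ C / 16 := by
  have := hf.2 0 x
  rw [gevWeight_zero, iteratedDeriv_zero] at this
  linarith

lemma mono_K {K' : ℝ} (hf : GevB s K C f) (hK : 0 ≤ K) (h : K ≤ K') : GevB s K' C f :=
  ⟨hf.1, fun k x => (hf.2 k x).trans (by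
    have := hf.nonneg
    unfold gevWeight
    gcongr)⟩

lemma const (hK : 0 ≤ K) (a : ℝ) : GevB s K (16 * |a|) (fun _ => a) := by
  refine ⟨contDiff_const, fun k x => ?_⟩
  rw [iteratedDeriv_const]
  split_ifs with h
  · subst h; rw [gevWeight_zero]; linarith
  · have := gevWeight_nonneg (s := s) hK k
    simp only [abs_zero]; positivity

lemma add (hf : GevB s K C₁ f) (hg : GevB s K C₂ g) :
    GevB s K (C₁ + C₂) (fun x => f x + g x) := by
  refine ⟨hf.1.add hg.1, fun k x => ?_⟩
  rw [iteratedDeriv_fun_add (hf.contDiffAt k x) (hg.contDiffAt k x), add_mul]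
  exact (abs_add_le _ _).trans (add_le_add (hf.2 k x) (hg.2 k x))

lemma const_mul (hf : GevB s K C f) (a : ℝ) : GevB s K (|a| * C) (fun x => a * f x) := by
  refine ⟨contDiff_const.mul hf.1, fun k x => ?_⟩
  rw [iteratedDeriv_const_mul_field, abs_mul, mul_assoc]
  exact mul_le_mul_of_nonneg_left (hf.2 k x) (abs_nonneg a)

lemma neg (hf : GevB s K C f) : GevB s K C (fun x => - f x) := by
  simpa using hf.const_mul (-1)

lemma sub (hf : GevB s K C₁ f) (hg : GevB s K C₂ g) :
    GevB s K (C₁ + C₂) (fun x => f x - g x) := by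
  simpa [sub_eq_add_neg] using hf.add hg.neg

lemma comp_add_const (hf : GevB s K C f) (a : ℝ) : GevB s K C (fun x => f (x + a)) := by
  refine ⟨hf.1.comp (contDiff_id.add contDiff_const), fun k x => ?_⟩
  rw [iteratedDeriv_comp_add_const]
  exact hf.2 k _

lemma comp_sub_const (hf : GevB s K C f) (a : ℝ) : GevB s K C (fun x => f (x - a)) := by
  simpa [sub_eq_add_neg] using hf.comp_add_const (-a)

lemma comp_mul_left (hf : GevB s K C f) {a : ℝ} (ha : 0 ≤ a) :
    GevB s (a * K) C (fun x => f (a * x)) := by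
  refine ⟨hf.1.comp (contDiff_const.mul contDiff_id), fun k x => ?_⟩
  rw [iteratedDeriv_comp_const_mul (hf.1.of_le (by exact_mod_cast le_top))]
  rw [abs_mul, abs_pow, abs_of_nonneg ha]
  calc a ^ k * |iteratedDeriv k f (a * x)| ≤ a ^ k * (C * gevWeight s K k) := by
        gcongr; exact hf.2 k _
    _ = _ := by unfold gevWeight; rw [mul_pow]; ring

lemma sum {ι : Type*} (I : Finset ι) {F : ι → ℝ → ℝ} {c : ι → ℝ}
    (hK : 0 ≤ K) (h : ∀ i ∈ I, GevB s K (c i) (F i)) :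
    GevB s K (∑ i ∈ I, c i) (fun x => ∑ i ∈ I, F i x) := by
  classical
  induction I using Finset.induction_on with
  | empty => simpa using GevB.const (s := s) hK 0
  | insert a I ha ih =>
    simp only [Finset.sum_insert ha]
    exact (h a (by simp)).add (ih fun i hi => h i (by simp [hi]))

lemma weight_conv (hs : 1 ≤ s) (hK : 0 ≤ K) (k : ℕ) :
    ∑ j ∈ Finset.range (k + 1), (k.choose j : ℝ) * (gevWeight s K j * gevWeight s K (k - j))
      ≤ gevWeight s K k / 2 := by
  have h1 : ∀ j ∈ Finset.range (k + 1),
      (k.choose j : ℝ) * (gevWeight s K j * gevWeight s K (k - j)) ≤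
      (K ^ k * (k.factorial : ℝ) ^ s / 256) *
        (1 / ((1 + (j : ℝ)) ^ 2 * (1 + ((k - j : ℕ) : ℝ)) ^ 2)) := by
    intro j hj
    have hjk : j ≤ k := by simpa [Nat.lt_succ_iff] using hj
    have := choose_mul_factorial_rpow_le hs hjk
    have hKp : K ^ k = K ^ j * K ^ (k - j) := by rw [← pow_add]; congr 1; omega
    unfold gevWeight
    calc _ = (K ^ j * K ^ (k - j) * ((k.choose j : ℝ) * ((j.factorial : ℝ) ^ s *
            ((k - j).factorial : ℝ) ^ s)) / 256) *
          (1 / ((1 + (j : ℝ)) ^ 2 * (1 + ((k - j : ℕ) : ℝ)) ^ 2)) := by field_simp; ring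
      _ ≤ _ := by rw [hKp]; gcongr
  refine (Finset.sum_le_sum h1).trans ?_
  rw [← Finset.mul_sum]
  calc _ ≤ (K ^ k * (k.factorial : ℝ) ^ s / 256) * (8 / (1 + (k : ℝ)) ^ 2) := by
        gcongr; exact sum_inv_sq_mul_le k
    _ = _ := by unfold gevWeight; field_simp; ring

lemma mul (hs : 1 ≤ s) (hK : 0 ≤ K) (hf : GevB s K C₁ f) (hg : GevB s K C₂ g) :
    GevB s K (C₁ * C₂ / 2) (fun x => f x * g x) := by
  refine ⟨hf.1.mul hg.1, fun k x => ?_⟩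
  have h := iteratedDeriv_mul (hf.contDiffAt k x) (hg.contDiffAt k x)
  have hC₁ := hf.nonneg
  have hC₂ := hg.nonneg
  change |iteratedDeriv k (f * g) x| ≤ _
  rw [h]
  refine (Finset.abs_sum_le_sum_abs _ _).trans ?_
  calc _ ≤ ∑ j ∈ Finset.range (k + 1),
        C₁ * C₂ * ((k.choose j : ℝ) * (gevWeight s K j * gevWeight s K (k - j))) := by
        refine Finset.sum_le_sum fun j _ => ?_
        rw [abs_mul, abs_mul, Nat.abs_cast]
        have := gevWeight_nonneg (s := s) hK j
        calc _ ≤ (k.choose j : ℝ) * (C₁ * gevWeight s K j) * (C₂ * gevWeight s K (k - j)) := by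
              gcongr
              · exact hf.2 j x
              · exact hg.2 _ x
          _ = _ := by ring
    _ ≤ _ := by
        rw [← Finset.mul_sum]
        calc _ ≤ C₁ * C₂ * (gevWeight s K k / 2) := by gcongr; exact weight_conv hs hK k
          _ = _ := by ring

lemma exp_of_le_two (hs : 1 ≤ s) (hK : 0 ≤ K) (hf : GevB s K C f) (hC : C ≤ 2) :
    GevB s K 20 (fun x => Real.exp (f x)) := by
  have hC0 := hf.nonneg
  refine ⟨Real.contDiff_exp.comp hf.1, fun k => ?_⟩
  induction k using Nat.strong_induction_on with
  | _ k ih =>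
  intro x
  rcases k with _ | k
  · rw [gevWeight_zero, iteratedDeriv_zero, Real.abs_exp]
    have h1 := (abs_le hf x)
    have h2 : f x ≤ 1 / 8 := by linarith [le_abs_self (f x)]
    have h3 : Real.exp (1 / 8) ≤ 1.2 := by
      have := Real.exp_bound' (x := 1 / 8) (by norm_num) (by norm_num) (n := 2) (by norm_num)
      norm_num [Finset.sum_range_succ, Nat.factorial] at this
      norm_num
      linarith
    linarith [Real.exp_le_exp.2 h2]
  · have hd : deriv (fun x => Real.exp (f x)) = deriv f * fun x => Real.exp (f x) := by
      ext y
      have : DifferentiableAt ℝ f y := (hf.1.differentiable (by simp)) y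
      simp [deriv_exp this, mul_comm]
    have hdf : ContDiffAt ℝ k (deriv f) x := by
      have : ContDiff ℝ (⊤ : ℕ∞) (deriv f) := by
        have h : ContDiff ℝ ((⊤ : ℕ∞) + 1) f := by simpa using hf.1
        exact h.deriv'
      exact (this.of_le (by exact_mod_cast le_top)).contDiffAt
    have hE : ContDiffAt ℝ k (fun x => Real.exp (f x)) x :=
      ((Real.contDiff_exp.comp hf.1).of_le (by exact_mod_cast le_top)).contDiffAt
    rw [iteratedDeriv_succ', hd, iteratedDeriv_mul hdf hE]
    refine (Finset.abs_sum_le_sum_abs _ _).trans ?_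
    calc _ ≤ ∑ j ∈ Finset.range (k + 1), C * 20 * (((k + 1).choose (j + 1) : ℝ) *
          (gevWeight s K (j + 1) * gevWeight s K (k + 1 - (j + 1)))) := by
          refine Finset.sum_le_sum fun j hj => ?_
          have hjk : j ≤ k := by simpa [Nat.lt_succ_iff] using hj
          rw [abs_mul, abs_mul, Nat.abs_cast, ← iteratedDeriv_succ']
          have := gevWeight_nonneg (s := s) hK (j + 1)
          have hch : (k.choose j : ℝ) ≤ ((k + 1).choose (j + 1) : ℝ) := by
            rw [Nat.choose_succ_succ']; push_cast
            have : (0 : ℝ) ≤ (k.choose (j + 1) : ℝ) := by positivity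
            linarith
          calc _ ≤ ((k + 1).choose (j + 1) : ℝ) * (C * gevWeight s K (j + 1)) *
                (20 * gevWeight s K (k + 1 - (j + 1))) := by
                gcongr
                · exact hf.2 _ x
                · rw [Nat.add_sub_add_right]; exact ih _ (by omega) x
            _ = _ := by ring
      _ ≤ ∑ j ∈ Finset.range (k + 1 + 1), C * 20 * (((k + 1).choose j : ℝ) *
          (gevWeight s K j * gevWeight s K (k + 1 - j))) := by
          rw [Finset.sum_range_succ' _ (k + 1)]
          have h0 := gevWeight_nonneg (s := s) hK (k + 1 - 0)
          have h1 := gevWeight_nonneg (s := s) hK 0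
          have : 0 ≤ C * 20 * (((k + 1).choose 0 : ℝ) *
            (gevWeight s K 0 * gevWeight s K (k + 1 - 0))) := by positivity
          linarith
      _ ≤ C * 20 * (gevWeight s K (k + 1) / 2) := by
          rw [← Finset.mul_sum]; gcongr; exact weight_conv hs hK _
      _ ≤ _ := by
          have := gevWeight_nonneg (s := s) hK (k + 1)
          nlinarith

lemma pow_succ_bound (hs : 1 ≤ s) (hK : 0 ≤ K) (hf : GevB s K C f) (n : ℕ) :
    GevB s K (C ^ (n + 1)) (fun x => f x ^ (n + 1)) := by
  have hC := hf.nonneg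
  induction n with
  | zero => simpa using hf
  | succ n ih =>
    have := (ih.mul hs hK hf).mono hK (C₂ := C ^ (n + 1 + 1)) (by
      rw [pow_succ C (n + 1)]
      have : 0 ≤ C ^ (n + 1) * C := by positivity
      linarith)
    simpa only [pow_succ _ (n + 1)] using this

lemma exp (hs : 1 ≤ s) (hK : 0 ≤ K) (hf : GevB s K C f) :
    GevB s K (Real.exp (3 * (C + 1))) (fun x => Real.exp (f x)) := by
  have hC := hf.nonneg
  set N := ⌊C⌋₊
  have hN : (N : ℝ) ≤ C := Nat.floor_le hC
  have hN' : C < N + 1 := Nat.lt_floor_add_one C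
  have hpos : (0 : ℝ) < N + 1 := by positivity
  have h1 := (hf.const_mul (1 / ((N : ℝ) + 1)))
  have h2 : |1 / ((N : ℝ) + 1)| * C ≤ 2 := by
    rw [abs_of_pos (by positivity), div_mul_eq_mul_div, one_mul, div_le_iff₀ hpos]
    linarith
  have h3 := (h1.exp_of_le_two hs hK h2).pow_succ_bound hs hK N
  have h4 : (fun x => Real.exp (1 / ((N : ℝ) + 1) * f x) ^ (N + 1)) = fun x => Real.exp (f x) := by
    ext x
    rw [← Real.exp_nat_mul]
    push_cast
    congr 1
    field_simp
  rw [h4] at h3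
  refine h3.mono hK ?_
  have h5 : (20 : ℝ) ≤ Real.exp 3 := by
    have := Real.exp_one_gt_d9
    have h : Real.exp 3 = Real.exp 1 ^ 3 := by rw [← Real.exp_nat_mul]; norm_num
    rw [h]
    calc (20 : ℝ) ≤ 2.7182818283 ^ 3 := by norm_num
      _ ≤ _ := by gcongr
  calc (20 : ℝ) ^ (N + 1) ≤ Real.exp 3 ^ (N + 1) := by gcongr
    _ = Real.exp (3 * (N + 1)) := by rw [← Real.exp_nat_mul]; push_cast; ring_nf
    _ ≤ _ := by gcongr

lemma disjoint_sum {ι : Type*} (I : Finset ι) {F : ι → ℝ → ℝ} (hK : 0 ≤ K) (hC : 0 ≤ C)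
    (h : ∀ i ∈ I, GevB s K C (F i))
    (hd : ∀ x, ∀ i ∈ I, ∀ j ∈ I, i ≠ j → F i =ᶠ[nhds x] 0 ∨ F j =ᶠ[nhds x] 0) :
    GevB s K C (fun x => ∑ i ∈ I, F i x) := by
  classical
  refine ⟨ContDiff.sum fun i hi => (h i hi).1, fun k x => ?_⟩
  rw [iteratedDeriv_fun_sum fun i hi => (h i hi).contDiffAt k x]
  have hw := gevWeight_nonneg (s := s) hK k
  by_cases hx : ∃ i ∈ I, ¬ F i =ᶠ[nhds x] 0
  · obtain ⟨i, hi, hne⟩ := hx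
    rw [Finset.sum_eq_single_of_mem i hi]
    · exact (h i hi).2 k x
    · intro j hj hji
      have := (hd x i hi j hj hji.symm).resolve_left hne
      rw [this.iteratedDeriv_eq k]
      simp
  · push Not at hx
    rw [Finset.sum_eq_zero]
    · simp only [abs_zero]; positivity
    · intro j hj
      rw [(hx j hj).iteratedDeriv_eq k]
      simp

/-- Passing to a larger Gevrey exponent normalises the Gevrey radius. -/
lemma convert {s' K' : ℝ} (hs' : s' < s) (hK' : 0 ≤ K') (hf : GevB s' K' C f) :
    GevB s 1 (C * Real.exp ((s - s') * K' ^ (1 / (s - s')))) f := by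
  refine ⟨hf.1, fun k x => (hf.2 k x).trans ?_⟩
  have hC := hf.nonneg
  have hd : 0 < s - s' := sub_pos.2 hs'
  rw [mul_assoc]
  refine mul_le_mul_of_nonneg_left ?_ hC
  unfold gevWeight
  have hfac : (0 : ℝ) < k.factorial := by exact_mod_cast k.factorial_pos
  rw [← mul_div_assoc]
  refine div_le_div_of_nonneg_right ?_ (by positivity)
  rw [one_pow, one_mul]
  set y := K' ^ (1 / (s - s')) with hy
  have hy0 : 0 ≤ y := by positivity
  have h1 : y ^ k / k.factorial ≤ Real.exp y := Real.pow_div_factorial_le_exp y hy0 k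
  have h2 : y ^ (s - s') = K' := by
    rw [hy, ← Real.rpow_mul hK', one_div_mul_cancel hd.ne', Real.rpow_one]
  have h3 : K' ^ k = (y ^ k) ^ (s - s') := by
    conv_lhs => rw [← h2]
    rw [← Real.rpow_natCast (y ^ (s - s')), ← Real.rpow_natCast y, ← Real.rpow_mul hy0,
      ← Real.rpow_mul hy0, mul_comm]
  have h4 : Real.exp ((s - s') * y) = Real.exp y ^ (s - s') := by
    rw [← Real.exp_mul, mul_comm]
  have h5 : (k.factorial : ℝ) ^ s = (k.factorial : ℝ) ^ s' * (k.factorial : ℝ) ^ (s - s') := by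
    rw [← Real.rpow_add hfac]; congr 1; ring
  rw [h3, h4, h5]
  have h6 : (y ^ k) ^ (s - s') ≤ Real.exp y ^ (s - s') * (k.factorial : ℝ) ^ (s - s') := by
    rw [← Real.mul_rpow (by positivity) (by positivity)]
    gcongr
    rwa [div_le_iff₀ hfac] at h1
  calc _ ≤ (Real.exp y ^ (s - s') * (k.factorial : ℝ) ^ (s - s')) * (k.factorial : ℝ) ^ s' := by
        gcongr
    _ = _ := by ring

end GevB

/-- The flat function `exp (-x⁻ᵇ)` on `x > 0`, extended by zero. -/
def flatFun (b : ℕ) (x : ℝ) : ℝ := expNegInvGlue (x ^ (2 * b + 1))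

lemma flatFun_nonneg (b : ℕ) (x : ℝ) : 0 ≤ flatFun b x := expNegInvGlue.nonneg _

lemma flatFun_of_nonpos (b : ℕ) {x : ℝ} (hx : x ≤ 0) : flatFun b x = 0 :=
  expNegInvGlue.zero_of_nonpos (Odd.pow_nonpos ⟨b, rfl⟩ hx)

lemma flatFun_pos (b : ℕ) {x : ℝ} (hx : 0 < x) : 0 < flatFun b x :=
  expNegInvGlue.pos_of_pos (by positivity)

lemma flatFun_contDiff (b : ℕ) : ContDiff ℝ (⊤ : ℕ∞) (flatFun b) :=
  expNegInvGlue.contDiff.comp (contDiff_id.pow _)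

/-- The holomorphic extension of `flatFun`. -/
def flatFunC (b : ℕ) (z : ℂ) : ℂ := Complex.exp (-(z ^ (2 * b + 1))⁻¹)

lemma flatFunC_ofReal (b : ℕ) {x : ℝ} (hx : 0 < x) : (flatFunC b x).re = flatFun b x := by
  have h : ¬ x ^ (2 * b + 1) ≤ 0 := not_le.2 (by positivity)
  unfold flatFunC flatFun expNegInvGlue
  rw [if_neg h, ← Complex.ofReal_pow, ← Complex.ofReal_inv, ← Complex.ofReal_neg,
    ← Complex.ofReal_exp, Complex.ofReal_re]

lemma flatFunC_analyticAt (b : ℕ) {z : ℂ} (hz : z ≠ 0) : AnalyticAt ℂ (flatFunC b) z := by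
  unfold flatFunC
  have : z ^ (2 * b + 1) ≠ 0 := pow_ne_zero _ hz
  fun_prop (disch := assumption)

lemma iteratedDeriv_flatFun (b k : ℕ) :
    ∀ x : ℝ, 0 < x → iteratedDeriv k (flatFun b) x = (iteratedDeriv k (flatFunC b) x).re := by
  induction k with
  | zero => intro x hx; simp [flatFunC_ofReal b hx]
  | succ k ih =>
    intro x hx
    have hx' : (x : ℂ) ≠ 0 := by exact_mod_cast hx.ne'
    rw [iteratedDeriv_succ, iteratedDeriv_succ]
    have hev : iteratedDeriv k (flatFun b) =ᶠ[nhds x]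
        fun x : ℝ => (iteratedDeriv k (flatFunC b) x).re := by
      filter_upwards [lt_mem_nhds hx] with y hy using ih y hy
    rw [hev.deriv_eq]
    have han : AnalyticAt ℂ (iteratedDeriv k (flatFunC b)) x := by
      rw [iteratedDeriv_eq_iterate]
      exact (flatFunC_analyticAt b hx').iterated_deriv k
    exact (han.differentiableAt.hasDerivAt.real_of_complex).deriv

lemma exists_radius (b : ℕ) : ∃ c : ℝ, 0 < c ∧ c < 1 ∧
    ∀ w : ℂ, ‖w‖ ≤ c → 1 / 2 ≤ (((1 + w) ^ (2 * b + 1))⁻¹).re := by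
  have hc : ContinuousAt (fun w : ℂ => (((1 + w) ^ (2 * b + 1))⁻¹).re) 0 := by
    refine Complex.continuous_re.continuousAt.comp ?_
    refine ContinuousAt.inv₀ (by fun_prop) (by simp)
  have h1 : ∀ᶠ w in nhds (0 : ℂ), 1 / 2 < (((1 + w) ^ (2 * b + 1))⁻¹).re := by
    refine hc.eventually_const_lt ?_
    norm_num
  obtain ⟨ε, hε, h⟩ := Metric.eventually_nhds_iff.1 h1
  refine ⟨min (ε / 2) (1 / 2), by positivity, by
    exact (min_le_right _ _).trans_lt (by norm_num), fun w hw => (h ?_).le⟩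
  rw [dist_zero_right]
  exact (hw.trans (min_le_left _ _)).trans_lt (by linarith)

lemma pow_mul_exp_neg_le (b k : ℕ) {x : ℝ} (hx : 0 < x) :
    (x⁻¹) ^ k * Real.exp (-((x ^ (2 * b + 1))⁻¹ / 2)) ≤
      2 ^ k * (k.factorial : ℝ) ^ (1 / ((2 * b + 1 : ℕ) : ℝ)) := by
  set n := 2 * b + 1 with hn
  have hn1 : (1 : ℝ) ≤ (n : ℝ) := by exact_mod_cast (by omega : 1 ≤ n)
  set y := (x ^ n)⁻¹ / 2 with hy
  have hy0 : 0 < y := by positivity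
  have h1 : y ^ k / k.factorial ≤ Real.exp y := Real.pow_div_factorial_le_exp y hy0.le k
  have hfac : (0 : ℝ) < k.factorial := by exact_mod_cast k.factorial_pos
  have h2 : ((x⁻¹) ^ k * Real.exp (-y)) ^ n ≤ (2 ^ k * (k.factorial : ℝ) ^ (1 / (n : ℝ))) ^ n := by
    have e1 : ((k.factorial : ℝ) ^ (1 / (n : ℝ))) ^ n = k.factorial := by
      rw [← Real.rpow_natCast, ← Real.rpow_mul hfac.le, one_div_mul_cancel (by positivity),
        Real.rpow_one]
    have e2 : ((x⁻¹) ^ k) ^ n = 2 ^ k * y ^ k := by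
      rw [← mul_pow, ← pow_mul, mul_comm k n, pow_mul, inv_pow]
      congr 1; rw [hy]; ring
    rw [mul_pow, mul_pow, e1, e2]
    have e3 : Real.exp (-y) ^ n ≤ Real.exp (-y) := by
      refine pow_le_of_le_one (Real.exp_pos _).le ?_ (by omega)
      rw [Real.exp_le_one_iff]; linarith
    have e4 : (2 : ℝ) ^ k ≤ (2 ^ k) ^ n := le_self_pow₀ (one_le_pow₀ (by norm_num)) (by omega)
    have e5 : y ^ k * Real.exp (-y) ≤ k.factorial := by
      rw [Real.exp_neg, ← div_eq_mul_inv, div_le_iff₀ (Real.exp_pos _)]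
      rw [div_le_iff₀ hfac] at h1
      linarith
    calc 2 ^ k * y ^ k * Real.exp (-y) ^ n ≤ 2 ^ k * y ^ k * Real.exp (-y) := by gcongr
      _ = 2 ^ k * (y ^ k * Real.exp (-y)) := by ring
      _ ≤ _ := by gcongr
  exact le_of_pow_le_pow_left₀ (by omega) (by positivity) h2

lemma flatFun_bound (b : ℕ) : ∃ L : ℝ, 1 ≤ L ∧ ∀ k x,
    |iteratedDeriv k (flatFun b) x| ≤
      L ^ k * (k.factorial : ℝ) ^ (1 + 1 / ((2 * b + 1 : ℕ) : ℝ)) := by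
  obtain ⟨c, hc, hc1, hrad⟩ := exists_radius b
  refine ⟨2 / c, by rw [le_div_iff₀ hc]; linarith, fun k => ?_⟩
  have hfac : (0 : ℝ) < k.factorial := by exact_mod_cast k.factorial_pos
  have hpos : ∀ x : ℝ, 0 < x → |iteratedDeriv k (flatFun b) x| ≤
      (2 / c) ^ k * (k.factorial : ℝ) ^ (1 + 1 / ((2 * b + 1 : ℕ) : ℝ)) := by
    intro x hx
    have hcx : 0 < c * x := by positivity
    have hne : ∀ z ∈ Metric.closedBall (x : ℂ) (c * x), z ≠ 0 := by
      rintro z hz rfl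
      rw [Metric.mem_closedBall, dist_comm, dist_zero_right, Complex.norm_real,
        Real.norm_of_nonneg hx.le] at hz
      nlinarith
    have hd : DiffContOnCl ℂ (flatFunC b) (Metric.ball (x : ℂ) (c * x)) := by
      refine DifferentiableOn.diffContOnCl fun z hz => ?_
      exact (flatFunC_analyticAt b (hne z
        (Metric.closure_ball_subset_closedBall hz))).differentiableAt.differentiableWithinAt
    have hb : ∀ z ∈ Metric.sphere (x : ℂ) (c * x),
        ‖flatFunC b z‖ ≤ Real.exp (-((x ^ (2 * b + 1))⁻¹ / 2)) := by
      intro z hz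
      unfold flatFunC
      rw [Complex.norm_exp, Real.exp_le_exp, Complex.neg_re, neg_le_neg_iff]
      have hxc : (x : ℂ) ≠ 0 := by exact_mod_cast hx.ne'
      have hz' : z = x * (1 + (z - x) / x) := by field_simp; ring
      have hw : ‖(z - x) / x‖ ≤ c := by
        rw [mem_sphere_iff_norm] at hz
        rw [norm_div, hz, Complex.norm_real, Real.norm_of_nonneg hx.le]
        exact (mul_div_cancel_right₀ c hx.ne').le
      have := hrad _ hw
      rw [hz', mul_pow, mul_inv, ← Complex.ofReal_pow, ← Complex.ofReal_inv, Complex.re_ofReal_mul]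
      have h0 : 0 < (x ^ (2 * b + 1))⁻¹ := by positivity
      nlinarith
    have hC := Complex.norm_iteratedDeriv_le_of_forall_mem_sphere_norm_le k hcx hd hb
    rw [iteratedDeriv_flatFun b k x hx]
    refine (Complex.abs_re_le_norm _).trans (hC.trans ?_)
    have h1 := pow_mul_exp_neg_le b k hx
    rw [Real.rpow_add hfac, Real.rpow_one]
    calc _ = k.factorial * (c⁻¹ ^ k * ((x⁻¹) ^ k * Real.exp (-((x ^ (2 * b + 1))⁻¹ / 2)))) := by
          rw [mul_pow, inv_pow, inv_pow]; field_simp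
      _ ≤ k.factorial * (c⁻¹ ^ k * (2 ^ k * (k.factorial : ℝ) ^ (1 / ((2 * b + 1 : ℕ) : ℝ)))) := by
          gcongr
      _ = _ := by rw [div_pow, inv_pow]; ring
  have hneg : ∀ x : ℝ, x < 0 → iteratedDeriv k (flatFun b) x = 0 := by
    intro x hx
    have : flatFun b =ᶠ[nhds x] fun _ => 0 := by
      filter_upwards [gt_mem_nhds hx] with y hy using flatFun_of_nonpos b hy.le
    rw [this.iteratedDeriv_eq k]; simp
  intro x
  rcases lt_trichotomy x 0 with h | h | h
  · rw [hneg x h, abs_zero]; positivity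
  · subst h
    have hcont : Continuous (iteratedDeriv k (flatFun b)) :=
      (flatFun_contDiff b).continuous_iteratedDeriv k (by exact_mod_cast le_top)
    have h2 : Tendsto (iteratedDeriv k (flatFun b)) (nhdsWithin 0 (Set.Iio 0))
        (nhds (iteratedDeriv k (flatFun b) 0)) := hcont.continuousAt.continuousWithinAt
    have h3 : Tendsto (iteratedDeriv k (flatFun b)) (nhdsWithin 0 (Set.Iio 0)) (nhds 0) := by
      refine tendsto_const_nhds.congr' ?_
      filter_upwards [self_mem_nhdsWithin] with y hy using (hneg y hy).symm
    rw [tendsto_nhds_unique h2 h3, abs_zero]; positivity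
  · exact hpos x h

lemma GevB.of_bound {s L A : ℝ} {f : ℝ → ℝ} (hL : 0 ≤ L) (hA : 0 ≤ A)
    (hf : ContDiff ℝ (⊤ : ℕ∞) f)
    (h : ∀ k x, |iteratedDeriv k f x| ≤ A * (L ^ k * (k.factorial : ℝ) ^ s)) :
    GevB s (4 * L) (16 * A) f := by
  refine ⟨hf, fun k x => (h k x).trans ?_⟩
  have h2 : 1 + (k : ℝ) ≤ 2 ^ k := by
    have := Nat.lt_two_pow_self (n := k)
    exact_mod_cast (by omega : 1 + k ≤ 2 ^ k)
  have h4 : (1 + (k : ℝ)) ^ 2 ≤ 4 ^ k := by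
    calc (1 + (k : ℝ)) ^ 2 ≤ (2 ^ k) ^ 2 := by gcongr
      _ = 4 ^ k := by rw [← pow_mul, mul_comm, pow_mul]; norm_num
  unfold gevWeight
  rw [mul_pow]
  have h0 : 0 ≤ A * (L ^ k * (k.factorial : ℝ) ^ s) := by positivity
  calc A * (L ^ k * (k.factorial : ℝ) ^ s)
      ≤ A * (L ^ k * (k.factorial : ℝ) ^ s) * (4 ^ k / (1 + (k : ℝ)) ^ 2) := by
        refine le_mul_of_one_le_right h0 ?_
        rwa [one_le_div (by positivity)]
    _ = _ := by field_simp

lemma GevB.comp_neg {s K C : ℝ} {f : ℝ → ℝ} (hf : GevB s K C f) :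
    GevB s K C (fun x => f (-x)) := by
  refine ⟨hf.1.comp contDiff_neg, fun k x => ?_⟩
  rw [iteratedDeriv_comp_neg]
  simpa [abs_mul] using hf.2 k (-x)

lemma GevB.mono_s {s s' K C : ℝ} {f : ℝ → ℝ} (hf : GevB s K C f) (hK : 0 ≤ K) (h : s ≤ s') :
    GevB s' K C f :=
  ⟨hf.1, fun k x => (hf.2 k x).trans (by
    have := hf.nonneg
    have : (1 : ℝ) ≤ k.factorial := by exact_mod_cast k.factorial_pos
    unfold gevWeight
    gcongr)⟩

lemma GevB.of_deriv {s K C A : ℝ} {f g : ℝ → ℝ} (hs : 1 ≤ s) (hK : 1 ≤ K)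
    (hA : ∀ x, |f x| ≤ A) (hd : ∀ x, HasDerivAt f (g x) x) (hg : GevB s K C g) :
    GevB s K (16 * A + 4 * C) f := by
  have hA0 : 0 ≤ A := (abs_nonneg _).trans (hA 0)
  have hC := hg.nonneg
  have hfd : deriv f = g := funext fun x => (hd x).deriv
  refine ⟨?_, fun k x => ?_⟩
  · have : ContDiff ℝ ((⊤ : ℕ∞) + 1) f := by
      rw [contDiff_succ_iff_deriv]
      refine ⟨fun x => (hd x).differentiableAt, by simp, by rw [hfd]; exact hg.1⟩
    simpa using this
  · rcases k with _ | k
    · rw [iteratedDeriv_zero, gevWeight_zero]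
      have := hA x
      linarith
    · rw [iteratedDeriv_succ', hfd]
      have hw : gevWeight s K k ≤ 4 * gevWeight s K (k + 1) := by
        unfold gevWeight
        rw [Nat.factorial_succ]
        push_cast
        rw [Real.mul_rpow (by positivity) (by positivity), pow_succ, ← mul_div_assoc,
          div_le_div_iff₀ (by positivity) (by positivity)]
        have h1 : (1 : ℝ) ≤ ((k : ℝ) + 1) ^ s := Real.one_le_rpow (by simp) (by linarith)
        have h2 : (1 + ((k : ℝ) + 1)) ^ 2 ≤ 4 * (1 + (k : ℝ)) ^ 2 := by
          have : (0 : ℝ) ≤ k := by positivity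
          nlinarith
        have h3 : 0 ≤ K ^ k * (k.factorial : ℝ) ^ s := by positivity
        have h4 : 1 ≤ K * ((k : ℝ) + 1) ^ s := one_le_mul_of_one_le_of_one_le hK h1
        calc _ = 16 * (K ^ k * (k.factorial : ℝ) ^ s) * (1 + ((k : ℝ) + 1)) ^ 2 * 1 := by ring
          _ ≤ 16 * (K ^ k * (k.factorial : ℝ) ^ s) * (4 * (1 + (k : ℝ)) ^ 2) *
              (K * ((k : ℝ) + 1) ^ s) := by gcongr
          _ = _ := by ring
      refine (hg.2 k x).trans ?_
      have h0 := gevWeight_nonneg (s := s) (by linarith : (0:ℝ) ≤ K) (k + 1)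
      calc C * gevWeight s K k ≤ C * (4 * gevWeight s K (k + 1)) := by gcongr
        _ ≤ _ := by nlinarith

lemma exists_step {s : ℝ} (hs : 1 < s) {d : ℝ} (hd : 0 < d) :
    ∃ (Ψ : ℝ → ℝ) (K C : ℝ), 1 ≤ K ∧ GevB s K C Ψ ∧ (∀ t, 0 ≤ Ψ t ∧ Ψ t ≤ 1) ∧
      (∀ t ≤ 0, Ψ t = 0) ∧ (∀ t, d ≤ t → Ψ t = 1) := by
  obtain ⟨b, hb⟩ := exists_nat_one_div_lt (sub_pos.2 hs)
  obtain ⟨L, hL, hbd⟩ := flatFun_bound b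
  have hf0 : GevB (1 + 1 / ((2 * b + 1 : ℕ) : ℝ)) (4 * L) (16 * 1) (flatFun b) :=
    GevB.of_bound (by linarith) (by norm_num) (flatFun_contDiff b) (by simpa using hbd)
  have hK0 : 0 ≤ 4 * L := by linarith
  have hf : GevB s (4 * L) (16 * 1) (flatFun b) := by
    refine hf0.mono_s hK0 ?_
    have : (1 : ℝ) / ((2 * b + 1 : ℕ) : ℝ) ≤ 1 / ((b : ℝ) + 1) := by
      push_cast
      gcongr
      linarith [(Nat.cast_nonneg b : (0 : ℝ) ≤ b)]
    linarith
  set g : ℝ → ℝ := fun t => flatFun b t * flatFun b (-(t - d)) with hg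
  have hgG : GevB s (4 * L) (16 * 1 * (16 * 1) / 2) g :=
    hf.mul hs.le hK0 (hf.comp_neg.comp_sub_const d)
  have hgc : Continuous g := hgG.1.continuous
  have hg0 : ∀ t, 0 ≤ g t := fun t => mul_nonneg (flatFun_nonneg b _) (flatFun_nonneg b _)
  have hgi : ∀ u v, IntervalIntegrable g volume u v := fun u v => hgc.intervalIntegrable u v
  set c := ∫ t in (0 : ℝ)..d, g t with hc
  have hcpos : 0 < c := by
    refine intervalIntegral.intervalIntegral_pos_of_pos_on (hgi _ _) (fun t ht => ?_) hd
    exact mul_pos (flatFun_pos b ht.1) (flatFun_pos b (by linarith [ht.2]))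
  set Ψ : ℝ → ℝ := fun t => c⁻¹ * ∫ u in (0 : ℝ)..t, g u with hΨ
  have hzero : ∀ t ≤ 0, Ψ t = 0 := by
    intro t ht
    have : ∫ u in (0 : ℝ)..t, g u = ∫ u in (0 : ℝ)..t, (0 : ℝ) := by
      refine intervalIntegral.integral_congr fun u hu => ?_
      rw [Set.uIcc_of_ge ht] at hu
      simp [hg, flatFun_of_nonpos b hu.2]
    simp [hΨ, this]
  have hone : ∀ t, d ≤ t → Ψ t = 1 := by
    intro t ht
    have h1 : ∫ u in d..t, g u = ∫ u in d..t, (0 : ℝ) := by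
      refine intervalIntegral.integral_congr fun u hu => ?_
      rw [Set.uIcc_of_le ht] at hu
      rw [hg]
      simp only [flatFun_of_nonpos b (by linarith [hu.1] : -(u - d) ≤ 0), mul_zero]
    have h2 := intervalIntegral.integral_add_adjacent_intervals (hgi 0 d) (hgi d t)
    simp only [hΨ]
    rw [← h2, h1]
    simp [← hc, hcpos.ne']
  have hder : ∀ t, HasDerivAt Ψ (c⁻¹ * g t) t := fun t =>
    (intervalIntegral.integral_hasDerivAt_right (hgi 0 t)
      hgc.aestronglyMeasurable.stronglyMeasurableAtFilter hgc.continuousAt).const_mul _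
  have hmono : Monotone Ψ := by
    refine monotone_of_deriv_nonneg (fun t => (hder t).differentiableAt) fun t => ?_
    rw [(hder t).deriv]
    exact mul_nonneg (inv_nonneg.2 hcpos.le) (hg0 t)
  have hrange : ∀ t, 0 ≤ Ψ t ∧ Ψ t ≤ 1 := by
    intro t
    constructor
    · rw [← hzero (min t 0) (min_le_right _ _)]; exact hmono (min_le_left _ _)
    · rw [← hone (max t d) (le_max_right _ _)]; exact hmono (le_max_left _ _)
  refine ⟨Ψ, 4 * L, _, by linarith, GevB.of_deriv hs.le (by linarith) (A := 1) (fun t => ?_) hder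
    (hgG.const_mul c⁻¹), hrange, hzero, hone⟩
  rw [abs_of_nonneg (hrange t).1]; exact (hrange t).2

lemma exists_bump {s : ℝ} (hs : 1 < s) {θ : ℝ} (hθ : θ < 1) :
    ∃ (χ : ℝ → ℝ) (R : ℝ), 1 ≤ R ∧ GevB s R 16 χ ∧ (∀ t, 0 ≤ χ t ∧ χ t ≤ 1) ∧
      (∀ t, |t| ≤ θ → χ t = 1) ∧ (∀ t, 1 ≤ |t| → χ t = 0) := by
  obtain ⟨Ψ, K, C, hK, hΨ, hr, h0, h1⟩ := exists_step hs (sub_pos.2 hθ)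
  have hK0 : 0 ≤ K := by linarith
  have hC := hΨ.nonneg
  set χ : ℝ → ℝ := fun t => Ψ (-t + 1) * Ψ (t + 1) with hχ
  have hG : GevB s K (C * C / 2) χ :=
    (hΨ.comp_add_const 1).comp_neg.mul hs.le hK0 (hΨ.comp_add_const 1)
  have hrange : ∀ t, 0 ≤ χ t ∧ χ t ≤ 1 := fun t =>
    ⟨mul_nonneg (hr _).1 (hr _).1, mul_le_one₀ (hr _).2 (hr _).1 (hr _).2⟩
  refine ⟨χ, K * (1 + C * C / 2), ?_, ⟨hG.1, fun k x => ?_⟩, hrange, fun t ht => ?_, fun t ht => ?_⟩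
  · have : 0 ≤ C * C / 2 := by positivity
    nlinarith
  · rcases k with _ | k
    · rw [gevWeight_zero, iteratedDeriv_zero, abs_of_nonneg (hrange x).1]
      linarith [(hrange x).2]
    · refine (hG.2 _ x).trans ?_
      have : C * C / 2 ≤ (1 + C * C / 2) ^ (k + 1) := by
        have h : 0 ≤ C * C / 2 := by positivity
        calc C * C / 2 ≤ 1 + C * C / 2 := by linarith
          _ ≤ _ := le_self_pow₀ (by linarith) (by omega)
      unfold gevWeight
      rw [mul_pow]
      calc C * C / 2 * (K ^ (k + 1) * ((k + 1).factorial : ℝ) ^ s / (16 * (1 + ((k + 1 : ℕ) : ℝ)) ^ 2))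
          ≤ (1 + C * C / 2) ^ (k + 1) *
            (K ^ (k + 1) * ((k + 1).factorial : ℝ) ^ s / (16 * (1 + ((k + 1 : ℕ) : ℝ)) ^ 2)) := by
            gcongr
        _ = 1 * (K ^ (k + 1) * (1 + C * C / 2) ^ (k + 1) * ((k + 1).factorial : ℝ) ^ s /
            (16 * (1 + ((k + 1 : ℕ) : ℝ)) ^ 2)) := by ring
        _ ≤ _ := by gcongr; norm_num
  · obtain ⟨h2, h3⟩ := abs_le.1 ht
    simp only [hχ]
    rw [h1 _ (by linarith), h1 _ (by linarith), one_mul]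
  · simp only [hχ]
    rcases le_abs.1 ht with h | h
    · rw [h0 (-t + 1) (by linarith), zero_mul]
    · rw [h0 (t + 1) (by linarith), mul_zero]

lemma round_eq_of_abs_sub_lt {x : ℝ} {m : ℤ} (h : |x - m| < 1 / 2) : round x = m := by
  have h1 := round_le x m
  have h2 : |((round x - m : ℤ) : ℝ)| < 1 := by
    push_cast
    calc |(round x : ℝ) - m| = |(x - m) - (x - round x)| := by ring_nf
      _ ≤ |x - m| + |x - round x| := abs_sub _ _
      _ < 1 := by linarith
  have h3 : |round x - m| < 1 := by exact_mod_cast h2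
  have := Int.abs_lt_one_iff.1 h3
  omega

lemma half_le_abs_sub {x : ℝ} {m : ℤ} (h : round x ≠ m) : 1 / 2 ≤ |x - m| := by
  by_contra hc
  exact h (round_eq_of_abs_sub_lt (not_le.1 hc))

/-- The `1`-periodic function equal to `χ (t / ρ)` near `t = 0`. -/
def periodize (χ : ℝ → ℝ) (ρ t : ℝ) : ℝ := χ (ρ⁻¹ * (t - round t))

lemma periodize_eventuallyEq {χ : ℝ → ℝ} {ρ : ℝ} (hρ : 0 < ρ) (hρ' : ρ ≤ 1 / 8)
    (h0 : ∀ t, 1 ≤ |t| → χ t = 0) (t : ℝ) :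
    periodize χ ρ =ᶠ[nhds t] fun y => χ (ρ⁻¹ * (y - round t)) := by
  filter_upwards [Metric.ball_mem_nhds t (by norm_num : (0 : ℝ) < 1 / 8)] with y hy
  rw [Metric.mem_ball, Real.dist_eq] at hy
  unfold periodize
  by_cases hr : round y = round t
  · rw [hr]
  · have key : ∀ m : ℤ, ρ ≤ |y - m| → χ (ρ⁻¹ * (y - m)) = 0 := by
      intro m hm
      refine h0 _ ?_
      rw [abs_mul, abs_of_pos (inv_pos.2 hρ), ← div_eq_inv_mul, le_div_iff₀ hρ]
      linarith
    have h1 := half_le_abs_sub hr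
    rw [key (round t) (by linarith), key]
    by_contra hc
    push Not at hc
    refine hr (round_eq_of_abs_sub_lt (x := t) (m := round y) ?_).symm
    calc |t - round y| = |(y - round y) - (y - t)| := by ring_nf
      _ ≤ |y - round y| + |y - t| := abs_sub _ _
      _ < 1 / 2 := by linarith

lemma periodize_periodic (χ : ℝ → ℝ) (ρ t : ℝ) : periodize χ ρ (t + 1) = periodize χ ρ t := by
  unfold periodize
  rw [round_add_one]; push_cast; ring_nf

lemma GevB.periodize {s R C : ℝ} {χ : ℝ → ℝ} {ρ : ℝ} (hχ : GevB s R C χ) (hρ : 0 < ρ)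
    (hρ' : ρ ≤ 1 / 8) (h0 : ∀ t, 1 ≤ |t| → χ t = 0) :
    GevB s (ρ⁻¹ * R) C (periodize χ ρ) := by
  have hk : ∀ m : ℤ, GevB s (ρ⁻¹ * R) C (fun y => χ (ρ⁻¹ * (y - m))) := fun m =>
    (hχ.comp_mul_left (inv_nonneg.2 hρ.le)).comp_sub_const (m : ℝ)
  refine ⟨contDiff_iff_contDiffAt.2 fun t => ?_, fun k t => ?_⟩
  · exact (hk (round t)).1.contDiffAt.congr_of_eventuallyEq (periodize_eventuallyEq hρ hρ' h0 t)
  · rw [(periodize_eventuallyEq hρ hρ' h0 t).iteratedDeriv_eq k]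
    exact (hk (round t)).2 k t

lemma periodize_eq_zero {χ : ℝ → ℝ} {ρ t : ℝ} (hρ : 0 < ρ) (h0 : ∀ t, 1 ≤ |t| → χ t = 0)
    (h : ρ ≤ |t - round t|) : periodize χ ρ t = 0 := by
  refine h0 _ ?_
  rw [abs_mul, abs_of_pos (inv_pos.2 hρ), ← div_eq_inv_mul, le_div_iff₀ hρ]
  linarith

lemma periodize_eq_one {χ : ℝ → ℝ} {ρ θ t : ℝ} (hρ : 0 < ρ) (h1 : ∀ t, |t| ≤ θ → χ t = 1)
    (h : |t - round t| ≤ θ * ρ) : periodize χ ρ t = 1 := by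
  refine h1 _ ?_
  rw [abs_mul, abs_of_pos (inv_pos.2 hρ), ← div_eq_inv_mul, div_le_iff₀ hρ]
  linarith

section ContinuedFraction
open GenContFract

lemma not_terminatedAt_of_irrational {α : ℝ} (hα : Irrational α) (n : ℕ) :
    ¬ (GenContFract.of α).TerminatedAt n := by
  intro h
  obtain ⟨q, hq⟩ := (GenContFract.terminates_iff_rat α).1 ⟨n, h⟩
  exact hα ⟨q, hq.symm⟩

lemma exists_int_contsAux {α : ℝ} (hα : Irrational α) (n : ℕ) :
    (∃ p q : ℤ, (GenContFract.of α).contsAux n = ⟨p, q⟩) ∧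
      ∃ p q : ℤ, (GenContFract.of α).contsAux (n + 1) = ⟨p, q⟩ := by
  induction n with
  | zero =>
    refine ⟨⟨1, 0, by simp [contsAux]⟩, ⟨⌊α⌋, 1, ?_⟩⟩
    simp [first_contAux_eq_h_one, GenContFract.of_h_eq_floor]
  | succ n ih =>
    refine ⟨ih.2, ?_⟩
    obtain ⟨⟨p, q, h⟩, ⟨p', q', h'⟩⟩ := ih
    obtain ⟨gp, hgp⟩ : ∃ gp, (GenContFract.of α).s.get? n = some gp :=
      Option.ne_none_iff_exists'.1 (not_terminatedAt_of_irrational hα n)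
    obtain ⟨ha, z, hz⟩ := of_partNum_eq_one_and_exists_int_partDen_eq hgp
    refine ⟨z * p' + p, z * q' + q, ?_⟩
    rw [contsAux_recurrence hgp h h', ha, hz]
    push_cast
    simp

lemma exists_convergent {α : ℝ} (hα : Irrational α) (n : ℕ) : ∃ P Q P' Q' : ℤ,
    cfDen α n = Q ∧ cfDen α (n + 1) = Q' ∧ P * Q' - Q * P' ≠ 0 ∧
    |Q * α - P| ≤ 1 / cfDen α (n + 1) ∧ |Q' * α - P'| ≤ 1 / cfDen α (n + 2) := by
  have hnt := not_terminatedAt_of_irrational hα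
  obtain ⟨⟨P, Q, h⟩, ⟨P', Q', h'⟩⟩ := exists_int_contsAux hα (n + 1)
  have key : ∀ m (p q : ℤ), (GenContFract.of α).contsAux (m + 1) = ⟨p, q⟩ →
      (GenContFract.of α).nums m = p ∧ cfDen α m = q ∧
        |q * α - p| ≤ 1 / cfDen α (m + 1) := by
    intro m p q hpq
    have h1 : (GenContFract.of α).nums m = p := by
      rw [num_eq_conts_a, nth_cont_eq_succ_nth_contAux, hpq]
    have h2 : (GenContFract.of α).dens m = q := by
      rw [den_eq_conts_b, nth_cont_eq_succ_nth_contAux, hpq]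
    have hq : (0 : ℝ) < q := by
      have := succ_nth_fib_le_of_nth_den (v := α) (n := m) (Or.inr (hnt _))
      rw [h2] at this
      have hf : 0 < Nat.fib (m + 1) := Nat.fib_pos.2 (by omega)
      have : (0 : ℝ) < Nat.fib (m + 1) := by exact_mod_cast hf
      linarith
    have h3 := abs_sub_convs_le (hnt m)
    rw [conv_eq_num_div_den, h1, h2] at h3
    refine ⟨h1, h2, ?_⟩
    have h4 : (q : ℝ) * α - p = q * (α - p / q) := by field_simp
    rw [h4, abs_mul, abs_of_pos hq]
    calc _ ≤ q * (1 / (q * (GenContFract.of α).dens (m + 1))) := by gcongr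
      _ = _ := by unfold cfDen; field_simp
  obtain ⟨hP, hQ, hb⟩ := key n P Q h
  obtain ⟨hP', hQ', hb'⟩ := key (n + 1) P' Q' h'
  refine ⟨P, Q, P', Q', hQ, hQ', ?_, hb, hb'⟩
  have hdet := SimpContFract.determinant (s := SimpContFract.of α) (n := n) (hnt n)
  change (GenContFract.of α).nums n * (GenContFract.of α).dens (n + 1) -
    (GenContFract.of α).dens n * (GenContFract.of α).nums (n + 1) = _ at hdet
  unfold cfDen at hQ hQ'
  rw [hP, hQ, hP', hQ'] at hdet
  intro h0
  have h1 : ((P * Q' - Q * P' : ℤ) : ℝ) = 0 := by rw [h0]; simp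
  push_cast at h1
  rw [h1] at hdet
  exact (pow_ne_zero (n + 1) (by norm_num : (-1 : ℝ) ≠ 0)) hdet.symm

lemma cfDen_fib_le {α : ℝ} (hα : Irrational α) (n : ℕ) : (Nat.fib (n + 1) : ℝ) ≤ cfDen α n :=
  succ_nth_fib_le_of_nth_den (Or.inr (not_terminatedAt_of_irrational hα _))

lemma BoundedType.two_le_sq {α M : ℝ} (hα : Irrational α) (hM : 1 ≤ M) (h : BoundedType α M) :
    2 ≤ M ^ 2 := by
  have h0 : cfDen α 0 = 1 := zeroth_den_eq_one
  have h2 := cfDen_fib_le hα 2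
  norm_num [Nat.fib_add_two] at h2
  have h3 := h 0
  have h4 := h 1
  norm_num at h3 h4
  rw [h0] at h3
  nlinarith

lemma BoundedType.lower_bound {α M : ℝ} (hα : Irrational α) (hM : 1 ≤ M) (hb : BoundedType α M)
    {k : ℕ} (hk : 1 ≤ k) (p : ℤ) : 1 / (4 * M * k) ≤ |k * α - p| := by
  have hk0 : (1 : ℝ) ≤ k := by exact_mod_cast hk
  have hpos : ∀ n, 0 < cfDen α n := fun n => by
    have h1 := cfDen_fib_le hα n
    have : (0 : ℝ) < Nat.fib (n + 1) := by exact_mod_cast Nat.fib_pos.2 (by omega)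
    linarith
  have hex : ∃ n, 2 * (k : ℝ) ≤ cfDen α (n + 1) := by
    refine ⟨2 * k + 4, ?_⟩
    have h1 := cfDen_fib_le hα (2 * k + 4 + 1)
    have h2 : (2 * k + 4 + 1 + 1 : ℕ) ≤ Nat.fib (2 * k + 4 + 1 + 1) := Nat.le_fib_self (by omega)
    have h3 : ((2 * k + 4 + 1 + 1 : ℕ) : ℝ) ≤ Nat.fib (2 * k + 4 + 1 + 1) := by exact_mod_cast h2
    push_cast at h3
    linarith
  classical
  obtain ⟨N, hN, hN2⟩ : ∃ N, 2 * (k : ℝ) ≤ cfDen α (N + 1) ∧ cfDen α N ≤ 2 * k := by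
    refine ⟨Nat.find hex, Nat.find_spec hex, ?_⟩
    rcases hn : Nat.find hex with _ | n
    · have h0 : cfDen α 0 = 1 := zeroth_den_eq_one
      rw [h0]; linarith
    · have := Nat.find_min hex (m := n) (by omega)
      exact (not_le.1 this).le
  obtain ⟨P, Q, P', Q', hQ, hQ', hdet, h1, h2⟩ := exists_convergent hα N
  have hN3 : cfDen α (N + 1) ≤ cfDen α (N + 2) := of_den_mono
  have hN4 := hb N
  have key : ∀ (A B : ℤ) (q : ℝ), 0 < (B : ℝ) → (B : ℝ) ≤ 2 * k * M → 2 * (k : ℝ) ≤ q →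
      |B * α - A| ≤ 1 / q → (k : ℤ) * A - p * B ≠ 0 → 1 / (4 * M * k) ≤ |k * α - p| := by
    intro A B q hB0 hB hq hA hne
    have h3 : (1 : ℝ) ≤ |((((k : ℤ) * A - p * B : ℤ)) : ℝ)| := by
      exact_mod_cast Int.one_le_abs hne
    have h4 : ((((k : ℤ) * A - p * B : ℤ)) : ℝ) = B * (k * α - p) - k * (B * α - A) := by
      push_cast; ring
    rw [h4] at h3
    have h5 : |B * (k * α - p) - k * (B * α - A)| ≤ B * |k * α - p| + k * |B * α - A| := by
      refine (abs_sub _ _).trans ?_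
      rw [abs_mul, abs_mul, abs_of_pos hB0, abs_of_pos (by linarith : (0 : ℝ) < k)]
    have h6 : (k : ℝ) * |B * α - A| ≤ 1 / 2 := by
      calc (k : ℝ) * |B * α - A| ≤ k * (1 / (2 * k)) := by
            gcongr
            refine hA.trans ?_
            gcongr
        _ = 1 / 2 := by field_simp
    have h7 : 1 / 2 ≤ 2 * k * M * |k * α - p| := by
      have := mul_le_mul_of_nonneg_right hB (abs_nonneg ((k : ℝ) * α - p))
      linarith
    rw [div_le_iff₀ (by positivity)]
    linarith
  by_cases hc : (k : ℤ) * P - p * Q = 0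
  · refine key P' Q' (cfDen α (N + 2)) (hQ' ▸ hpos _) ?_ (hN.trans hN3) h2 ?_
    · rw [← hQ']
      nlinarith
    · intro hc'
      apply hdet
      have hk' : (k : ℤ) ≠ 0 := by omega
      have : (k : ℤ) * (P * Q' - Q * P') = 0 := by linear_combination Q' * hc - Q * hc'
      exact (mul_eq_zero.1 this).resolve_left hk'
  · refine key P Q (cfDen α (N + 1)) (hQ ▸ hpos _) ?_ hN h1 hc
    rw [← hQ]
    nlinarith

end ContinuedFraction

/-- The determinant of the pair of plane vectors `(v, w)`. -/
def wedge (v w : Fin 2 → ℝ) : ℝ := v 0 * w 1 - v 1 * w 0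

/-- The unipotent matrix `v ↦ v - c (v ∧ w) w`. -/
def shear (c : ℝ) (w : Fin 2 → ℝ) : Matrix (Fin 2) (Fin 2) ℝ :=
  !![1 - c * (w 1 * w 0), c * (w 0 * w 0); -(c * (w 1 * w 1)), 1 + c * (w 0 * w 1)]

lemma shear_mulVec (c : ℝ) (w v : Fin 2 → ℝ) :
    (shear c w).mulVec v = v - (c * wedge v w) • w := by
  ext i
  fin_cases i <;> simp [shear, wedge, Matrix.mulVec, dotProduct, Fin.sum_univ_two] <;> ring

lemma det_shear (c : ℝ) (w : Fin 2 → ℝ) : (shear c w).det = 1 := by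
  simp [shear, Matrix.det_fin_two]; ring

lemma shear_zero (w : Fin 2 → ℝ) : shear 0 w = 1 := by
  ext i j; fin_cases i <;> fin_cases j <;> simp [shear]

@[simp] lemma wedge_self (v : Fin 2 → ℝ) : wedge v v = 0 := by simp [wedge]; ring

lemma wedge_comb (p q r t : ℝ) (v w : Fin 2 → ℝ) :
    wedge (p • v + q • w) (r • w + t • v) = (p * r - q * t) * wedge v w := by
  simp [wedge]; ring

/-- A cocycle map together with an invariant splitting `u, s`, its inverse area `di`
and the corrections `a, b` to the exponents along the splitting. -/
structure SplitCocycle where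
  A : ℝ → Matrix (Fin 2) (Fin 2) ℝ
  u : ℝ → Fin 2 → ℝ
  s : ℝ → Fin 2 → ℝ
  di : ℝ → ℝ
  a : ℝ → ℝ
  b : ℝ → ℝ

/-- The defining relations of a split cocycle of exponent `l` over the rotation by `α`. -/
structure SplitCocycle.Valid (α l : ℝ) (L : SplitCocycle) : Prop where
  u_eq : ∀ y, (L.A y).mulVec (L.u y) = Real.exp (l - L.a y) • L.u (y + α)
  s_eq : ∀ y, (L.A y).mulVec (L.s y) = Real.exp (-l + L.b y) • L.s (y + α)
  di_eq : ∀ y, L.di y * wedge (L.u y) (L.s y) = 1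
  det_eq : ∀ y, (L.A y).det = 1

/-- All components are `1`-periodic. -/
structure SplitCocycle.Per (L : SplitCocycle) : Prop where
  A : ∀ y, L.A (y + 1) = L.A y
  u : ∀ y, L.u (y + 1) = L.u y
  s : ∀ y, L.s (y + 1) = L.s y
  di : ∀ y, L.di (y + 1) = L.di y
  a : ∀ y, L.a (y + 1) = L.a y
  b : ∀ y, L.b (y + 1) = L.b y

section Step

variable (α h : ℝ) (m : ℕ) (χ r : ℝ → ℝ)

/-- `1 - exp (-h χ)`. -/
def dipFun (y : ℝ) : ℝ := 1 - Real.exp (-(h * χ y))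

/-- Exponential of a forward Birkhoff sum. -/
def fwdExp (j : ℕ) (x : ℝ) : ℝ := Real.exp (∑ i ∈ Finset.range j, r (x + i * α))

/-- Exponential of a backward Birkhoff sum. -/
def bwdExp (j : ℕ) (x : ℝ) : ℝ := Real.exp (∑ i ∈ Finset.range j, r (x - (i + 1) * α))

def fwdP (y : ℝ) : ℝ :=
  Real.exp (-(h * ∑ j ∈ Finset.range m, (1 - ((j : ℝ) + 1) / m) * χ (y - (j + 1) * α)))

def fwdS (y : ℝ) : ℝ :=
  ∑ j ∈ Finset.range m, dipFun h χ (y - (j + 1) * α) *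
    Real.exp (((j : ℝ) + 1) / m * (h * χ (y - (j + 1) * α))) * fwdExp α r (j + 1) (y - (j + 1) * α)

def bwdP (y : ℝ) : ℝ :=
  Real.exp (-(h * ∑ j ∈ Finset.range m, (1 - (j : ℝ) / m) * χ (y + j * α)))

def bwdS (y : ℝ) : ℝ :=
  ∑ j ∈ Finset.range m, dipFun h χ (y + j * α) *
    Real.exp ((j : ℝ) / m * (h * χ (y + j * α))) * bwdExp α r j (y + j * α)

def fwdB (y : ℝ) : ℝ := (Real.exp (h * χ (y - m * α)) - 1) * fwdExp α r m (y - m * α)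

def bwdB (y : ℝ) : ℝ := (Real.exp (h * χ (y + m * α)) - 1) * bwdExp α r m (y + m * α)

end Step

/-- The relative exponent of the two directions of the splitting. -/
def SplitCocycle.ratio (L : SplitCocycle) (l y : ℝ) : ℝ := -2 * l + (L.a y + L.b y)

/-- The modification of a split cocycle near the support of `χ`. -/
def SplitCocycle.step (L : SplitCocycle) (α l h σ : ℝ) (m : ℕ) (χ : ℝ → ℝ) : SplitCocycle where
  A y := L.A y * shear (-(σ * dipFun h χ y)) ![0, 1] *
    shear (fwdB α h m χ (L.ratio l) y * L.di y) (L.s y) *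
    shear (bwdB α h m χ (L.ratio l) y * L.di y) (L.u y)
  u y := fwdP α h m χ y • L.u y + fwdS α h m χ (L.ratio l) y • L.s y
  s y := bwdP α h m χ y • L.s y + bwdS α h m χ (L.ratio l) y • L.u y
  di y := L.di y * ((fwdP α h m χ y)⁻¹ * (bwdP α h m χ y)⁻¹)
  a y := L.a y + h / m * ∑ j ∈ Finset.range m, χ (y - j * α)
  b y := L.b y + h / m * ∑ j ∈ Finset.range m, χ (y + (j + 1) * α)

/-- The translates of the support of `χ` by `k α`, `|k| ≤ 2 m + 1`, are pairwise disjoint. -/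
def OrbitDisjoint (α : ℝ) (m : ℕ) (χ : ℝ → ℝ) : Prop :=
  ∀ (y : ℝ) (k : ℤ), k ≠ 0 → |k| ≤ 2 * m + 1 → χ y ≠ 0 → χ (y + k * α) = 0

section Evaluate

variable {α h : ℝ} {m : ℕ} {χ r : ℝ → ℝ}

lemma dipFun_zero {y : ℝ} (hy : χ y = 0) : dipFun h χ y = 0 := by simp [dipFun, hy]

lemma fwdP_of_zero {y : ℝ} (hz : ∀ j < m, χ (y - (j + 1) * α) = 0) : fwdP α h m χ y = 1 := by
  unfold fwdP
  rw [Finset.sum_eq_zero fun j hj => by rw [hz j (Finset.mem_range.1 hj), mul_zero]]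
  simp

lemma fwdS_of_zero {y : ℝ} (hz : ∀ j < m, χ (y - (j + 1) * α) = 0) : fwdS α h m χ r y = 0 := by
  unfold fwdS
  exact Finset.sum_eq_zero fun j hj => by
    rw [dipFun_zero (hz j (Finset.mem_range.1 hj)), zero_mul, zero_mul]

lemma bwdP_of_zero {y : ℝ} (hz : ∀ j < m, χ (y + j * α) = 0) : bwdP α h m χ y = 1 := by
  unfold bwdP
  rw [Finset.sum_eq_zero fun j hj => by rw [hz j (Finset.mem_range.1 hj), mul_zero]]
  simp

lemma bwdS_of_zero {y : ℝ} (hz : ∀ j < m, χ (y + j * α) = 0) : bwdS α h m χ r y = 0 := by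
  unfold bwdS
  exact Finset.sum_eq_zero fun j hj => by
    rw [dipFun_zero (hz j (Finset.mem_range.1 hj)), zero_mul, zero_mul]

lemma fwdB_of_zero {y : ℝ} (hz : χ (y - m * α) = 0) : fwdB α h m χ r y = 0 := by
  simp [fwdB, hz]

lemma bwdB_of_zero {y : ℝ} (hz : χ (y + m * α) = 0) : bwdB α h m χ r y = 0 := by
  simp [bwdB, hz]

lemma OrbitDisjoint.shift (hd : OrbitDisjoint α m χ) {x : ℝ} (hx : χ x ≠ 0) (k : ℤ) (hk : k ≠ 0)
    (hk' : |k| ≤ 2 * m + 1) {z : ℝ} (hz : z = x + k * α) : χ z = 0 := by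
  rw [hz]; exact hd x k hk hk' hx

lemma fwdP_at (hd : OrbitDisjoint α m χ) {x y : ℝ} (hx : χ x ≠ 0) {j : ℕ} (hj : j < m)
    (hy : y = x + (j + 1) * α) :
    fwdP α h m χ y = Real.exp (-(h * ((1 - ((j : ℝ) + 1) / m) * χ x))) := by
  unfold fwdP
  rw [Finset.sum_eq_single_of_mem j (Finset.mem_range.2 hj)]
  · rw [hy]; ring_nf
  · intro i hi hij
    rw [Finset.mem_range] at hi
    rw [hd.shift hx (j - i : ℤ) (by omega) (by rw [abs_le]; omega) (by rw [hy]; push_cast; ring),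
      mul_zero]

lemma fwdS_at (hd : OrbitDisjoint α m χ) {x y : ℝ} (hx : χ x ≠ 0) {j : ℕ} (hj : j < m)
    (hy : y = x + (j + 1) * α) :
    fwdS α h m χ r y = dipFun h χ x * Real.exp (((j : ℝ) + 1) / m * (h * χ x)) *
      fwdExp α r (j + 1) x := by
  unfold fwdS
  rw [Finset.sum_eq_single_of_mem j (Finset.mem_range.2 hj)]
  · rw [hy, add_sub_cancel_right]
  · intro i hi hij
    rw [Finset.mem_range] at hi
    rw [dipFun_zero (hd.shift hx (j - i : ℤ) (by omega) (by rw [abs_le]; omega)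
      (by rw [hy]; push_cast; ring)), zero_mul, zero_mul]

lemma bwdP_at (hd : OrbitDisjoint α m χ) {x y : ℝ} (hx : χ x ≠ 0) {j : ℕ} (hj : j < m)
    (hy : y = x - j * α) :
    bwdP α h m χ y = Real.exp (-(h * ((1 - (j : ℝ) / m) * χ x))) := by
  unfold bwdP
  rw [Finset.sum_eq_single_of_mem j (Finset.mem_range.2 hj)]
  · rw [hy]; ring_nf
  · intro i hi hij
    rw [Finset.mem_range] at hi
    rw [hd.shift hx (i - j : ℤ) (by omega) (by rw [abs_le]; omega) (by rw [hy]; push_cast; ring),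
      mul_zero]

lemma bwdS_at (hd : OrbitDisjoint α m χ) {x y : ℝ} (hx : χ x ≠ 0) {j : ℕ} (hj : j < m)
    (hy : y = x - j * α) :
    bwdS α h m χ r y = dipFun h χ x * Real.exp ((j : ℝ) / m * (h * χ x)) * bwdExp α r j x := by
  unfold bwdS
  rw [Finset.sum_eq_single_of_mem j (Finset.mem_range.2 hj)]
  · rw [hy, sub_add_cancel]
  · intro i hi hij
    rw [Finset.mem_range] at hi
    rw [dipFun_zero (hd.shift hx (i - j : ℤ) (by omega) (by rw [abs_le]; omega)
      (by rw [hy]; push_cast; ring)), zero_mul, zero_mul]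

lemma fwdExp_succ (j : ℕ) (x : ℝ) :
    fwdExp α r (j + 1) x = fwdExp α r j x * Real.exp (r (x + j * α)) := by
  unfold fwdExp
  rw [Finset.sum_range_succ, Real.exp_add]

lemma bwdExp_succ (j : ℕ) (x : ℝ) :
    bwdExp α r (j + 1) x = bwdExp α r j x * Real.exp (r (x - (j + 1) * α)) := by
  unfold bwdExp
  rw [Finset.sum_range_succ, Real.exp_add]

end Evaluate

namespace SplitCocycle

variable {α l h σ : ℝ} {m : ℕ} {χ : ℝ → ℝ} {L : SplitCocycle}

lemma Valid.mulVec_comb (hL : L.Valid α l) (p q y : ℝ) :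
    (L.A y).mulVec (p • L.u y + q • L.s y) =
      Real.exp (l - L.a y) • (p • L.u (y + α) + (q * Real.exp (L.ratio l y)) • L.s (y + α)) := by
  rw [Matrix.mulVec_add, Matrix.mulVec_smul, Matrix.mulVec_smul, hL.u_eq, hL.s_eq]
  have : Real.exp (-l + L.b y) = Real.exp (l - L.a y) * Real.exp (L.ratio l y) := by
    rw [← Real.exp_add]; congr 1; unfold ratio; ring
  rw [this]
  ext i
  simp only [Pi.add_apply, Pi.smul_apply, smul_eq_mul]
  ring

lemma Valid.mulVec_comb' (hL : L.Valid α l) (p q y : ℝ) :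
    (L.A y).mulVec (p • L.s y + q • L.u y) =
      Real.exp (-l + L.b y) • (p • L.s (y + α) + (q * Real.exp (-L.ratio l y)) • L.u (y + α)) := by
  rw [Matrix.mulVec_add, Matrix.mulVec_smul, Matrix.mulVec_smul, hL.u_eq, hL.s_eq]
  have : Real.exp (l - L.a y) = Real.exp (-l + L.b y) * Real.exp (-L.ratio l y) := by
    rw [← Real.exp_add]; congr 1; unfold ratio; ring
  rw [this]
  ext i
  simp only [Pi.add_apply, Pi.smul_apply, smul_eq_mul]
  ring

lemma step_A_of_zero {y : ℝ} (h1 : χ y = 0) (h2 : χ (y - m * α) = 0) (h3 : χ (y + m * α) = 0) :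
    (L.step α l h σ m χ).A y = L.A y := by
  simp [step, dipFun_zero h1, fwdB_of_zero h2, bwdB_of_zero h3, shear_zero]

lemma step_u_of_zero {y : ℝ} (hz : ∀ j < m, χ (y - (j + 1) * α) = 0) :
    (L.step α l h σ m χ).u y = L.u y := by
  simp [step, fwdP_of_zero hz, fwdS_of_zero hz]

lemma step_s_of_zero {y : ℝ} (hz : ∀ j < m, χ (y + j * α) = 0) :
    (L.step α l h σ m χ).s y = L.s y := by
  simp [step, bwdP_of_zero hz, bwdS_of_zero hz]

lemma step_a_of_zero {y : ℝ} (hz : ∀ j < m, χ (y - j * α) = 0) :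
    (L.step α l h σ m χ).a y = L.a y := by
  simp only [step]
  rw [Finset.sum_eq_zero fun j hj => hz j (Finset.mem_range.1 hj)]; simp

lemma step_b_of_zero {y : ℝ} (hz : ∀ j < m, χ (y + (j + 1) * α) = 0) :
    (L.step α l h σ m χ).b y = L.b y := by
  simp only [step]
  rw [Finset.sum_eq_zero fun j hj => hz j (Finset.mem_range.1 hj)]; simp

lemma step_a_at (hd : OrbitDisjoint α m χ) {x y : ℝ} (hx : χ x ≠ 0) {j : ℕ} (hj : j < m)
    (hy : y = x + j * α) : (L.step α l h σ m χ).a y = L.a y + h / m * χ x := by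
  simp only [step]
  rw [Finset.sum_eq_single_of_mem j (Finset.mem_range.2 hj)]
  · rw [hy, add_sub_cancel_right]
  · intro i hi hij
    rw [Finset.mem_range] at hi
    exact hd.shift hx (j - i : ℤ) (by omega) (by rw [abs_le]; omega) (by rw [hy]; push_cast; ring)

lemma step_b_at (hd : OrbitDisjoint α m χ) {x y : ℝ} (hx : χ x ≠ 0) {j : ℕ} (hj : j < m)
    (hy : y = x - (j + 1) * α) : (L.step α l h σ m χ).b y = L.b y + h / m * χ x := by
  simp only [step]
  rw [Finset.sum_eq_single_of_mem j (Finset.mem_range.2 hj)]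
  · rw [hy, sub_add_cancel]
  · intro i hi hij
    rw [Finset.mem_range] at hi
    exact hd.shift hx (i - j : ℤ) (by omega) (by rw [abs_le]; omega) (by rw [hy]; push_cast; ring)

lemma step_u_eq (hL : L.Valid α l) (hm : 1 ≤ m) (hd : OrbitDisjoint α m χ)
    (hfr : ∀ y, χ y ≠ 0 → L.u y = ![1, 0] ∧ L.s y = ![1, σ]) (y : ℝ) :
    ((L.step α l h σ m χ).A y).mulVec ((L.step α l h σ m χ).u y) =
      Real.exp (l - (L.step α l h σ m χ).a y) • (L.step α l h σ m χ).u (y + α) := by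
  have hm0 : (m : ℝ) ≠ 0 := by exact_mod_cast (by omega : m ≠ 0)
  by_cases hex : ∃ j ≤ m, χ (y - j * α) ≠ 0
  · obtain ⟨j, hj, hx⟩ := hex
    set x := y - j * α with hxdef
    have hy : y = x + j * α := by rw [hxdef]; ring
    rcases j with _ | j
    · have hyx : y = x := by rw [hy]; simp
      have hz1 : χ (y - m * α) = 0 :=
        hd.shift hx (-m : ℤ) (by omega) (by rw [abs_le]; omega) (by rw [hyx]; push_cast; ring)
      have hz2 : χ (y + m * α) = 0 :=
        hd.shift hx (m : ℤ) (by omega) (by rw [abs_le]; omega) (by rw [hyx]; push_cast; ring)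
      have hA : (L.step α l h σ m χ).A y = L.A y * shear (-(σ * dipFun h χ y)) ![0, 1] := by
        simp [step, fwdB_of_zero hz1, bwdB_of_zero hz2, shear_zero]
      have hu : (L.step α l h σ m χ).u y = L.u y := step_u_of_zero fun i hi =>
        hd.shift hx (-(i + 1) : ℤ) (by omega) (by rw [abs_le]; omega)
          (by rw [hyx]; push_cast; ring)
      rw [hA, hu, ← Matrix.mulVec_mulVec, shear_mulVec, step_a_at hd hx (j := 0) (by omega) hy]
      have hχ : χ y ≠ 0 := hyx ▸ hx
      have hE : L.u y - (-(σ * dipFun h χ y) * wedge (L.u y) ![0, 1]) • ![0, 1] =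
          Real.exp (-(h * χ x)) • L.u y + dipFun h χ x • L.s y := by
        rw [(hfr y hχ).1, (hfr y hχ).2, ← hyx]
        ext i
        fin_cases i <;> simp [wedge, dipFun]; ring
      rw [hE, hL.mulVec_comb]
      simp only [step]
      rw [fwdP_at hd hx (j := 0) (by omega) (by rw [hyx]; push_cast; ring),
        fwdS_at hd hx (j := 0) (by omega) (by rw [hyx]; push_cast; ring)]
      have e1 : Real.exp (-(h * χ x)) = Real.exp (-(h / m * χ x)) *
          Real.exp (-(h * ((1 - (((0 : ℕ) : ℝ) + 1) / m) * χ x))) := by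
        rw [← Real.exp_add]; congr 1; push_cast; field_simp; ring
      have e2 : (1 : ℝ) = Real.exp (-(h / m * χ x)) *
          Real.exp ((((0 : ℕ) : ℝ) + 1) / m * (h * χ x)) := by
        rw [← Real.exp_add]; symm; rw [Real.exp_eq_one_iff]; push_cast; field_simp; ring
      have e3 : Real.exp (l - (L.a y + h / m * χ x)) =
          Real.exp (l - L.a y) * Real.exp (-(h / m * χ x)) := by
        rw [← Real.exp_add]; congr 1; ring
      have e4 : fwdExp α (L.ratio l) (0 + 1) x = Real.exp (L.ratio l y) := by
        simp [fwdExp, hyx]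
      rw [e3, e4]
      ext i
      simp only [Pi.add_apply, Pi.smul_apply, smul_eq_mul]
      rw [e1]
      linear_combination (Real.exp (l - L.a y) * dipFun h χ x * Real.exp (L.ratio l y) *
        L.s (y + α) i) * e2
    · by_cases hjm : j + 1 < m
      · have hA : (L.step α l h σ m χ).A y = L.A y := by
          refine step_A_of_zero ?_ ?_ ?_
          · exact hd.shift hx (j + 1 : ℤ) (by omega) (by rw [abs_le]; omega)
              (by rw [hy]; push_cast; ring)
          · exact hd.shift hx (j + 1 - m : ℤ) (by omega) (by rw [abs_le]; omega)
              (by rw [hy]; push_cast; ring)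
          · exact hd.shift hx (j + 1 + m : ℤ) (by omega) (by rw [abs_le]; omega)
              (by rw [hy]; push_cast; ring)
        rw [hA, step_a_at hd hx hjm hy]
        simp only [step]
        rw [fwdP_at hd hx (j := j) (by omega) (by rw [hy]; push_cast; ring),
          fwdS_at hd hx (j := j) (by omega) (by rw [hy]; push_cast; ring),
          fwdP_at hd hx (j := j + 1) (by omega) (by rw [hy]; push_cast; ring),
          fwdS_at hd hx (j := j + 1) (by omega) (by rw [hy]; push_cast; ring), hL.mulVec_comb,
          fwdExp_succ (j + 1) x, ← hy]
        have e1 : Real.exp (-(h * ((1 - ((j : ℝ) + 1) / m) * χ x))) = Real.exp (-(h / m * χ x)) *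
            Real.exp (-(h * ((1 - (((j + 1 : ℕ) : ℝ) + 1) / m) * χ x))) := by
          rw [← Real.exp_add]; congr 1; push_cast; field_simp; ring
        have e2 : Real.exp (((j : ℝ) + 1) / m * (h * χ x)) = Real.exp (-(h / m * χ x)) *
            Real.exp ((((j + 1 : ℕ) : ℝ) + 1) / m * (h * χ x)) := by
          rw [← Real.exp_add]; congr 1; push_cast; field_simp; ring
        have e3 : Real.exp (l - (L.a y + h / m * χ x)) =
            Real.exp (l - L.a y) * Real.exp (-(h / m * χ x)) := by
          rw [← Real.exp_add]; congr 1; ring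
        rw [e3]
        ext i
        simp only [Pi.add_apply, Pi.smul_apply, smul_eq_mul]
        rw [e1, e2]
        ring
      · have hjm' : m = j + 1 := by omega
        have hz2 : χ (y + m * α) = 0 :=
          hd.shift hx (j + 1 + m : ℤ) (by omega) (by rw [abs_le]; omega)
            (by rw [hy]; push_cast; ring)
        have hz0 : χ y = 0 :=
          hd.shift hx (j + 1 : ℤ) (by omega) (by rw [abs_le]; omega) (by rw [hy]; push_cast; ring)
        have hA : (L.step α l h σ m χ).A y = L.A y *
            shear (fwdB α h m χ (L.ratio l) y * L.di y) (L.s y) := by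
          simp [step, dipFun_zero hz0, bwdB_of_zero hz2, shear_zero]
        have hua : (L.step α l h σ m χ).u (y + α) = L.u (y + α) := step_u_of_zero fun i hi =>
          hd.shift hx (j + 1 - i : ℤ) (by omega) (by rw [abs_le]; omega)
            (by rw [hy]; push_cast; ring)
        have ha : (L.step α l h σ m χ).a y = L.a y := step_a_of_zero fun i hi =>
          hd.shift hx (j + 1 - i : ℤ) (by omega) (by rw [abs_le]; omega)
            (by rw [hy]; push_cast; ring)
        rw [hA, hua, ha, ← hL.u_eq, ← Matrix.mulVec_mulVec, shear_mulVec]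
        congr 1
        simp only [step]
        rw [fwdP_at hd hx (j := j) (by omega) (by rw [hy]; push_cast; ring),
          fwdS_at hd hx (j := j) (by omega) (by rw [hy]; push_cast; ring)]
        have e0 : y - m * α = x := by rw [hxdef, hjm']
        have e1 : ((j : ℝ) + 1) / m = 1 := by
          rw [hjm']; push_cast; exact div_self (by positivity)
        have e2 : fwdB α h m χ (L.ratio l) y =
            dipFun h χ x * Real.exp (1 * (h * χ x)) * fwdExp α (L.ratio l) (j + 1) x := by
          unfold fwdB dipFun
          rw [e0, ← hjm', one_mul]
          have e : Real.exp (-(h * χ x)) * Real.exp (h * χ x) = 1 := by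
            rw [← Real.exp_add]; simp
          linear_combination fwdExp α (L.ratio l) m x * e
        rw [e1, ← e2]
        have hdi := hL.di_eq y
        have e3 : ∀ p t : ℝ, wedge (p • L.u y + t • L.s y) (L.s y) = p * wedge (L.u y) (L.s y) := by
          intro p t; simp [wedge]; ring
        rw [e3]
        simp only [sub_self, zero_mul, mul_zero, neg_zero, Real.exp_zero, one_mul, one_smul]
        rw [mul_assoc, hdi, mul_one, add_sub_cancel_right]
  · push Not at hex
    have h0 : χ y = 0 := by simpa using hex 0 (by omega)
    have hu : (L.step α l h σ m χ).u y = L.u y := step_u_of_zero fun i hi => by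
      simpa using hex (i + 1) (by omega)
    have hua : (L.step α l h σ m χ).u (y + α) = L.u (y + α) := step_u_of_zero fun i hi => by
      have := hex i (by omega)
      rw [← this]; congr 1; ring
    have ha : (L.step α l h σ m χ).a y = L.a y := step_a_of_zero fun i hi => hex i (by omega)
    rw [hu, hua, ha, ← hL.u_eq]
    simp only [step]
    rw [fwdB_of_zero (hex m le_rfl), dipFun_zero h0]
    simp only [mul_zero, neg_zero, zero_mul, shear_zero, Matrix.mul_one]
    rw [← Matrix.mulVec_mulVec, shear_mulVec]
    simp only [wedge_self, mul_zero, zero_smul, sub_zero]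

lemma step_s_eq (hL : L.Valid α l) (hm : 1 ≤ m) (hd : OrbitDisjoint α m χ)
    (hfr : ∀ y, χ y ≠ 0 → L.u y = ![1, 0] ∧ L.s y = ![1, σ]) (y : ℝ) :
    ((L.step α l h σ m χ).A y).mulVec ((L.step α l h σ m χ).s y) =
      Real.exp (-l + (L.step α l h σ m χ).b y) • (L.step α l h σ m χ).s (y + α) := by
  have hm0 : (m : ℝ) ≠ 0 := by exact_mod_cast (by omega : m ≠ 0)
  by_cases hex : ∃ j ≤ m, χ (y + j * α) ≠ 0
  · obtain ⟨j, hj, hx⟩ := hex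
    set x := y + j * α with hxdef
    have hy : y = x - j * α := by rw [hxdef]; ring
    rcases j with _ | j
    · have hyx : y = x := by rw [hy]; simp
      have hz1 : χ (y - m * α) = 0 :=
        hd.shift hx (-m : ℤ) (by omega) (by rw [abs_le]; omega) (by rw [hyx]; push_cast; ring)
      have hz2 : χ (y + m * α) = 0 :=
        hd.shift hx (m : ℤ) (by omega) (by rw [abs_le]; omega) (by rw [hyx]; push_cast; ring)
      have hA : (L.step α l h σ m χ).A y = L.A y * shear (-(σ * dipFun h χ y)) ![0, 1] := by
        simp [step, fwdB_of_zero hz1, bwdB_of_zero hz2, shear_zero]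
      have hsa : (L.step α l h σ m χ).s (y + α) = L.s (y + α) := step_s_of_zero fun i hi =>
        hd.shift hx (i + 1 : ℤ) (by omega) (by rw [abs_le]; omega)
          (by rw [hyx]; push_cast; ring)
      have hb : (L.step α l h σ m χ).b y = L.b y := step_b_of_zero fun i hi =>
        hd.shift hx (i + 1 : ℤ) (by omega) (by rw [abs_le]; omega)
          (by rw [hyx]; push_cast; ring)
      rw [hA, hsa, hb, ← hL.s_eq, ← Matrix.mulVec_mulVec, shear_mulVec]
      congr 1
      have hχ : χ y ≠ 0 := hyx ▸ hx
      simp only [step]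
      rw [bwdP_at hd hx (j := 0) (by omega) (by rw [hyx]; push_cast; ring),
        bwdS_at hd hx (j := 0) (by omega) (by rw [hyx]; push_cast; ring),
        (hfr y hχ).1, (hfr y hχ).2, hyx]
      ext i
      fin_cases i <;> simp [wedge, dipFun, bwdExp]; ring
    · by_cases hjm : j + 1 < m
      · have hA : (L.step α l h σ m χ).A y = L.A y := by
          refine step_A_of_zero ?_ ?_ ?_
          · exact hd.shift hx (-(j + 1) : ℤ) (by omega) (by rw [abs_le]; omega)
              (by rw [hy]; push_cast; ring)
          · exact hd.shift hx (-(j + 1) - m : ℤ) (by omega) (by rw [abs_le]; omega)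
              (by rw [hy]; push_cast; ring)
          · exact hd.shift hx (m - (j + 1) : ℤ) (by omega) (by rw [abs_le]; omega)
              (by rw [hy]; push_cast; ring)
        rw [hA, step_b_at hd hx (j := j) (by omega) (by rw [hy]; push_cast; ring)]
        simp only [step]
        rw [bwdP_at hd hx (j := j + 1) (by omega) hy,
          bwdS_at hd hx (j := j + 1) (by omega) hy,
          bwdP_at hd hx (j := j) (by omega) (by rw [hy]; push_cast; ring),
          bwdS_at hd hx (j := j) (by omega) (by rw [hy]; push_cast; ring), hL.mulVec_comb',
          bwdExp_succ j x]
        have hy' : x - ((j : ℝ) + 1) * α = y := by rw [hy]; push_cast; ring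
        rw [hy']
        have e1 : Real.exp (-(h * ((1 - ((j + 1 : ℕ) : ℝ) / m) * χ x))) =
            Real.exp (h / m * χ x) * Real.exp (-(h * ((1 - (j : ℝ) / m) * χ x))) := by
          rw [← Real.exp_add]; congr 1; push_cast; field_simp; ring
        have e2 : Real.exp (((j + 1 : ℕ) : ℝ) / m * (h * χ x)) = Real.exp (h / m * χ x) *
            Real.exp ((j : ℝ) / m * (h * χ x)) := by
          rw [← Real.exp_add]; congr 1; push_cast; field_simp; ring
        have e3 : Real.exp (-l + (L.b y + h / m * χ x)) =
            Real.exp (-l + L.b y) * Real.exp (h / m * χ x) := by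
          rw [← Real.exp_add]; congr 1; ring
        have e4 : Real.exp (L.ratio l y) * Real.exp (-L.ratio l y) = 1 := by
          rw [← Real.exp_add]; simp
        rw [e3]
        ext i
        simp only [Pi.add_apply, Pi.smul_apply, smul_eq_mul]
        rw [e1, e2]
        linear_combination (Real.exp (-l + L.b y) * dipFun h χ x * Real.exp (h / m * χ x) *
          Real.exp ((j : ℝ) / m * (h * χ x)) * bwdExp α (L.ratio l) j x * L.u (y + α) i) * e4
      · have hjm' : m = j + 1 := by omega
        have hz1 : χ (y - m * α) = 0 :=
          hd.shift hx (-(j + 1) - m : ℤ) (by omega) (by rw [abs_le]; omega)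
            (by rw [hy]; push_cast; ring)
        have hz0 : χ y = 0 :=
          hd.shift hx (-(j + 1) : ℤ) (by omega) (by rw [abs_le]; omega)
            (by rw [hy]; push_cast; ring)
        have hA : (L.step α l h σ m χ).A y = L.A y *
            shear (bwdB α h m χ (L.ratio l) y * L.di y) (L.u y) := by
          simp [step, dipFun_zero hz0, fwdB_of_zero hz1, shear_zero]
        have hs : (L.step α l h σ m χ).s y = L.s y := step_s_of_zero fun i hi =>
          hd.shift hx (i - (j + 1) : ℤ) (by omega) (by rw [abs_le]; omega)
            (by rw [hy]; push_cast; ring)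
        have hdi := hL.di_eq y
        have e3 : wedge (L.s y) (L.u y) = - wedge (L.u y) (L.s y) := by simp [wedge]; ring
        have e5 : L.s y - (bwdB α h m χ (L.ratio l) y * L.di y * wedge (L.s y) (L.u y)) • L.u y =
            (1 : ℝ) • L.s y + bwdB α h m χ (L.ratio l) y • L.u y := by
          rw [e3, mul_assoc, mul_neg, hdi]; simp
        rw [hA, hs, ← Matrix.mulVec_mulVec, shear_mulVec, e5, hL.mulVec_comb',
          step_b_at hd hx (j := j) (by omega) (by rw [hy]; push_cast; ring)]
        simp only [step]
        rw [bwdP_at hd hx (j := j) (by omega) (by rw [hy]; push_cast; ring),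
          bwdS_at hd hx (j := j) (by omega) (by rw [hy]; push_cast; ring)]
        have e0 : y + m * α = x := by rw [hxdef, hjm']
        have hy' : x - ((j : ℝ) + 1) * α = y := by rw [hy]; push_cast; ring
        have e1 : (j : ℝ) / m = 1 - 1 / m := by
          rw [hjm'] at hm0 ⊢; push_cast at hm0 ⊢; field_simp; ring
        have e4 : Real.exp (L.ratio l y) * Real.exp (-L.ratio l y) = 1 := by
          rw [← Real.exp_add]; simp
        have e6 : bwdB α h m χ (L.ratio l) y * Real.exp (-L.ratio l y) =
            (Real.exp (h * χ x) - 1) * bwdExp α (L.ratio l) j x := by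
          unfold bwdB
          rw [e0]
          conv_lhs => rw [show bwdExp α (L.ratio l) m x = bwdExp α (L.ratio l) (j + 1) x by
            rw [hjm']]
          rw [bwdExp_succ, hy']
          linear_combination ((Real.exp (h * χ x) - 1) * bwdExp α (L.ratio l) j x) * e4
        have e7 : Real.exp (-l + (L.b y + h / m * χ x)) =
            Real.exp (-l + L.b y) * Real.exp (h / m * χ x) := by
          rw [← Real.exp_add]; congr 1; ring
        have e8 : Real.exp (h / m * χ x) * Real.exp (-(h * ((1 - (j : ℝ) / m) * χ x))) = 1 := by
          rw [← Real.exp_add, Real.exp_eq_one_iff, e1]; ring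
        have e9 : Real.exp (h / m * χ x) * Real.exp ((j : ℝ) / m * (h * χ x)) * dipFun h χ x =
            Real.exp (h * χ x) - 1 := by
          have : h / m * χ x + (j : ℝ) / m * (h * χ x) = h * χ x := by rw [e1]; ring
          rw [← Real.exp_add, this, dipFun, mul_sub, mul_one, ← Real.exp_add]
          simp
        rw [e6, e7]
        ext i
        simp only [Pi.add_apply, Pi.smul_apply, smul_eq_mul]
        linear_combination (-Real.exp (-l + L.b y) * L.s (y + α) i) * e8 -
          (Real.exp (-l + L.b y) * bwdExp α (L.ratio l) j x * L.u (y + α) i) * e9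
  · push Not at hex
    have h0 : χ y = 0 := by simpa using hex 0 (by omega)
    have hs : (L.step α l h σ m χ).s y = L.s y := step_s_of_zero fun i hi => hex i (by omega)
    have hsa : (L.step α l h σ m χ).s (y + α) = L.s (y + α) := step_s_of_zero fun i hi => by
      have := hex (i + 1) (by omega)
      rw [← this]; congr 1; push_cast; ring
    have hb : (L.step α l h σ m χ).b y = L.b y := step_b_of_zero fun i hi => by
      simpa using hex (i + 1) (by omega)
    rw [hs, hsa, hb, ← hL.s_eq]
    simp only [step]
    rw [bwdB_of_zero (hex m le_rfl), dipFun_zero h0]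
    simp only [mul_zero, neg_zero, zero_mul, shear_zero, Matrix.mul_one]
    rw [← Matrix.mulVec_mulVec, shear_mulVec]
    simp only [wedge_self, mul_zero, zero_smul, sub_zero]

lemma fwdS_mul_bwdS (hd : OrbitDisjoint α m χ) (r : ℝ → ℝ) (y : ℝ) :
    fwdS α h m χ r y * bwdS α h m χ r y = 0 := by
  by_cases hex : ∃ j < m, χ (y + j * α) ≠ 0
  · obtain ⟨j, hj, hx⟩ := hex
    rw [fwdS_of_zero fun i hi => hd.shift hx (-(i + 1) - j : ℤ) (by omega)
      (by rw [abs_le]; omega) (by push_cast; ring), zero_mul]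
  · push Not at hex
    rw [bwdS_of_zero hex, mul_zero]

lemma Valid.step (hL : L.Valid α l) (hm : 1 ≤ m) (hd : OrbitDisjoint α m χ)
    (hfr : ∀ y, χ y ≠ 0 → L.u y = ![1, 0] ∧ L.s y = ![1, σ]) :
    (L.step α l h σ m χ).Valid α l where
  u_eq := step_u_eq hL hm hd hfr
  s_eq := step_s_eq hL hm hd hfr
  di_eq y := by
    simp only [SplitCocycle.step]
    rw [wedge_comb, fwdS_mul_bwdS hd, sub_zero]
    have h1 : fwdP α h m χ y ≠ 0 := (Real.exp_pos _).ne'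
    have h2 : bwdP α h m χ y ≠ 0 := (Real.exp_pos _).ne'
    have := hL.di_eq y
    field_simp
    linarith
  det_eq y := by
    simp [SplitCocycle.step, Matrix.det_mul, det_shear, hL.det_eq]

lemma step_frame (hd : OrbitDisjoint α m χ) (hm : 1 ≤ m)
    (hfr : ∀ y, χ y ≠ 0 → L.u y = ![1, 0] ∧ L.s y = ![1, σ]) {y : ℝ} (hy : χ y = 1) :
    (L.step α l h σ m χ).u y = ![1, 0] ∧
      (L.step α l h σ m χ).s y = ![1, σ * Real.exp (-h)] := by
  have hx : χ y ≠ 0 := by rw [hy]; norm_num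
  refine ⟨?_, ?_⟩
  · rw [step_u_of_zero fun i hi => hd.shift hx (-(i + 1) : ℤ) (by omega)
      (by rw [abs_le]; omega) (by push_cast; ring), (hfr y hx).1]
  · simp only [step]
    rw [bwdP_at hd hx (j := 0) (by omega) (by simp), bwdS_at hd hx (j := 0) (by omega) (by simp),
      (hfr y hx).1, (hfr y hx).2]
    ext i
    fin_cases i <;> simp [dipFun, bwdExp, hy]; ring

lemma Per.step (hL : L.Per) (hχ : ∀ y, χ (y + 1) = χ y) : (L.step α l h σ m χ).Per := by
  have h1 : ∀ y c, χ (y + 1 + c) = χ (y + c) := fun y c => by rw [add_right_comm, hχ]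
  have h2 : ∀ y c, χ (y + 1 - c) = χ (y - c) := fun y c => by rw [add_sub_right_comm, hχ]
  have hr : ∀ y, L.ratio l (y + 1) = L.ratio l y := fun y => by
    unfold ratio; rw [hL.a, hL.b]
  have h3 : ∀ j y c, fwdExp α (L.ratio l) j (y + 1 - c) = fwdExp α (L.ratio l) j (y - c) := by
    intro j y c
    unfold fwdExp
    congr 1
    refine Finset.sum_congr rfl fun i _ => ?_
    rw [show y + 1 - c + i * α = (y - c + i * α) + 1 by ring, hr]
  have h4 : ∀ j y c, bwdExp α (L.ratio l) j (y + 1 + c) = bwdExp α (L.ratio l) j (y + c) := by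
    intro j y c
    unfold bwdExp
    congr 1
    refine Finset.sum_congr rfl fun i _ => ?_
    rw [show y + 1 + c - (i + 1) * α = (y + c - (i + 1) * α) + 1 by ring, hr]
  constructor <;> intro y <;>
    simp only [SplitCocycle.step, dipFun, fwdP, fwdS, bwdP, bwdS, fwdB, bwdB, h1, h2, h3, h4, hχ,
      hL.A, hL.u, hL.s, hL.di, hL.a, hL.b]

end SplitCocycle

lemma norm_toLp_mulVec_le (A : Matrix (Fin 2) (Fin 2) ℝ) (v : Fin 2 → ℝ) :
    ‖WithLp.toLp 2 (A.mulVec v)‖ ≤ mnorm A * ‖WithLp.toLp 2 v‖ := by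
  have := (Matrix.toEuclideanCLM (𝕜 := ℝ) A).le_opNorm (WithLp.toLp 2 v)
  rwa [Matrix.toEuclideanCLM_toLp] at this

lemma mnorm_le_of_mulVec {A : Matrix (Fin 2) (Fin 2) ℝ} {C : ℝ} (hC : 0 ≤ C)
    (h : ∀ v, ‖WithLp.toLp 2 (A.mulVec v)‖ ≤ C * ‖WithLp.toLp 2 v‖) : mnorm A ≤ C := by
  refine ContinuousLinearMap.opNorm_le_bound _ hC fun x => ?_
  have := h x.ofLp
  rwa [← Matrix.toEuclideanCLM_toLp] at this

lemma mnorm_mul_le (A B : Matrix (Fin 2) (Fin 2) ℝ) : mnorm (A * B) ≤ mnorm A * mnorm B := by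
  unfold mnorm; rw [map_mul]; exact norm_mul_le _ _

lemma mnorm_nonneg (A : Matrix (Fin 2) (Fin 2) ℝ) : 0 ≤ mnorm A := norm_nonneg _

lemma abs_apply_le_norm_toLp (v : Fin 2 → ℝ) (i : Fin 2) : |v i| ≤ ‖WithLp.toLp 2 v‖ := by
  simpa using PiLp.norm_apply_le (WithLp.toLp 2 v) i

lemma norm_toLp_le_add (v : Fin 2 → ℝ) : ‖WithLp.toLp 2 v‖ ≤ |v 0| + |v 1| := by
  rw [EuclideanSpace.norm_eq]
  simp only [Fin.sum_univ_two, Real.norm_eq_abs, sq_abs]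
  rw [Real.sqrt_le_left (by positivity)]
  nlinarith [mul_nonneg (abs_nonneg (v 0)) (abs_nonneg (v 1)), sq_abs (v 0), sq_abs (v 1)]

lemma one_le_mnorm {A : Matrix (Fin 2) (Fin 2) ℝ} (hA : A.det = 1) : 1 ≤ mnorm A := by
  have h : ∀ i, ‖WithLp.toLp 2 (A.mulVec (Pi.single i 1))‖ ≤ mnorm A := fun i => by
    have := norm_toLp_mulVec_le A (Pi.single i 1)
    have h1 : ‖WithLp.toLp 2 (Pi.single i (1 : ℝ) : Fin 2 → ℝ)‖ = 1 := by simp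
    rwa [h1, mul_one] at this
  have hs : ∀ i, A 0 i ^ 2 + A 1 i ^ 2 ≤ mnorm A ^ 2 := fun i => by
    have h1 := pow_le_pow_left₀ (norm_nonneg _) (h i) 2
    rw [EuclideanSpace.norm_sq_eq] at h1
    simpa [Fin.sum_univ_two] using h1
  rw [Matrix.det_fin_two] at hA
  by_contra hc
  push Not at hc
  have hm := mnorm_nonneg A
  have : mnorm A ^ 2 < 1 := by nlinarith
  nlinarith [hs 0, hs 1, sq_nonneg (A 0 0 - A 1 1), sq_nonneg (A 0 1 + A 1 0)]

lemma continuous_mnorm : Continuous mnorm := by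
  have h : Continuous fun A : Matrix (Fin 2) (Fin 2) ℝ => Matrix.toEuclideanCLM (𝕜 := ℝ) A :=
    LinearMap.continuous_of_finiteDimensional
      ((Matrix.toEuclideanCLM (n := Fin 2) (𝕜 := ℝ)).toAlgEquiv.toLinearMap)
  exact h.norm

/-- Iterates of a cocycle over the rotation by `α` of the circle `ℝ / ℤ`. -/
def unitIter (α : ℝ) (A : ℝ → Matrix (Fin 2) (Fin 2) ℝ) : ℕ → ℝ → Matrix (Fin 2) (Fin 2) ℝ
  | 0, _ => 1
  | n + 1, t => A (t + n * α) * unitIter α A n t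

lemma cocycleIter_comp_div (α : ℝ) (A : ℝ → Matrix (Fin 2) (Fin 2) ℝ) (n : ℕ) (x : ℝ) :
    cocycleIter α (fun x => A (x / (2 * π))) n x = unitIter α A n (x / (2 * π)) := by
  induction n with
  | zero => rfl
  | succ n ih =>
    simp only [cocycleIter, unitIter]
    rw [ih]
    congr 2
    have := Real.pi_ne_zero
    field_simp

lemma lyapunovExp_comp_div (α : ℝ) (A : ℝ → Matrix (Fin 2) (Fin 2) ℝ) :
    lyapunovExp α (fun x => A (x / (2 * π))) =
      ⨅ n : ℕ, (1 / ((n : ℝ) + 1)) * ∫ t in (0 : ℝ)..1, Real.log (mnorm (unitIter α A (n + 1) t)) := by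
  unfold lyapunovExp
  refine iInf_congr fun n => ?_
  congr 1
  simp only [cocycleIter_comp_div]
  have hp : 2 * π ≠ 0 := by positivity
  rw [intervalIntegral.integral_comp_div (fun t => Real.log (mnorm (unitIter α A (n + 1) t))) hp]
  rw [zero_div, div_self hp, smul_eq_mul, ← mul_assoc, inv_mul_cancel₀ hp, one_mul]

section

variable {α : ℝ} {A : ℝ → Matrix (Fin 2) (Fin 2) ℝ}

lemma det_unitIter (h : ∀ t, (A t).det = 1) (n : ℕ) (t : ℝ) : (unitIter α A n t).det = 1 := by
  induction n with
  | zero => simp [unitIter]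
  | succ n ih => rw [unitIter, Matrix.det_mul, h, ih, one_mul]

lemma continuous_unitIter (h : Continuous A) (n : ℕ) : Continuous (unitIter α A n) := by
  induction n with
  | zero => exact continuous_const
  | succ n ih => exact (h.comp (continuous_id.add continuous_const)).matrix_mul ih

lemma continuous_log_mnorm_unitIter (h : Continuous A) (hd : ∀ t, (A t).det = 1) (n : ℕ) :
    Continuous fun t => Real.log (mnorm (unitIter α A n t)) :=
  (continuous_mnorm.comp (continuous_unitIter h n)).log fun t =>
    (zero_lt_one.trans_le (one_le_mnorm (det_unitIter hd n t))).ne'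

lemma log_mnorm_unitIter_nonneg (hd : ∀ t, (A t).det = 1) (n : ℕ) (t : ℝ) :
    0 ≤ Real.log (mnorm (unitIter α A n t)) :=
  Real.log_nonneg (one_le_mnorm (det_unitIter hd n t))

lemma mnorm_unitIter_le {C : ℝ} (hC : ∀ t, mnorm (A t) ≤ C) (n : ℕ) (t : ℝ) :
    mnorm (unitIter α A n t) ≤ C ^ n := by
  induction n with
  | zero =>
    refine mnorm_le_of_mulVec (by simp) fun v => ?_
    simp [unitIter]
  | succ n ih =>
    rw [unitIter, pow_succ']
    exact (mnorm_mul_le _ _).trans (mul_le_mul (hC _) ih (mnorm_nonneg _)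
      ((mnorm_nonneg _).trans (hC t)))

lemma tendsto_unitIter {B : ℕ → ℝ → Matrix (Fin 2) (Fin 2) ℝ}
    (h : ∀ t, Tendsto (fun n => B n t) atTop (nhds (A t))) (N : ℕ) (t : ℝ) :
    Tendsto (fun n => unitIter α (B n) N t) atTop (nhds (unitIter α A N t)) := by
  induction N with
  | zero => exact tendsto_const_nhds
  | succ N ih =>
    have hm : Continuous fun p : Matrix (Fin 2) (Fin 2) ℝ × Matrix (Fin 2) (Fin 2) ℝ => p.1 * p.2 :=
      continuous_fst.matrix_mul continuous_snd
    exact (hm.tendsto _).comp ((h _).prodMk_nhds ih)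

lemma tendsto_integral_log_unitIter {B : ℕ → ℝ → Matrix (Fin 2) (Fin 2) ℝ} {C : ℝ}
    (hB : ∀ n, Continuous (B n)) (hd : ∀ n t, (B n t).det = 1) (hC : ∀ n t, mnorm (B n t) ≤ C)
    (hdA : ∀ t, (A t).det = 1)
    (h : ∀ t, Tendsto (fun n => B n t) atTop (nhds (A t))) (N : ℕ) :
    Tendsto (fun n => ∫ t in (0 : ℝ)..1, Real.log (mnorm (unitIter α (B n) N t))) atTop
      (nhds (∫ t in (0 : ℝ)..1, Real.log (mnorm (unitIter α A N t)))) := by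
  refine intervalIntegral.tendsto_integral_filter_of_dominated_convergence
    (fun _ => Real.log (C ^ N)) ?_ ?_ ?_ ?_
  · exact .of_forall fun n =>
      (continuous_log_mnorm_unitIter (hB n) (hd n) N).aestronglyMeasurable
  · refine .of_forall fun n => .of_forall fun t _ => ?_
    rw [Real.norm_of_nonneg (log_mnorm_unitIter_nonneg (hd n) N t)]
    exact Real.log_le_log (zero_lt_one.trans_le (one_le_mnorm (det_unitIter (hd n) N t)))
      (mnorm_unitIter_le (hC n) N t)
  · exact intervalIntegrable_const
  · refine .of_forall fun t _ => ?_
    have h1 := ((continuous_mnorm.tendsto _).comp (tendsto_unitIter (α := α) h N t))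
    exact h1.log (zero_lt_one.trans_le (one_le_mnorm (det_unitIter hdA N t))).ne'

end

namespace SplitCocycle

variable {α l H : ℝ} {L : SplitCocycle}

lemma Valid.u_ne_zero (hL : L.Valid α l) (y : ℝ) : L.u y ≠ 0 := by
  intro h
  have := hL.di_eq y
  rw [h] at this
  simp [wedge] at this

lemma Valid.unitIter_mulVec (hL : L.Valid α l) (N : ℕ) (t : ℝ) :
    (unitIter α L.A N t).mulVec (L.u t) =
      Real.exp (∑ j ∈ Finset.range N, (l - L.a (t + j * α))) • L.u (t + N * α) := by
  induction N with
  | zero => simp [unitIter]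
  | succ N ih =>
    rw [unitIter, ← Matrix.mulVec_mulVec, ih, Matrix.mulVec_smul, hL.u_eq, smul_smul,
      ← Real.exp_add, Finset.sum_range_succ]
    congr 2
    push_cast; ring

lemma Valid.le_integral_log (hL : L.Valid α l) (hp : L.Per) (hA : Continuous L.A)
    (hu : Continuous L.u) (ha : ∀ y, L.a y ≤ H) (N : ℕ) :
    N * (l - H) ≤ ∫ t in (0 : ℝ)..1, Real.log (mnorm (unitIter α L.A N t)) := by
  set g : ℝ → ℝ := fun t => Real.log ‖WithLp.toLp 2 (L.u t)‖ with hg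
  have hpos : ∀ t, 0 < ‖WithLp.toLp 2 (L.u t)‖ := fun t => by
    rw [norm_pos_iff]; simpa using hL.u_ne_zero t
  have hgc : Continuous g :=
    ((PiLp.continuous_toLp 2 _).comp hu).norm.log fun t => (hpos t).ne'
  have hgp : Function.Periodic g 1 := fun t => by simp only [hg, hp.u]
  have hle : ∀ t, N * (l - H) + (g (t + N * α) - g t) ≤
      Real.log (mnorm (unitIter α L.A N t)) := fun t => by
    have h1 := norm_toLp_mulVec_le (unitIter α L.A N t) (L.u t)
    rw [hL.unitIter_mulVec, WithLp.toLp_smul, norm_smul, Real.norm_of_nonneg (Real.exp_pos _).le]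
      at h1
    have hm : 0 < mnorm (unitIter α L.A N t) :=
      zero_lt_one.trans_le (one_le_mnorm (det_unitIter hL.det_eq N t))
    have h2 := Real.log_le_log (by have := hpos (t + N * α); positivity) h1
    rw [Real.log_mul (Real.exp_pos _).ne' (hpos _).ne', Real.log_exp,
      Real.log_mul hm.ne' (hpos _).ne'] at h2
    have h3 : N * (l - H) ≤ ∑ j ∈ Finset.range N, (l - L.a (t + j * α)) := by
      have : ∑ j ∈ Finset.range N, (l - H) ≤ ∑ j ∈ Finset.range N, (l - L.a (t + j * α)) :=
        Finset.sum_le_sum fun j _ => by linarith [ha (t + j * α)]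
      rwa [Finset.sum_const, Finset.card_range, nsmul_eq_mul] at this
    simp only [hg]; linarith
  have hi1 : IntervalIntegrable (fun t => g (t + N * α)) volume 0 1 :=
    (hgc.comp (continuous_id.add continuous_const)).intervalIntegrable _ _
  have hi2 : IntervalIntegrable g volume 0 1 := hgc.intervalIntegrable _ _
  have hshift : ∫ t in (0 : ℝ)..1, g (t + N * α) = ∫ t in (0 : ℝ)..1, g t := by
    rw [intervalIntegral.integral_comp_add_right, zero_add, add_comm (1 : ℝ)]
    simpa using hgp.intervalIntegral_add_eq (N * α) 0
  have key : ∫ t in (0 : ℝ)..1, (N * (l - H) + (g (t + N * α) - g t)) = N * (l - H) := by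
    rw [intervalIntegral.integral_add intervalIntegrable_const (hi1.sub hi2),
      intervalIntegral.integral_sub hi1 hi2, hshift]
    simp
  rw [← key]
  exact intervalIntegral.integral_mono_on zero_le_one (intervalIntegrable_const.add (hi1.sub hi2))
    ((continuous_log_mnorm_unitIter hA hL.det_eq N).intervalIntegrable _ _) fun t _ => hle t

/-- Lower semicontinuity of the exponent along a convergent sequence of split cocycles. -/
lemma le_lyapunovExp_of_tendsto {F : ℕ → SplitCocycle} {A : ℝ → Matrix (Fin 2) (Fin 2) ℝ} {C : ℝ}
    (hL : ∀ n, (F n).Valid α l) (hp : ∀ n, (F n).Per) (hA : ∀ n, Continuous (F n).A)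
    (hu : ∀ n, Continuous (F n).u) (ha : ∀ n y, (F n).a y ≤ H)
    (hC : ∀ n t, mnorm ((F n).A t) ≤ C) (hdA : ∀ t, (A t).det = 1)
    (h : ∀ t, Tendsto (fun n => (F n).A t) atTop (nhds (A t))) :
    l - H ≤ lyapunovExp α (fun x => A (x / (2 * π))) := by
  rw [lyapunovExp_comp_div]
  refine le_ciInf fun n => ?_
  have h1 := ge_of_tendsto' (tendsto_integral_log_unitIter hA (fun n => (hL n).det_eq) hC hdA h
    (n + 1)) fun k => (hL k).le_integral_log (hp k) (hA k) (hu k) (ha k) (n + 1)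
  rw [one_div, ← div_eq_inv_mul, le_div_iff₀ (by positivity)]
  push_cast at h1
  linarith

end SplitCocycle

/-- Indicator function of the set where `χ = 1`. -/
def coreFun (χ : ℝ → ℝ) (y : ℝ) : ℝ := {z | χ z = 1}.indicator 1 y

/-- The number of visits to `χ = 1` at the times `±1, …, ±m`. -/
def visits (α : ℝ) (m : ℕ) (χ : ℝ → ℝ) (y : ℝ) : ℝ :=
  ∑ j ∈ Finset.range m, coreFun χ (y + (j + 1) * α) +
    ∑ j ∈ Finset.range m, coreFun χ (y - (j + 1) * α)

/-- A primitive of `visits α m χ - 2 m coreFun χ` over the rotation. -/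
def visitWeight (α : ℝ) (m : ℕ) (χ : ℝ → ℝ) (y : ℝ) : ℝ :=
  ∑ j ∈ Finset.range (m + 1), ((m : ℝ) - j) * coreFun χ (y + j * α) -
    ∑ j ∈ Finset.range m, ((m : ℝ) - j) * coreFun χ (y - (j + 1) * α)

section

variable {α : ℝ} {m : ℕ} {χ : ℝ → ℝ}

lemma coreFun_nonneg (y : ℝ) : 0 ≤ coreFun χ y :=
  Set.indicator_nonneg (fun _ _ => zero_le_one) y

lemma coreFun_le_one (y : ℝ) : coreFun χ y ≤ 1 := by
  unfold coreFun Set.indicator; split_ifs <;> simp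

lemma coreFun_of_eq_one {y : ℝ} (h : χ y = 1) : coreFun χ y = 1 := by
  simp [coreFun, h]

lemma coreFun_of_ne_one {y : ℝ} (h : χ y ≠ 1) : coreFun χ y = 0 := by
  simp [coreFun, h]

lemma coreFun_of_eq_zero {y : ℝ} (h : χ y = 0) : coreFun χ y = 0 :=
  coreFun_of_ne_one (by rw [h]; norm_num)

lemma sum_range_shift_sub (f : ℕ → ℝ) (m : ℕ) :
    ∑ j ∈ Finset.range m, ((m : ℝ) - j) * f (j + 1) - ∑ j ∈ Finset.range m, ((m : ℝ) - j) * f j =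
      ∑ j ∈ Finset.range m, f (j + 1) - m * f 0 := by
  induction m with
  | zero => simp
  | succ m ih =>
    have h1 : ∀ g : ℕ → ℝ, ∑ j ∈ Finset.range (m + 1), (((m + 1 : ℕ) : ℝ) - j) * g j =
        ∑ j ∈ Finset.range m, ((m : ℝ) - j) * g j + ∑ j ∈ Finset.range (m + 1), g j := by
      intro g
      rw [Finset.sum_range_succ, Finset.sum_range_succ, ← add_assoc, ← Finset.sum_add_distrib]
      congr 1
      · refine Finset.sum_congr rfl fun j _ => ?_
        push_cast; ring
      · push_cast; ring
    rw [h1 fun j => f (j + 1), h1 f, Finset.sum_range_succ' f m]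
    push_cast
    linarith

lemma visitWeight_add (y : ℝ) : visitWeight α m χ (y + α) =
    visitWeight α m χ y + visits α m χ y - 2 * m * coreFun χ y := by
  unfold visitWeight visits
  rw [Finset.sum_range_succ, Finset.sum_range_succ]
  have h1 := sum_range_shift_sub (fun j => coreFun χ (y + j * α)) m
  have h2 := sum_range_shift_sub (fun j => coreFun χ (y - j * α)) m
  have e1 : ∀ j : ℕ, y + α + j * α = y + ((j + 1 : ℕ) : ℝ) * α := fun j => by push_cast; ring
  have e2 : ∀ j : ℕ, y + α - (j + 1) * α = y - j * α := fun j => by ring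
  simp only [e1, e2]
  simp only [Nat.cast_add, Nat.cast_one, Nat.cast_zero, zero_mul, add_zero, sub_zero] at h1 h2 ⊢
  linarith

lemma abs_visitWeight_le (y : ℝ) : |visitWeight α m χ y| ≤ ((m : ℝ) + 1) ^ 2 := by
  have h : ∀ (n : ℕ) (hn : n ≤ m + 1) (g : ℕ → ℝ) (_ : ∀ j, 0 ≤ g j ∧ g j ≤ 1),
      0 ≤ ∑ j ∈ Finset.range n, ((m : ℝ) - j) * g j ∧
        ∑ j ∈ Finset.range n, ((m : ℝ) - j) * g j ≤ ((m : ℝ) + 1) ^ 2 := by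
    intro n hn g hg
    have hj : ∀ j ∈ Finset.range n, (0 : ℝ) ≤ (m : ℝ) - j := fun j hj => by
      rw [Finset.mem_range] at hj
      have : (j : ℝ) ≤ m := by exact_mod_cast (by omega : j ≤ m)
      linarith
    refine ⟨Finset.sum_nonneg fun j hj' => mul_nonneg (hj j hj') (hg j).1, ?_⟩
    calc ∑ j ∈ Finset.range n, ((m : ℝ) - j) * g j
        ≤ ∑ j ∈ Finset.range n, ((m : ℝ) + 1) := Finset.sum_le_sum fun j hj' => by
          nlinarith [hj j hj', hg j, (Nat.cast_nonneg j : (0 : ℝ) ≤ j)]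
      _ = n * ((m : ℝ) + 1) := by rw [Finset.sum_const, Finset.card_range, nsmul_eq_mul]
      _ ≤ ((m : ℝ) + 1) ^ 2 := by
          have : (n : ℝ) ≤ m + 1 := by exact_mod_cast hn
          rw [sq]; gcongr
  have h1 := h (m + 1) le_rfl (fun j => coreFun χ (y + j * α))
    fun j => ⟨coreFun_nonneg _, coreFun_le_one _⟩
  have h2 := h m (by omega) (fun j => coreFun χ (y - (j + 1) * α))
    fun j => ⟨coreFun_nonneg _, coreFun_le_one _⟩
  unfold visitWeight
  rw [abs_le]
  constructor <;> linarith [h1.1, h1.2, h2.1, h2.2]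

lemma visits_eq_zero (hd : OrbitDisjoint α m χ) {y : ℝ} (hy : χ y ≠ 0) : visits α m χ y = 0 := by
  unfold visits
  rw [Finset.sum_eq_zero, Finset.sum_eq_zero, add_zero] <;> intro i hi <;>
    rw [Finset.mem_range] at hi
  · exact coreFun_of_eq_zero (hd.shift hy (-(i + 1) : ℤ) (by omega) (by rw [abs_le]; omega)
      (by push_cast; ring))
  · exact coreFun_of_eq_zero (hd.shift hy (i + 1 : ℤ) (by omega) (by rw [abs_le]; omega)
      (by push_cast; ring))

lemma visitWeight_eq (hd : OrbitDisjoint α m χ) {y : ℝ} (hy : χ y ≠ 0) :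
    visitWeight α m χ y = m * coreFun χ y := by
  unfold visitWeight
  rw [Finset.sum_range_succ', Finset.sum_eq_zero, Finset.sum_eq_zero]
  · simp
  · intro i hi
    rw [Finset.mem_range] at hi
    rw [coreFun_of_eq_zero (hd.shift hy (-(i + 1) : ℤ) (by omega) (by rw [abs_le]; omega)
      (by push_cast; ring)), mul_zero]
  · intro i hi
    rw [Finset.mem_range] at hi
    rw [coreFun_of_eq_zero (hd.shift hy (i + 1 : ℤ) (by omega) (by rw [abs_le]; omega)
      (by push_cast; ring)), mul_zero]

lemma visits_le_one (hd : OrbitDisjoint α m χ) (y : ℝ) : visits α m χ y ≤ 1 := by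
  unfold visits
  have hne : ∀ z, coreFun χ z ≠ 0 → χ z ≠ 0 := fun z hz h => hz (coreFun_of_eq_zero h)
  by_cases h1 : ∃ j < m, coreFun χ (y + (j + 1) * α) ≠ 0
  · obtain ⟨j, hj, hx⟩ := h1
    have hx := hne _ hx
    rw [Finset.sum_eq_single_of_mem j (Finset.mem_range.2 hj)]
    · rw [Finset.sum_eq_zero]
      · linarith [coreFun_le_one (χ := χ) (y + (j + 1) * α)]
      · intro i hi
        rw [Finset.mem_range] at hi
        exact coreFun_of_eq_zero (hd.shift hx (-(i + 1) - (j + 1) : ℤ) (by omega)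
          (by rw [abs_le]; omega) (by push_cast; ring))
    · intro i hi hij
      rw [Finset.mem_range] at hi
      exact coreFun_of_eq_zero (hd.shift hx (i - j : ℤ) (by omega)
        (by rw [abs_le]; omega) (by push_cast; ring))
  · push Not at h1
    rw [Finset.sum_eq_zero fun j hj => h1 j (Finset.mem_range.1 hj), zero_add]
    by_cases h2 : ∃ j < m, coreFun χ (y - (j + 1) * α) ≠ 0
    · obtain ⟨j, hj, hx⟩ := h2
      have hx := hne _ hx
      rw [Finset.sum_eq_single_of_mem j (Finset.mem_range.2 hj)]
      · exact coreFun_le_one _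
      · intro i hi hij
        rw [Finset.mem_range] at hi
        exact coreFun_of_eq_zero (hd.shift hx (j - i : ℤ) (by omega)
          (by rw [abs_le]; omega) (by push_cast; ring))
    · push Not at h2
      rw [Finset.sum_eq_zero fun j hj => h2 j (Finset.mem_range.1 hj)]
      exact zero_le_one

lemma measurable_coreFun (hχ : Continuous χ) : Measurable (coreFun χ) :=
  measurable_one.indicator (isClosed_eq hχ continuous_const).measurableSet

lemma intervalIntegrable_coreFun (hχ : Continuous χ) (c a b : ℝ) :
    IntervalIntegrable (fun y => coreFun χ (y + c)) volume a b := by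
  refine (intervalIntegrable_const (c := (1 : ℝ))).mono_fun
    ((measurable_coreFun hχ).comp (measurable_id.add_const c)).aestronglyMeasurable ?_
  refine .of_forall fun y => ?_
  simp only [norm_one]
  rw [Real.norm_of_nonneg (coreFun_nonneg _)]
  exact coreFun_le_one _

lemma integral_coreFun_shift (hp : ∀ y, χ (y + 1) = χ y) (c : ℝ) :
    ∫ y in (0 : ℝ)..1, coreFun χ (y + c) = ∫ y in (0 : ℝ)..1, coreFun χ y := by
  have hper : Function.Periodic (coreFun χ) 1 := fun y => by
    by_cases h : χ y = 1
    · rw [coreFun_of_eq_one h, coreFun_of_eq_one (by rw [hp, h])]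
    · rw [coreFun_of_ne_one h, coreFun_of_ne_one (by rw [hp]; exact h)]
  rw [intervalIntegral.integral_comp_add_right, zero_add, add_comm (1 : ℝ)]
  simpa using hper.intervalIntegral_add_eq c 0

lemma intervalIntegrable_visits (hχ : Continuous χ) (c a b : ℝ) :
    IntervalIntegrable (fun y => visits α m χ (y + c)) volume a b := by
  have h := IntervalIntegrable.sum (μ := volume) (a := a) (b := b) (Finset.range m)
    (f := fun (j : ℕ) y => coreFun χ (y + c + (j + 1) * α)) fun j _ => by
      simpa only [add_assoc] using intervalIntegrable_coreFun hχ (c + (j + 1) * α) a b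
  have h' := IntervalIntegrable.sum (μ := volume) (a := a) (b := b) (Finset.range m)
    (f := fun (j : ℕ) y => coreFun χ (y + c - (j + 1) * α)) fun j _ => by
      simpa only [add_assoc, sub_eq_add_neg] using
        intervalIntegrable_coreFun hχ (c + -((j + 1) * α)) a b
  refine (h.add h').congr ?_
  exact fun y _ => by simp [visits, Finset.sum_apply]

lemma integral_visits (hχ : Continuous χ) (hp : ∀ y, χ (y + 1) = χ y) (c : ℝ) :
    ∫ y in (0 : ℝ)..1, visits α m χ (y + c) = 2 * m * ∫ y in (0 : ℝ)..1, coreFun χ y := by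
  have e1 : ∀ (y : ℝ) (j : ℕ), y + c + (j + 1) * α = y + (c + (j + 1) * α) := fun y j => by ring
  have e2 : ∀ (y : ℝ) (j : ℕ), y + c - (j + 1) * α = y + (c - (j + 1) * α) := fun y j => by ring
  unfold visits
  simp only [e1, e2]
  rw [intervalIntegral.integral_add, intervalIntegral.integral_finsetSum,
    intervalIntegral.integral_finsetSum]
  · simp only [integral_coreFun_shift hp, Finset.sum_const, Finset.card_range, nsmul_eq_mul]
    ring
  · exact fun j _ => intervalIntegrable_coreFun hχ _ _ _
  · exact fun j _ => intervalIntegrable_coreFun hχ _ _ _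
  · refine (IntervalIntegrable.sum (μ := volume) (Finset.range m)
      (f := fun (j : ℕ) y => coreFun χ (y + (c + (j + 1) * α)))
      fun j _ => intervalIntegrable_coreFun hχ _ 0 1).congr ?_
    exact fun y _ => by simp [Finset.sum_apply]
  · refine (IntervalIntegrable.sum (μ := volume) (Finset.range m)
      (f := fun (j : ℕ) y => coreFun χ (y + (c - (j + 1) * α)))
      fun j _ => intervalIntegrable_coreFun hχ _ 0 1).congr ?_
    exact fun y _ => by simp [Finset.sum_apply]

lemma le_integral_coreFun (hχ : Continuous χ) {κ : ℝ} (h0 : 0 ≤ κ) (h1 : κ ≤ 1)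
    (h : ∀ y, 0 ≤ y → y ≤ κ → χ y = 1) : κ ≤ ∫ y in (0 : ℝ)..1, coreFun χ y := by
  have hi := fun a b => by simpa using intervalIntegrable_coreFun hχ 0 a b
  rw [← intervalIntegral.integral_add_adjacent_intervals (hi 0 κ) (hi κ 1)]
  have e : ∫ y in (0 : ℝ)..κ, coreFun χ y = κ := by
    rw [intervalIntegral.integral_congr (g := fun _ => (1 : ℝ))]
    · simp
    · intro y hy
      rw [Set.uIcc_of_le h0] at hy
      exact coreFun_of_eq_one (h y hy.1 hy.2)
  have e2 : 0 ≤ ∫ y in κ..1, coreFun χ y :=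
    intervalIntegral.integral_nonneg h1 fun y _ => coreFun_nonneg y
  linarith

end

namespace SplitCocycle

/-- The cocycle exchanging the two directions of the splitting where `χ = 1`. -/
def twist (L : SplitCocycle) (σ : ℝ) (χ : ℝ → ℝ) (y : ℝ) : Matrix (Fin 2) (Fin 2) ℝ :=
  L.A y * !![1, 0; σ * χ y, 1]

/-- The coordinate of `v` along `u`. -/
def coordU (L : SplitCocycle) (y : ℝ) (v : Fin 2 → ℝ) : ℝ := L.di y * wedge v (L.s y)

/-- The coordinate of `v` along `s`. -/
def coordS (L : SplitCocycle) (y : ℝ) (v : Fin 2 → ℝ) : ℝ := L.di y * wedge (L.u y) v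

variable {α l H σ : ℝ} {m : ℕ} {χ : ℝ → ℝ} {L : SplitCocycle}

lemma Valid.coord_eq (hL : L.Valid α l) (y : ℝ) (v : Fin 2 → ℝ) :
    L.coordU y v • L.u y + L.coordS y v • L.s y = v := by
  have h := hL.di_eq y
  ext i
  simp only [coordU, coordS, wedge, Pi.add_apply, Pi.smul_apply, smul_eq_mul] at h ⊢
  fin_cases i
  · simp only [Fin.zero_eta]
    linear_combination (v 0) * h
  · simp only [Fin.mk_one]
    linear_combination (v 1) * h

lemma Valid.coordU_comb (hL : L.Valid α l) (y p q : ℝ) :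
    L.coordU y (p • L.u y + q • L.s y) = p := by
  have h := hL.di_eq y
  simp only [coordU, wedge, Pi.add_apply, Pi.smul_apply, smul_eq_mul] at h ⊢
  linear_combination p * h

lemma Valid.coordS_comb (hL : L.Valid α l) (y p q : ℝ) :
    L.coordS y (p • L.u y + q • L.s y) = q := by
  have h := hL.di_eq y
  simp only [coordS, wedge, Pi.add_apply, Pi.smul_apply, smul_eq_mul] at h ⊢
  linear_combination q * h

lemma Valid.det_twist (hL : L.Valid α l) (y : ℝ) : (L.twist σ χ y).det = 1 := by
  simp [twist, Matrix.det_mul, hL.det_eq, Matrix.det_fin_two]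

lemma Valid.twist_mulVec (hL : L.Valid α l)
    (hfr : ∀ y, χ y ≠ 0 → L.u y = ![1, 0] ∧ L.s y = ![1, σ]) (y p q : ℝ) :
    (L.twist σ χ y).mulVec (p • L.u y + q • L.s y) =
      (Real.exp (l - L.a y) * ((1 - χ y) * p - χ y * q)) • L.u (y + α) +
      (Real.exp (-l + L.b y) * (χ y * p + (1 + χ y) * q)) • L.s (y + α) := by
  have hG : (!![1, 0; σ * χ y, 1] : Matrix (Fin 2) (Fin 2) ℝ).mulVec (p • L.u y + q • L.s y) =
      ((1 - χ y) * p - χ y * q) • L.u y + (χ y * p + (1 + χ y) * q) • L.s y := by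
    by_cases h : χ y = 0
    · rw [h]
      have : (!![1, 0; σ * 0, 1] : Matrix (Fin 2) (Fin 2) ℝ) = 1 := by
        rw [mul_zero, Matrix.one_fin_two]
      rw [this, Matrix.one_mulVec]
      simp
    · rw [(hfr y h).1, (hfr y h).2]
      ext i
      fin_cases i <;> simp [Matrix.mulVec, dotProduct, Fin.sum_univ_two] <;> ring_nf
  rw [twist, ← Matrix.mulVec_mulVec, hG, Matrix.mulVec_add, Matrix.mulVec_smul, Matrix.mulVec_smul,
    hL.u_eq, hL.s_eq, smul_smul, smul_smul, mul_comm (Real.exp _), mul_comm (Real.exp _)]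

/-- The adapted norm used to bound the growth of the twisted cocycle. -/
def adaptedNorm (L : SplitCocycle) (α l : ℝ) (m : ℕ) (χ : ℝ → ℝ) (y : ℝ) (v : Fin 2 → ℝ) : ℝ :=
  max (Real.exp (-(l * visitWeight α m χ y)) * |L.coordU y v|)
    (Real.exp (l * visitWeight α m χ y) * |L.coordS y v|)

lemma Valid.adaptedNorm_twist_le (hL : L.Valid α l) (hd : OrbitDisjoint α m χ)
    (hχ : ∀ y, 0 ≤ χ y ∧ χ y ≤ 1)
    (hfr : ∀ y, χ y ≠ 0 → L.u y = ![1, 0] ∧ L.s y = ![1, σ]) (hl : 0 ≤ l) (hH : 0 ≤ H)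
    (ha : ∀ y, 0 ≤ L.a y) (hb : ∀ y, L.b y ≤ H) (y : ℝ) (v : Fin 2 → ℝ) :
    L.adaptedNorm α l m χ (y + α) ((L.twist σ χ y).mulVec v) ≤
      Real.exp (H + Real.log 4 + l * (1 - visits α m χ y)) * L.adaptedNorm α l m χ y v := by
  set p := L.coordU y v with hp
  set q := L.coordS y v with hq
  set W := visitWeight α m χ y with hW
  set T := visits α m χ y with hT
  have hv : p • L.u y + q • L.s y = v := hL.coord_eq y v
  have hQ : L.adaptedNorm α l m χ y v =
    max (Real.exp (-(l * W)) * |p|) (Real.exp (l * W) * |q|) := rfl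
  set Q := L.adaptedNorm α l m χ y v with hQdef
  have hpQ : |p| ≤ Real.exp (l * W) * Q := by
    have : Real.exp (-(l * W)) * |p| ≤ Q := by rw [hQ]; exact le_max_left _ _
    calc |p| = Real.exp (l * W) * (Real.exp (-(l * W)) * |p|) := by
          rw [← mul_assoc, ← Real.exp_add]; simp
      _ ≤ _ := by gcongr
  have hqQ : |q| ≤ Real.exp (-(l * W)) * Q := by
    have : Real.exp (l * W) * |q| ≤ Q := by rw [hQ]; exact le_max_right _ _
    calc |q| = Real.exp (-(l * W)) * (Real.exp (l * W) * |q|) := by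
          rw [← mul_assoc, ← Real.exp_add]; simp
      _ ≤ _ := by gcongr
  have hQ0 : 0 ≤ Q := by
    rw [hQ]; exact (by positivity : (0 : ℝ) ≤ Real.exp (-(l * W)) * |p|).trans (le_max_left _ _)
  have hc0 := (hχ y).1
  have hc1 := (hχ y).2
  have hlog : Real.exp (Real.log 4) = 4 := Real.exp_log (by norm_num)
  have hfin : ∀ e1 e2 f : ℝ, 0 ≤ f → f ≤ 4 → e1 ≤ e2 + H →
      Real.exp e1 * f * Q ≤ Real.exp (H + Real.log 4 + e2) * Q := by
    intro e1 e2 f hf0 hf he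
    rw [show H + Real.log 4 + e2 = (e2 + H) + Real.log 4 by ring, Real.exp_add (e2 + H), hlog]
    gcongr
  rw [← hv, hL.twist_mulVec hfr]
  unfold adaptedNorm
  rw [hL.coordU_comb, hL.coordS_comb, visitWeight_add, ← hW, ← hT, abs_mul, abs_mul,
    abs_of_pos (Real.exp_pos _), abs_of_pos (Real.exp_pos _), ← mul_assoc, ← mul_assoc,
    ← Real.exp_add, ← Real.exp_add]
  by_cases h : χ y = 0
  · rw [h, coreFun_of_eq_zero h]
    have hT1 : T ≤ 1 := visits_le_one hd y
    refine max_le ?_ ?_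
    · calc Real.exp (-(l * (W + T - 2 * m * 0)) + (l - L.a y)) * |(1 - 0) * p - 0 * q|
          = Real.exp (-(l * (W + T - 2 * m * 0)) + (l - L.a y)) * |p| := by simp
        _ ≤ Real.exp (-(l * (W + T - 2 * m * 0)) + (l - L.a y)) * (Real.exp (l * W) * Q) := by
            gcongr
        _ = Real.exp (l * (1 - T) - L.a y) * 1 * Q := by
            rw [← mul_assoc, ← Real.exp_add, mul_one]; congr 2; ring
        _ ≤ _ := hfin _ _ _ zero_le_one (by norm_num) (by linarith [ha y])
    · calc Real.exp (l * (W + T - 2 * m * 0) + (-l + L.b y)) * |0 * p + (1 + 0) * q|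
          = Real.exp (l * (W + T - 2 * m * 0) + (-l + L.b y)) * |q| := by simp
        _ ≤ Real.exp (l * (W + T - 2 * m * 0) + (-l + L.b y)) * (Real.exp (-(l * W)) * Q) := by
            gcongr
        _ = Real.exp (l * (T - 1) + L.b y) * 1 * Q := by
            rw [← mul_assoc, ← Real.exp_add, mul_one]; congr 2; ring
        _ ≤ _ := hfin _ _ _ zero_le_one (by norm_num) (by nlinarith [hb y])
  · have hT0 : T = 0 := visits_eq_zero hd h
    have hW0 : W = m * coreFun χ y := visitWeight_eq hd h
    by_cases h1 : χ y = 1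
    · rw [coreFun_of_eq_one h1, mul_one] at hW0
      rw [h1, coreFun_of_eq_one h1, hT0, hW0]
      rw [hW0] at hpQ hqQ
      have hlm : 0 ≤ l * m := by positivity
      refine max_le ?_ ?_
      · calc Real.exp (-(l * (m + 0 - 2 * m * 1)) + (l - L.a y)) * |(1 - 1) * p - 1 * q|
            = Real.exp (-(l * (m + 0 - 2 * m * 1)) + (l - L.a y)) * |q| := by simp
          _ ≤ Real.exp (-(l * (m + 0 - 2 * m * 1)) + (l - L.a y)) *
              (Real.exp (-(l * m)) * Q) := by gcongr
          _ = Real.exp (l - L.a y) * 1 * Q := by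
              rw [← mul_assoc, ← Real.exp_add, mul_one]; congr 2; ring_nf
          _ ≤ _ := hfin _ _ _ zero_le_one (by norm_num) (by linarith [ha y])
      · have h3 : |1 * p + (1 + 1) * q| ≤ 3 * (Real.exp (l * m) * Q) := by
          have h4 : Real.exp (-(l * m)) ≤ Real.exp (l * m) := Real.exp_le_exp.2 (by linarith)
          have h5 := mul_le_mul_of_nonneg_right h4 hQ0
          calc |1 * p + (1 + 1) * q| ≤ |1 * p| + |(1 + 1) * q| := abs_add_le _ _
            _ = |p| + 2 * |q| := by rw [abs_mul, abs_mul]; norm_num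
            _ ≤ _ := by linarith
        calc _ ≤ Real.exp (l * (m + 0 - 2 * m * 1) + (-l + L.b y)) *
              (3 * (Real.exp (l * m) * Q)) := by gcongr
          _ = Real.exp (-l + L.b y) * 3 * Q := by
              rw [show l * (m + 0 - 2 * m * 1) + (-l + L.b y) = -(l * m) + (-l + L.b y) by ring,
                Real.exp_add]
              have : Real.exp (-(l * m)) * Real.exp (l * m) = 1 := by rw [← Real.exp_add]; simp
              linear_combination (3 * Real.exp (-l + L.b y) * Q) * this
          _ ≤ _ := hfin _ _ _ (by norm_num) (by norm_num) (by linarith [hb y])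
    · rw [coreFun_of_ne_one h1, mul_zero] at hW0
      rw [coreFun_of_ne_one h1, hT0, hW0]
      rw [hW0, mul_zero, neg_zero, Real.exp_zero, one_mul] at hqQ
      rw [hW0, mul_zero, Real.exp_zero, one_mul] at hpQ
      refine max_le ?_ ?_
      · have h3 : |(1 - χ y) * p - χ y * q| ≤ 1 * Q := by
          calc |(1 - χ y) * p - χ y * q| ≤ |(1 - χ y) * p| + |χ y * q| := abs_sub _ _
            _ = (1 - χ y) * |p| + χ y * |q| := by
                rw [abs_mul, abs_mul, abs_of_nonneg hc0, abs_of_nonneg (sub_nonneg.2 hc1)]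
            _ ≤ (1 - χ y) * Q + χ y * Q := by
                have := sub_nonneg.2 hc1
                gcongr
            _ = 1 * Q := by ring
        calc _ ≤ Real.exp (-(l * (0 + 0 - 2 * m * 0)) + (l - L.a y)) * (1 * Q) := by gcongr
          _ = Real.exp (l - L.a y) * 1 * Q := by
              rw [← mul_assoc]; congr 3; ring
          _ ≤ _ := hfin _ _ _ zero_le_one (by norm_num) (by linarith [ha y])
      · have h3 : |χ y * p + (1 + χ y) * q| ≤ 3 * Q := by
          calc |χ y * p + (1 + χ y) * q| ≤ |χ y * p| + |(1 + χ y) * q| := abs_add_le _ _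
            _ = χ y * |p| + (1 + χ y) * |q| := by
                rw [abs_mul, abs_mul, abs_of_nonneg hc0, abs_of_nonneg (by linarith : 0 ≤ 1 + χ y)]
            _ ≤ 1 * Q + (1 + 1) * Q := by gcongr
            _ = 3 * Q := by ring
        calc _ ≤ Real.exp (l * (0 + 0 - 2 * m * 0) + (-l + L.b y)) * (3 * Q) := by gcongr
          _ = Real.exp (-l + L.b y) * 3 * Q := by
              rw [← mul_assoc]; congr 3; ring
          _ ≤ _ := hfin _ _ _ (by norm_num) (by norm_num) (by linarith [hb y])

lemma Valid.adaptedNorm_iter_le (hL : L.Valid α l) (hd : OrbitDisjoint α m χ)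
    (hχ : ∀ y, 0 ≤ χ y ∧ χ y ≤ 1)
    (hfr : ∀ y, χ y ≠ 0 → L.u y = ![1, 0] ∧ L.s y = ![1, σ]) (hl : 0 ≤ l) (hH : 0 ≤ H)
    (ha : ∀ y, 0 ≤ L.a y) (hb : ∀ y, L.b y ≤ H) (N : ℕ) (t : ℝ) (v : Fin 2 → ℝ) :
    L.adaptedNorm α l m χ (t + N * α) ((unitIter α (L.twist σ χ) N t).mulVec v) ≤
      Real.exp (∑ j ∈ Finset.range N, (H + Real.log 4 + l * (1 - visits α m χ (t + j * α)))) *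
        L.adaptedNorm α l m χ t v := by
  induction N with
  | zero => simp [unitIter]
  | succ N ih =>
    rw [unitIter, ← Matrix.mulVec_mulVec, Finset.sum_range_succ, add_comm (Finset.sum _ _),
      Real.exp_add, mul_assoc]
    rw [show t + ((N + 1 : ℕ) : ℝ) * α = t + N * α + α by push_cast; ring]
    exact (hL.adaptedNorm_twist_le hd hχ hfr hl hH ha hb _ _).trans
      (mul_le_mul_of_nonneg_left ih (Real.exp_pos _).le)

lemma exists_bound_of_periodic {g : ℝ → ℝ} (hg : Continuous g) (hp : ∀ y, g (y + 1) = g y) :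
    ∃ C, 0 ≤ C ∧ ∀ y, |g y| ≤ C := by
  have h : Bornology.IsBounded (Set.range g) :=
    Function.Periodic.isBounded_of_continuous (c := 1) hp one_ne_zero hg
  obtain ⟨C, hC⟩ := h.exists_norm_le
  exact ⟨C, (norm_nonneg _).trans (hC _ ⟨0, rfl⟩), fun y => hC _ ⟨y, rfl⟩⟩

lemma Valid.exists_adaptedNorm_bounds (hL : L.Valid α l) (hp : L.Per) (hu : Continuous L.u)
    (hs : Continuous L.s) (hdi : Continuous L.di) (hl : 0 ≤ l) (m : ℕ) (χ : ℝ → ℝ) :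
    ∃ C, 0 < C ∧ ∀ y v, L.adaptedNorm α l m χ y v ≤ C * ‖WithLp.toLp 2 v‖ ∧
      ‖WithLp.toLp 2 v‖ ≤ C * L.adaptedNorm α l m χ y v := by
  have hb : ∀ i, ∃ C, 0 ≤ C ∧ ∀ y, |L.u y i| ≤ C := fun i =>
    exists_bound_of_periodic ((continuous_apply i).comp hu) fun y => by
      simp only [hp.u]
  have hb' : ∀ i, ∃ C, 0 ≤ C ∧ ∀ y, |L.s y i| ≤ C := fun i =>
    exists_bound_of_periodic ((continuous_apply i).comp hs) fun y => by
      simp only [hp.s]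
  choose U hU0 hU using hb
  choose S hS0 hS using hb'
  obtain ⟨Δ, hΔ0, hΔ⟩ := exists_bound_of_periodic hdi hp.di
  set V := U 0 + U 1 + S 0 + S 1 with hV
  have hV0 : 0 ≤ V := by have := hU0 0; have := hU0 1; have := hS0 0; have := hS0 1; positivity
  have hUV : ∀ i y, |L.u y i| ≤ V := fun i y => by
    have := hU0 0; have := hU0 1; have := hS0 0; have := hS0 1
    refine (hU i y).trans ?_
    fin_cases i <;> simp only [hV, Fin.zero_eta, Fin.mk_one] <;> linarith
  have hSV : ∀ i y, |L.s y i| ≤ V := fun i y => by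
    have := hU0 0; have := hU0 1; have := hS0 0; have := hS0 1
    refine (hS i y).trans ?_
    fin_cases i <;> simp only [hV, Fin.zero_eta, Fin.mk_one] <;> linarith
  set E := Real.exp (l * ((m : ℝ) + 1) ^ 2) with hE
  have hE1 : 0 < E := Real.exp_pos _
  have hw : ∀ y, Real.exp (l * visitWeight α m χ y) ≤ E ∧
      Real.exp (-(l * visitWeight α m χ y)) ≤ E := fun y => by
    have h := abs_le.1 (abs_visitWeight_le (α := α) (m := m) (χ := χ) y)
    constructor <;> refine Real.exp_le_exp.2 ?_ <;> nlinarith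
  have hwedge : ∀ a b : Fin 2 → ℝ, ∀ x y : ℝ, (∀ i, |a i| ≤ x) → (∀ i, |b i| ≤ y) → 0 ≤ x →
      |wedge a b| ≤ 2 * x * y := by
    intro a b x y hx hy hx0
    calc |wedge a b| ≤ |a 0 * b 1| + |a 1 * b 0| := abs_sub _ _
      _ ≤ x * y + x * y := by
          rw [abs_mul, abs_mul]
          gcongr
          · exact hx 0
          · exact hy 1
          · exact hx 1
          · exact hy 0
      _ = 2 * x * y := by ring
  refine ⟨E * (Δ * (2 * V)) + 4 * E * V + 1, by positivity, fun y v => ⟨?_, ?_⟩⟩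
  · have hv : ∀ i, |v i| ≤ ‖WithLp.toLp 2 v‖ := abs_apply_le_norm_toLp v
    have hn := norm_nonneg (WithLp.toLp 2 v)
    have h1 : |L.coordU y v| ≤ Δ * (2 * V) * ‖WithLp.toLp 2 v‖ := by
      rw [coordU, abs_mul]
      calc |L.di y| * |wedge v (L.s y)| ≤ Δ * (2 * ‖WithLp.toLp 2 v‖ * V) := by
            gcongr
            · exact hΔ y
            · exact hwedge _ _ _ _ hv (fun i => hSV i y) hn
        _ = _ := by ring
    have h2 : |L.coordS y v| ≤ Δ * (2 * V) * ‖WithLp.toLp 2 v‖ := by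
      rw [coordS, abs_mul]
      calc |L.di y| * |wedge (L.u y) v| ≤ Δ * (2 * V * ‖WithLp.toLp 2 v‖) := by
            gcongr
            · exact hΔ y
            · exact hwedge _ _ _ _ (fun i => hUV i y) hv hV0
        _ = _ := by ring
    have h3 : L.adaptedNorm α l m χ y v ≤ E * (Δ * (2 * V) * ‖WithLp.toLp 2 v‖) :=
      max_le (mul_le_mul (hw y).2 h1 (abs_nonneg _) hE1.le)
        (mul_le_mul (hw y).1 h2 (abs_nonneg _) hE1.le)
    have : 0 ≤ (4 * E * V + 1) * ‖WithLp.toLp 2 v‖ := by positivity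
    linarith
  · set Q := L.adaptedNorm α l m χ y v with hQ
    have h1 : |L.coordU y v| ≤ E * Q := by
      calc |L.coordU y v| = Real.exp (l * visitWeight α m χ y) *
            (Real.exp (-(l * visitWeight α m χ y)) * |L.coordU y v|) := by
            rw [← mul_assoc, ← Real.exp_add]; simp
        _ ≤ E * Q := mul_le_mul (hw y).1 (le_max_left _ _) (by positivity) hE1.le
    have h2 : |L.coordS y v| ≤ E * Q := by
      calc |L.coordS y v| = Real.exp (-(l * visitWeight α m χ y)) *
            (Real.exp (l * visitWeight α m χ y) * |L.coordS y v|) := by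
            rw [← mul_assoc, ← Real.exp_add]; simp
        _ ≤ E * Q := mul_le_mul (hw y).2 (le_max_right _ _) (by positivity) hE1.le
    have hQ0 : 0 ≤ Q := (by positivity : (0 : ℝ) ≤ Real.exp (-(l * visitWeight α m χ y)) *
      |L.coordU y v|).trans (le_max_left _ _)
    have h3 : ∀ i, |v i| ≤ E * Q * V + E * Q * V := fun i => by
      conv_lhs => rw [← hL.coord_eq y v]
      simp only [Pi.add_apply, Pi.smul_apply, smul_eq_mul]
      refine (abs_add_le _ _).trans ?_
      rw [abs_mul, abs_mul]
      gcongr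
      · exact hUV i y
      · exact hSV i y
    have h4 := norm_toLp_le_add v
    have h5 : 0 ≤ (E * (Δ * (2 * V)) + 1) * Q := by positivity
    linarith [h3 0, h3 1]

lemma continuous_twist (hA : Continuous L.A) (hχ : Continuous χ) :
    Continuous (L.twist σ χ) := by
  refine hA.matrix_mul (continuous_matrix fun i j => ?_)
  fin_cases i <;> fin_cases j <;> simp <;> fun_prop

/-- The Lyapunov exponent drops when the two directions of the splitting are exchanged. -/
lemma Valid.lyapunovExp_twist_le (hL : L.Valid α l) (hp : L.Per) (hA : Continuous L.A)
    (hu : Continuous L.u) (hs : Continuous L.s) (hdi : Continuous L.di)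
    (hd : OrbitDisjoint α m χ) (hχc : Continuous χ) (hχp : ∀ y, χ (y + 1) = χ y)
    (hχ : ∀ y, 0 ≤ χ y ∧ χ y ≤ 1)
    (hfr : ∀ y, χ y ≠ 0 → L.u y = ![1, 0] ∧ L.s y = ![1, σ]) (hl : 0 ≤ l) (hH : 0 ≤ H)
    (ha : ∀ y, 0 ≤ L.a y) (hb : ∀ y, L.b y ≤ H) {κ : ℝ} (h0 : 0 ≤ κ) (h1 : κ ≤ 1)
    (hκ : ∀ y, 0 ≤ y → y ≤ κ → χ y = 1) :
    lyapunovExp α (fun x => L.twist σ χ (x / (2 * π))) ≤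
      H + Real.log 4 + l * (1 - 2 * m * κ) := by
  obtain ⟨C, hC, hCb⟩ := hL.exists_adaptedNorm_bounds hp hu hs hdi hl m χ
  have hdet : ∀ t, (L.twist σ χ t).det = 1 := hL.det_twist
  have hcont := continuous_twist (σ := σ) hA hχc
  set Z := H + Real.log 4 + l * (1 - 2 * m * ∫ y in (0 : ℝ)..1, coreFun χ y) with hZ
  have hint : ∀ N : ℕ, ∫ t in (0 : ℝ)..1, Real.log (mnorm (unitIter α (L.twist σ χ) N t)) ≤
      Real.log (C * C) + N * Z := fun N => by
    have hpt : ∀ t, Real.log (mnorm (unitIter α (L.twist σ χ) N t)) ≤ Real.log (C * C) +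
        ∑ j ∈ Finset.range N, (H + Real.log 4 + l * (1 - visits α m χ (t + j * α))) := fun t => by
      set S' := ∑ j ∈ Finset.range N, (H + Real.log 4 + l * (1 - visits α m χ (t + j * α)))
      have : mnorm (unitIter α (L.twist σ χ) N t) ≤ C * C * Real.exp S' := by
        refine mnorm_le_of_mulVec (by positivity) fun v => ?_
        have e1 := (hCb (t + N * α) ((unitIter α (L.twist σ χ) N t).mulVec v)).2
        have e2 := hL.adaptedNorm_iter_le hd hχ hfr hl hH ha hb N t v
        have e3 := (hCb t v).1
        calc _ ≤ _ := e1
          _ ≤ C * (Real.exp S' * (C * ‖WithLp.toLp 2 v‖)) := by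
              refine mul_le_mul_of_nonneg_left (e2.trans ?_) hC.le
              exact mul_le_mul_of_nonneg_left e3 (Real.exp_pos _).le
          _ = _ := by ring
      have h2 := Real.log_le_log (zero_lt_one.trans_le (one_le_mnorm (det_unitIter hdet N t))) this
      rwa [Real.log_mul (by positivity) (Real.exp_pos _).ne', Real.log_exp] at h2
    have hi : ∀ j ∈ Finset.range N, IntervalIntegrable
        (fun t => H + Real.log 4 + l * (1 - visits α m χ (t + j * α))) volume 0 1 := fun j _ =>
      intervalIntegrable_const.add
        ((intervalIntegrable_const.sub (intervalIntegrable_visits hχc _ _ _)).const_mul l)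
    have hsum : IntervalIntegrable (fun t => ∑ j ∈ Finset.range N,
        (H + Real.log 4 + l * (1 - visits α m χ (t + j * α)))) volume 0 1 := by
      refine (IntervalIntegrable.sum _ hi).congr ?_
      exact fun y _ => by simp only [Finset.sum_apply]
    have hval : ∫ t in (0 : ℝ)..1, (Real.log (C * C) + ∑ j ∈ Finset.range N,
        (H + Real.log 4 + l * (1 - visits α m χ (t + j * α)))) = Real.log (C * C) + N * Z := by
      rw [intervalIntegral.integral_add intervalIntegrable_const hsum,
        intervalIntegral.integral_finsetSum hi]
      have : ∀ j : ℕ, ∫ t in (0 : ℝ)..1, (H + Real.log 4 + l * (1 - visits α m χ (t + j * α))) = Z :=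
        fun j => by
          rw [intervalIntegral.integral_add intervalIntegrable_const
            ((intervalIntegrable_const.sub (intervalIntegrable_visits hχc _ _ _)).const_mul l),
            intervalIntegral.integral_const_mul, intervalIntegral.integral_sub
            intervalIntegrable_const (intervalIntegrable_visits hχc _ _ _),
            integral_visits hχc hχp]
          simp [hZ]
      simp only [this]
      simp
    rw [← hval]
    exact intervalIntegral.integral_mono_on zero_le_one
      ((continuous_log_mnorm_unitIter hcont hdet N).intervalIntegrable _ _)
      (intervalIntegrable_const.add hsum) fun t _ => hpt t
  have hZκ : Z ≤ H + Real.log 4 + l * (1 - 2 * m * κ) := by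
    have := le_integral_coreFun hχc h0 h1 hκ
    rw [hZ]
    have h5 : (0 : ℝ) ≤ 2 * m * l := by positivity
    nlinarith
  refine le_trans ?_ hZκ
  rw [lyapunovExp_comp_div]
  have hbdd : BddBelow (Set.range fun n : ℕ => (1 / ((n : ℝ) + 1)) *
      ∫ t in (0 : ℝ)..1, Real.log (mnorm (unitIter α (L.twist σ χ) (n + 1) t))) := by
    refine ⟨0, ?_⟩
    rintro _ ⟨n, rfl⟩
    exact mul_nonneg (by positivity) (intervalIntegral.integral_nonneg zero_le_one fun t _ =>
      log_mnorm_unitIter_nonneg hdet _ t)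
  have hlim : Tendsto (fun n : ℕ => Real.log (C * C) * (1 / ((n : ℝ) + 1)) + Z) atTop
      (nhds (Real.log (C * C) * 0 + Z)) :=
    (tendsto_one_div_add_atTop_nhds_zero_nat.const_mul _).add_const _
  rw [mul_zero, zero_add] at hlim
  refine ge_of_tendsto' hlim fun n => (ciInf_le hbdd n).trans ?_
  have h6 := hint (n + 1)
  have h7 : (0 : ℝ) < (n : ℝ) + 1 := by positivity
  calc _ ≤ 1 / ((n : ℝ) + 1) * (Real.log (C * C) + ((n + 1 : ℕ) : ℝ) * Z) := by gcongr
    _ = _ := by push_cast; field_simp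

end SplitCocycle

lemma GevB.tsum {s K : ℝ} {f : ℕ → ℝ → ℝ} {c : ℕ → ℝ} (hf : ∀ i, GevB s K (c i) (f i))
    (hc : Summable c) : GevB s K (∑' i, c i) (fun x => ∑' i, f i x) := by
  have hv : ∀ k : ℕ, ((k : ℕ∞) ≤ (⊤ : ℕ∞)) → Summable fun i => c i * gevWeight s K k :=
    fun k _ => hc.mul_right _
  have hb : ∀ (k : ℕ) (i : ℕ) (x : ℝ), ((k : ℕ∞) ≤ (⊤ : ℕ∞)) →
      ‖iteratedFDeriv ℝ k (f i) x‖ ≤ c i * gevWeight s K k := fun k i x _ => by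
    rw [norm_iteratedFDeriv_eq_norm_iteratedDeriv]
    exact (hf i).2 k x
  refine ⟨contDiff_tsum (fun i => (hf i).1) hv hb, fun k x => ?_⟩
  rw [← Real.norm_eq_abs, ← norm_iteratedFDeriv_eq_norm_iteratedDeriv,
    iteratedFDeriv_tsum_apply (fun i => (hf i).1) hv hb le_top x, ← tsum_mul_right]
  exact tsum_of_norm_bounded (hv k le_top).hasSum fun i => hb k i x le_top

/-- Entrywise Gevrey bounds for matrix valued maps. -/
def MatGevB (s K C : ℝ) (F : ℝ → Matrix (Fin 2) (Fin 2) ℝ) : Prop :=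
  ∀ i j, GevB s K C fun x => F x i j

/-- Componentwise Gevrey bounds for vector valued maps. -/
def VecGevB (s K C : ℝ) (v : ℝ → Fin 2 → ℝ) : Prop :=
  ∀ i, GevB s K C fun x => v x i

section

variable {s K : ℝ}

lemma MatGevB.continuous {C : ℝ} {F : ℝ → Matrix (Fin 2) (Fin 2) ℝ} (hF : MatGevB s K C F) :
    Continuous F :=
  continuous_matrix fun i j => (hF i j).1.continuous

lemma VecGevB.continuous {C : ℝ} {v : ℝ → Fin 2 → ℝ} (hv : VecGevB s K C v) : Continuous v :=
  continuous_pi fun i => (hv i).1.continuous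

lemma MatGevB.mul (hs : 1 ≤ s) (hK : 0 ≤ K) {C₁ C₂ : ℝ} {F G : ℝ → Matrix (Fin 2) (Fin 2) ℝ}
    (hF : MatGevB s K C₁ F) (hG : MatGevB s K C₂ G) :
    MatGevB s K (C₁ * C₂) fun x => F x * G x := by
  intro i j
  have h := ((hF i 0).mul hs hK (hG 0 j)).add ((hF i 1).mul hs hK (hG 1 j))
  simp only [Matrix.mul_apply, Fin.sum_univ_two]
  convert h using 1
  ring

lemma MatGevB.nonneg {C : ℝ} {F : ℝ → Matrix (Fin 2) (Fin 2) ℝ} (hF : MatGevB s K C F) : 0 ≤ C :=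
  (hF 0 0).nonneg

lemma MatGevB.add {C₁ C₂ : ℝ} {F G : ℝ → Matrix (Fin 2) (Fin 2) ℝ}
    (hF : MatGevB s K C₁ F) (hG : MatGevB s K C₂ G) :
    MatGevB s K (C₁ + C₂) fun x => F x + G x :=
  fun i j => (hF i j).add (hG i j)

lemma MatGevB.mono (hK : 0 ≤ K) {C₁ C₂ : ℝ} {F : ℝ → Matrix (Fin 2) (Fin 2) ℝ}
    (hF : MatGevB s K C₁ F) (h : C₁ ≤ C₂) : MatGevB s K C₂ F :=
  fun i j => (hF i j).mono hK h

/-- Multiplying by three factors close to the identity is a small perturbation. -/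
lemma MatGevB.mul_near_one (hs : 1 ≤ s) (hK : 0 ≤ K) {C τ : ℝ} (hτ : τ ≤ 1)
    {F E₁ E₂ E₃ : ℝ → Matrix (Fin 2) (Fin 2) ℝ} (hF : MatGevB s K C F)
    (h₁ : MatGevB s K τ fun x => E₁ x - 1) (h₂ : MatGevB s K τ fun x => E₂ x - 1)
    (h₃ : MatGevB s K τ fun x => E₃ x - 1) :
    MatGevB s K (7 * C * τ) fun x => F x * E₁ x * E₂ x * E₃ x - F x := by
  have hτ0 := h₁.nonneg
  have hC := hF.nonneg
  have d₁ := hF.mul hs hK h₁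
  have d₂ := (hF.add d₁).mul hs hK h₂
  have d₃ := ((hF.add d₁).add d₂).mul hs hK h₃
  have h := ((d₁.add d₂).add d₃).mono hK (C₂ := 7 * C * τ) (by
    have h2 : C * τ * τ ≤ C * τ * 1 := by gcongr
    have h3 : C * τ * τ * τ ≤ C * τ * 1 * 1 := by gcongr
    nlinarith)
  have e : ∀ x, F x * E₁ x * E₂ x * E₃ x - F x = F x * (E₁ x - 1) +
      (F x + F x * (E₁ x - 1)) * (E₂ x - 1) +
      (F x + F x * (E₁ x - 1) + (F x + F x * (E₁ x - 1)) * (E₂ x - 1)) * (E₃ x - 1) := fun x => by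
    simp only [mul_sub, mul_one]
    abel_nf
  simpa only [e] using h

lemma matGevB_shear_sub_one (hs : 1 ≤ s) (hK : 0 ≤ K) {T X : ℝ} {c : ℝ → ℝ} {w : ℝ → Fin 2 → ℝ}
    (hc : GevB s K T c) (hw : VecGevB s K X w) :
    MatGevB s K (T * X ^ 2 / 4) fun x => shear (c x) (w x) - 1 := by
  have h : ∀ i j, GevB s K (T * X ^ 2 / 4) fun x => c x * (w x i * w x j) := fun i j => by
    convert hc.mul hs hK ((hw i).mul hs hK (hw j)) using 1
    ring
  intro i j
  fin_cases i <;> fin_cases j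
  · convert (h 1 0).neg using 1
    ext x; simp [shear]
  · convert h 0 0 using 1
    ext x; simp [shear]
  · convert (h 1 1).neg using 1
    ext x; simp [shear]
  · convert h 0 1 using 1
    ext x; simp [shear]

/-- The translates of the closed support of `χ` by `k α`, `|k| ≤ 2 m + 1`, are pairwise disjoint. -/
def OrbitSeparated (α : ℝ) (m : ℕ) (χ : ℝ → ℝ) : Prop :=
  ∀ (y : ℝ) (k : ℤ), k ≠ 0 → |k| ≤ 2 * m + 1 →
    χ =ᶠ[nhds y] 0 ∨ χ =ᶠ[nhds (y + k * α)] 0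

lemma OrbitSeparated.orbitDisjoint {α : ℝ} {m : ℕ} {χ : ℝ → ℝ} (h : OrbitSeparated α m χ) :
    OrbitDisjoint α m χ := fun y k hk hk' hy => by
  rcases h y k hk hk' with h | h
  · exact absurd h.eq_of_nhds hy
  · exact h.eq_of_nhds

variable {α h : ℝ} {m : ℕ} {χ r : ℝ → ℝ}

lemma OrbitSeparated.gevB_sum (hsep : OrbitSeparated α m χ) (hK : 0 ≤ K) (hχ : GevB s K 16 χ)
    (c : ℕ → ℝ) (hc : ∀ j < m, |c j| ≤ 1) (p : ℕ → ℤ) (hp : ∀ i j, i ≠ j → p i ≠ p j)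
    (hp' : ∀ i < m, |p i| ≤ m) :
    GevB s K 16 fun y => ∑ j ∈ Finset.range m, c j * χ (y + p j * α) := by
  refine GevB.disjoint_sum _ hK (by norm_num) (fun j hj => ?_) fun x i hi j hj hij => ?_
  · refine ((hχ.comp_add_const (p j * α)).const_mul (c j)).mono hK ?_
    have := hc j (Finset.mem_range.1 hj)
    linarith
  · rw [Finset.mem_range] at hi hj
    have hpi := abs_le.1 (hp' i hi)
    have hpj := abs_le.1 (hp' j hj)
    have key : ∀ q : ℕ, χ =ᶠ[nhds (x + p q * α)] 0 →
        (fun y => c q * χ (y + p q * α)) =ᶠ[nhds x] 0 := fun q hq => by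
      have ht : Tendsto (fun y : ℝ => y + p q * α) (nhds x) (nhds (x + p q * α)) :=
        (continuous_id.add continuous_const).tendsto x
      filter_upwards [ht.eventually hq] with y hy
      simp only [Pi.zero_apply] at hy ⊢
      rw [hy, mul_zero]
    rcases hsep (x + p i * α) (p j - p i) (sub_ne_zero.2 (hp j i hij.symm))
      (by rw [abs_le]; omega) with h | h
    · exact Or.inl (key i h)
    · refine Or.inr (key j ?_)
      convert h using 2
      push_cast; ring

lemma gevB_exp_le (hs : 1 ≤ s) (hK : 0 ≤ K) {C : ℝ} {f : ℝ → ℝ} (hf : GevB s K (16 * C) f) :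
    GevB s K (Real.exp (48 * C + 3)) fun x => Real.exp (f x) := by
  have := hf.exp hs hK
  rwa [show 3 * (16 * C + 1) = 48 * C + 3 by ring] at this

lemma gevB_mul_const_le (hK : 0 ≤ K) (hχ : GevB s K 16 χ) {c h : ℝ} (hc : |c| ≤ h) :
    GevB s K (16 * h) fun y => c * χ y :=
  (hχ.const_mul c).mono hK (by linarith)

lemma sixteen_le_exp_three : (16 : ℝ) ≤ Real.exp 3 := by
  have h := Real.exp_one_gt_d9
  have : Real.exp 3 = Real.exp 1 ^ 3 := by rw [← Real.exp_nat_mul]; norm_num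
  rw [this]
  calc (16 : ℝ) ≤ 2.7 ^ 3 := by norm_num
    _ ≤ _ := by gcongr; linarith

lemma two_le_exp_one : (2 : ℝ) ≤ Real.exp 1 := by
  have h := Real.exp_one_gt_d9
  linarith

lemma gevB_exp_sub_one (hs : 1 ≤ s) (hK : 0 ≤ K) (hχ : GevB s K 16 χ) (h0 : 0 ≤ h) :
    GevB s K (Real.exp (48 * h + 4)) fun y => Real.exp (h * χ y) - 1 := by
  have h1 := gevB_exp_le hs hK (gevB_mul_const_le hK hχ (abs_of_nonneg h0).le)
  refine (h1.sub (GevB.const hK 1)).mono hK ?_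
  have h2 : Real.exp 3 ≤ Real.exp (48 * h + 3) := Real.exp_le_exp.2 (by linarith)
  have h3 : Real.exp (48 * h + 4) = Real.exp (48 * h + 3) * Real.exp 1 := by
    rw [← Real.exp_add]; ring_nf
  rw [h3, abs_one]
  nlinarith [two_le_exp_one, sixteen_le_exp_three]

lemma gevB_dipFun (hs : 1 ≤ s) (hK : 0 ≤ K) (hχ : GevB s K 16 χ) (h0 : 0 ≤ h) :
    GevB s K (Real.exp (48 * h + 4)) (dipFun h χ) := by
  have h1 := gevB_exp_le hs hK (gevB_mul_const_le hK hχ (c := -h) (h := h)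
    (by rw [abs_neg, abs_of_nonneg h0]))
  have h4 := ((GevB.const hK 1).sub h1).mono hK (C₂ := Real.exp (48 * h + 4)) (by
    have h2 : Real.exp 3 ≤ Real.exp (48 * h + 3) := Real.exp_le_exp.2 (by linarith)
    have h3 : Real.exp (48 * h + 4) = Real.exp (48 * h + 3) * Real.exp 1 := by
      rw [← Real.exp_add]; ring_nf
    rw [h3, abs_one]
    nlinarith [two_le_exp_one, sixteen_le_exp_three])
  convert h4 using 1
  ext y
  simp [dipFun]

variable {l H : ℝ} {L : SplitCocycle}

lemma gevB_birkhoff_exp (hs : 1 ≤ s) (hK : 0 ≤ K) {a : ℝ → ℝ} (ha : GevB s K (32 * H) a) (j : ℕ)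
    (c : ℕ → ℝ) :
    GevB s K (Real.exp ((96 * H - 2 * l) * j + 3))
      fun x => Real.exp (∑ i ∈ Finset.range j, (-2 * l + a (x + c i))) := by
  have h1 := GevB.sum (Finset.range j) hK fun i _ => ha.comp_add_const (c i)
  have h2 := (h1.exp hs hK).const_mul (Real.exp (-2 * l * j))
  rw [abs_of_pos (Real.exp_pos _), ← Real.exp_add] at h2
  convert h2 using 1
  · congr 1
    simp only [Finset.sum_const, Finset.card_range, nsmul_eq_mul]
    ring
  · ext x
    rw [Finset.sum_add_distrib, Finset.sum_const, Finset.card_range, nsmul_eq_mul, Real.exp_add]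
    congr 2
    ring

lemma gevB_fwdExp (hs : 1 ≤ s) (hK : 0 ≤ K) (ha : GevB s K (16 * H) L.a)
    (hb : GevB s K (16 * H) L.b) (j : ℕ) :
    GevB s K (Real.exp ((96 * H - 2 * l) * j + 3)) (fwdExp α (L.ratio l) j) :=
  gevB_birkhoff_exp hs hK (a := fun x => L.a x + L.b x)
    (by convert ha.add hb using 1; ring) j fun i => i * α

lemma gevB_bwdExp (hs : 1 ≤ s) (hK : 0 ≤ K) (ha : GevB s K (16 * H) L.a)
    (hb : GevB s K (16 * H) L.b) (j : ℕ) :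
    GevB s K (Real.exp ((96 * H - 2 * l) * j + 3)) (bwdExp α (L.ratio l) j) :=
  gevB_birkhoff_exp hs hK (a := fun x => L.a x + L.b x)
    (by convert ha.add hb using 1; ring) j fun i => -((i + 1) * α)

end

section

variable {s K α h l H σ X : ℝ} {m : ℕ} {χ : ℝ → ℝ} {L : SplitCocycle}

lemma OrbitSeparated.gevB_exp_sum (hsep : OrbitSeparated α m χ) (hs : 1 ≤ s) (hK : 0 ≤ K)
    (hχ : GevB s K 16 χ) {e : ℝ} (he : |e| ≤ h)
    (c : ℕ → ℝ) (hc : ∀ j < m, |c j| ≤ 1) (p : ℕ → ℤ) (hp : ∀ i j, i ≠ j → p i ≠ p j)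
    (hp' : ∀ i < m, |p i| ≤ m) :
    GevB s K (Real.exp (48 * h + 3))
      fun y => Real.exp (e * ∑ j ∈ Finset.range m, c j * χ (y + p j * α)) :=
  gevB_exp_le hs hK (gevB_mul_const_le hK (hsep.gevB_sum hK hχ c hc p hp hp') he)

lemma OrbitSeparated.gevB_fwdP (hsep : OrbitSeparated α m χ) (hs : 1 ≤ s) (hK : 0 ≤ K)
    (hχ : GevB s K 16 χ) (h0 : 0 ≤ h) :
    GevB s K (Real.exp (48 * h + 3)) (fwdP α h m χ) ∧
      GevB s K (Real.exp (48 * h + 3)) fun y => (fwdP α h m χ y)⁻¹ := by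
  have hc : ∀ j < m, |1 - ((j : ℝ) + 1) / m| ≤ 1 := fun j hj => by
    have hm : (0 : ℝ) < m := by exact_mod_cast (by omega : 0 < m)
    have h1 : ((j : ℝ) + 1) / m ≤ 1 := (div_le_one hm).2 (by exact_mod_cast hj)
    have h2 : 0 ≤ ((j : ℝ) + 1) / m := by positivity
    rw [abs_le]; constructor <;> linarith
  have key : ∀ e : ℝ, |e| ≤ h → _ := fun e he =>
    hsep.gevB_exp_sum hs hK hχ he (fun j => 1 - ((j : ℝ) + 1) / m) hc (fun j => -((j : ℤ) + 1))
      (fun i j hij => by omega) fun i hi => by rw [abs_le]; omega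
  constructor
  · convert key (-h) (by rw [abs_neg, abs_of_nonneg h0]) using 1
    ext y
    simp only [fwdP, neg_mul]
    push_cast
    simp only [neg_mul, ← sub_eq_add_neg]
  · convert key h (abs_of_nonneg h0).le using 1
    ext y
    simp only [fwdP, ← Real.exp_neg, neg_neg]
    push_cast
    simp only [neg_mul, ← sub_eq_add_neg]

lemma OrbitSeparated.gevB_bwdP (hsep : OrbitSeparated α m χ) (hs : 1 ≤ s) (hK : 0 ≤ K)
    (hχ : GevB s K 16 χ) (h0 : 0 ≤ h) :
    GevB s K (Real.exp (48 * h + 3)) (bwdP α h m χ) ∧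
      GevB s K (Real.exp (48 * h + 3)) fun y => (bwdP α h m χ y)⁻¹ := by
  have hc : ∀ j < m, |1 - (j : ℝ) / m| ≤ 1 := fun j hj => by
    have hm : (0 : ℝ) < m := by exact_mod_cast (by omega : 0 < m)
    have h1 : (j : ℝ) / m ≤ 1 := (div_le_one hm).2 (by exact_mod_cast hj.le)
    have h2 : 0 ≤ (j : ℝ) / m := by positivity
    rw [abs_le]; constructor <;> linarith
  have key : ∀ e : ℝ, |e| ≤ h → _ := fun e he =>
    hsep.gevB_exp_sum hs hK hχ he (fun j => 1 - (j : ℝ) / m) hc (fun j => (j : ℤ))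
      (fun i j hij => by omega) fun i hi => by rw [abs_le]; omega
  constructor
  · convert key (-h) (by rw [abs_neg, abs_of_nonneg h0]) using 1
    ext y
    simp only [bwdP, neg_mul]
    push_cast
    rfl
  · convert key h (abs_of_nonneg h0).le using 1
    ext y
    simp only [bwdP, ← Real.exp_neg, neg_neg]
    push_cast
    rfl

lemma gevB_relExp_le (hs : 1 ≤ s) (hK : 0 ≤ K) (hl : 48 * H ≤ l) (ha : GevB s K (16 * H) L.a)
    (hb : GevB s K (16 * H) L.b) (j : ℕ) :
    GevB s K (Real.exp 3) (fwdExp α (L.ratio l) j) ∧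
      GevB s K (Real.exp 3) (bwdExp α (L.ratio l) j) := by
  have : Real.exp ((96 * H - 2 * l) * j + 3) ≤ Real.exp 3 := by
    refine Real.exp_le_exp.2 ?_
    have : (96 * H - 2 * l) * j ≤ 0 := mul_nonpos_of_nonpos_of_nonneg (by linarith) (by positivity)
    linarith
  exact ⟨(gevB_fwdExp hs hK ha hb j).mono hK this, (gevB_bwdExp hs hK ha hb j).mono hK this⟩

lemma gevB_dip_term (hs : 1 ≤ s) (hK : 0 ≤ K) (hχ : GevB s K 16 χ) (h0 : 0 ≤ h) {c : ℝ}
    (hc0 : 0 ≤ c) (hc1 : c ≤ 1) {g : ℝ → ℝ} (hg : GevB s K (Real.exp 3) g) :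
    GevB s K (Real.exp (96 * h + 10)) fun y => dipFun h χ y * Real.exp (c * (h * χ y)) * g y := by
  have h1 := gevB_exp_le hs hK (gevB_mul_const_le hK hχ (c := c * h) (h := h) (by
    rw [abs_of_nonneg (by positivity)]; nlinarith))
  have h2 := ((gevB_dipFun hs hK hχ h0).mul hs hK h1).mul hs hK hg
  simp only [mul_assoc] at h2 ⊢
  refine h2.mono hK ?_
  have e : Real.exp (96 * h + 10) =
      Real.exp (48 * h + 4) * (Real.exp (48 * h + 3) * Real.exp 3) := by
    rw [← Real.exp_add, ← Real.exp_add]; ring_nf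
  have p := Real.exp_pos (96 * h + 10)
  rw [e] at p ⊢
  nlinarith

lemma gevB_slide (hs : 1 ≤ s) (hK : 0 ≤ K) (hχ : GevB s K 16 χ) (h0 : 0 ≤ h)
    (hl : 48 * H ≤ l) (ha : GevB s K (16 * H) L.a) (hb : GevB s K (16 * H) L.b) :
    GevB s K (m * Real.exp (96 * h + 10)) (fwdS α h m χ (L.ratio l)) ∧
      GevB s K (m * Real.exp (96 * h + 10)) (bwdS α h m χ (L.ratio l)) := by
  constructor
  · have := GevB.sum (Finset.range m) hK (F := fun (j : ℕ) y => dipFun h χ (y - (j + 1) * α) *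
      Real.exp (((j : ℝ) + 1) / m * (h * χ (y - (j + 1) * α))) *
        fwdExp α (L.ratio l) (j + 1) (y - (j + 1) * α)) (c := fun _ => Real.exp (96 * h + 10))
      fun j hj => by
        have hj := Finset.mem_range.1 hj
        have hm : (0 : ℝ) < m := by exact_mod_cast (by omega : 0 < m)
        exact (gevB_dip_term hs hK hχ h0 (c := ((j : ℝ) + 1) / m) (by positivity)
          ((div_le_one hm).2 (by exact_mod_cast hj))
          (gevB_relExp_le hs hK hl ha hb (j + 1)).1).comp_sub_const ((j + 1) * α)
    simp only [Finset.sum_const, Finset.card_range, nsmul_eq_mul] at this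
    exact this
  · have := GevB.sum (Finset.range m) hK (F := fun (j : ℕ) y => dipFun h χ (y + j * α) *
      Real.exp ((j : ℝ) / m * (h * χ (y + j * α))) *
        bwdExp α (L.ratio l) j (y + j * α)) (c := fun _ => Real.exp (96 * h + 10))
      fun j hj => by
        have hj := Finset.mem_range.1 hj
        have hm : (0 : ℝ) < m := by exact_mod_cast (by omega : 0 < m)
        exact (gevB_dip_term hs hK hχ h0 (c := (j : ℝ) / m) (by positivity)
          ((div_le_one hm).2 (by exact_mod_cast hj.le))
          (gevB_relExp_le hs hK hl ha hb j).2).comp_add_const (j * α)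
    simp only [Finset.sum_const, Finset.card_range, nsmul_eq_mul] at this
    exact this

/-- One component of the new frame. -/
lemma gevB_comb (hs : 1 ≤ s) (hK : 0 ≤ K) (hm : 1 ≤ m) (hh : h ≤ H * m)
    {P Q v w : ℝ → ℝ} (hP : GevB s K (Real.exp (48 * h + 3)) P)
    (hQ : GevB s K (m * Real.exp (96 * h + 10)) Q) (hv : GevB s K X v) (hw : GevB s K X w)
    (h0 : 0 ≤ h) :
    GevB s K (X * Real.exp ((96 * H + 11) * m)) fun y => P y * v y + Q y * w y := by
  have hX := hv.nonneg
  have hm' : (1 : ℝ) ≤ m := by exact_mod_cast hm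
  refine ((hP.mul hs hK hv).add (hQ.mul hs hK hw)).mono hK ?_
  have h1 : Real.exp (48 * h + 3) ≤ Real.exp ((96 * H + 11) * m) :=
    Real.exp_le_exp.2 (by nlinarith)
  have h2 : m * Real.exp (96 * h + 10) ≤ Real.exp ((96 * H + 11) * m) := by
    have : (m : ℝ) ≤ Real.exp m := by linarith [Real.add_one_le_exp (m : ℝ)]
    calc m * Real.exp (96 * h + 10) ≤ Real.exp m * Real.exp (96 * h + 10) := by gcongr
      _ = Real.exp (m + (96 * h + 10)) := (Real.exp_add _ _).symm
      _ ≤ _ := Real.exp_le_exp.2 (by nlinarith)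
  nlinarith

namespace SplitCocycle

/-- Gevrey bounds for the components of a split cocycle: `X` for the splitting, `Ca` for the
exponents and `C` for the cocycle. -/
structure Gev (r K X Ca C : ℝ) (L : SplitCocycle) : Prop where
  A : MatGevB r K C L.A
  u : VecGevB r K X L.u
  s : VecGevB r K X L.s
  di : GevB r K X L.di
  a : GevB r K (16 * Ca) L.a
  b : GevB r K (16 * Ca) L.b

lemma Gev.mono_K {K' Ca C : ℝ} (hL : L.Gev s K X Ca C) (hK : 0 ≤ K) (h : K ≤ K') :
    L.Gev s K' X Ca C where
  A i j := (hL.A i j).mono_K hK h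
  u i := (hL.u i).mono_K hK h
  s i := (hL.s i).mono_K hK h
  di := hL.di.mono_K hK h
  a := hL.a.mono_K hK h
  b := hL.b.mono_K hK h

lemma Gev.step_sub {Ca C τ : ℝ} (hL : L.Gev s K X Ca C) (hs : 1 ≤ s) (hK : 0 ≤ K)
    (hχ : GevB s K 16 χ) (h0 : 0 ≤ h) (hh : h ≤ H * m) (hCa : Ca ≤ H)
    (hm : 1 ≤ m) (hσ : 0 ≤ σ) (hτσ : σ * Real.exp (48 * h + 4) ≤ τ)
    (hτX : X ^ 3 * Real.exp ((144 * H + 7 - 2 * l) * m) ≤ τ) (hτ : τ ≤ 1) :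
    MatGevB s K (7 * C * τ) fun y => (L.step α l h σ m χ).A y - L.A y := by
  have ha := hL.a.mono hK (C₂ := 16 * H) (by linarith)
  have hb := hL.b.mono hK (C₂ := 16 * H) (by linarith)
  have hX := hL.di.nonneg
  have hm' : (1 : ℝ) ≤ m := by exact_mod_cast hm
  have key : ∀ (g : ℝ → ℝ) (w : ℝ → Fin 2 → ℝ), VecGevB s K X w →
      GevB s K (Real.exp (48 * h + 4) * Real.exp ((96 * H - 2 * l) * m + 3) / 2) g →
      MatGevB s K τ fun y => shear (g y * L.di y) (w y) - 1 := fun g w hw hg => by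
    refine (matGevB_shear_sub_one hs hK (hg.mul hs hK hL.di) hw).mono hK ?_
    have e : Real.exp (48 * h + 4) * Real.exp ((96 * H - 2 * l) * m + 3) ≤
        Real.exp ((144 * H + 7 - 2 * l) * m) := by
      rw [← Real.exp_add]
      exact Real.exp_le_exp.2 (by nlinarith)
    have p : 0 ≤ Real.exp (48 * h + 4) * Real.exp ((96 * H - 2 * l) * m + 3) := by positivity
    have := mul_le_mul_of_nonneg_left e (pow_nonneg hX 3)
    have := mul_nonneg (pow_nonneg hX 3) p
    linarith
  refine MatGevB.mul_near_one hs hK hτ hL.A ?_ (key _ _ hL.s ?_) (key _ _ hL.u ?_)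
  · have h1 : GevB s K τ fun y => σ * dipFun h χ y := by
      refine ((gevB_dipFun hs hK hχ h0).const_mul σ).mono hK ?_
      rw [abs_of_nonneg hσ]; linarith
    have h2 : GevB s K τ fun _ => 0 := (GevB.const hK 0).mono hK (by simpa using h1.nonneg)
    intro i j
    fin_cases i <;> fin_cases j
    · simpa [shear] using h2
    · simpa [shear] using h2
    · simpa [shear] using h1
    · simpa [shear] using h2
  · exact (((gevB_exp_sub_one hs hK hχ h0).mul hs hK
      (gevB_fwdExp hs hK ha hb m))).comp_sub_const (m * α)
  · exact (((gevB_exp_sub_one hs hK hχ h0).mul hs hK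
      (gevB_bwdExp hs hK ha hb m))).comp_add_const (m * α)

lemma Gev.step {Ca C τ : ℝ} (hL : L.Gev s K X Ca C) (hs : 1 ≤ s) (hK : 0 ≤ K)
    (hχ : GevB s K 16 χ) (hsep : OrbitSeparated α m χ) (h0 : 0 ≤ h) (hh : h ≤ H * m)
    (hCa : Ca ≤ H) (hl : 48 * H ≤ l)
    (hm : 1 ≤ m) (hσ : 0 ≤ σ) (hτσ : σ * Real.exp (48 * h + 4) ≤ τ)
    (hτX : X ^ 3 * Real.exp ((144 * H + 7 - 2 * l) * m) ≤ τ) (hτ : τ ≤ 1) :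
    (L.step α l h σ m χ).Gev s K (X * Real.exp ((96 * H + 11) * m)) (Ca + h / m)
      (C * (1 + 7 * τ)) := by
  have ha := hL.a.mono hK (C₂ := 16 * H) (by linarith)
  have hb := hL.b.mono hK (C₂ := 16 * H) (by linarith)
  have hX := hL.di.nonneg
  have hm' : (1 : ℝ) ≤ m := by exact_mod_cast hm
  have hP := hsep.gevB_fwdP hs hK hχ h0
  have hQ := hsep.gevB_bwdP hs hK hχ h0
  have hS := gevB_slide (α := α) (m := m) (L := L) hs hK hχ h0 hl ha hb
  refine ⟨?_, fun i => ?_, fun i => ?_, ?_, ?_, ?_⟩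
  · have := hL.A.add (hL.step_sub (α := α) (l := l) hs hK hχ h0 hh hCa hm hσ hτσ hτX hτ)
    simp only [add_sub_cancel] at this
    convert this using 1
    ring
  · exact gevB_comb hs hK hm hh hP.1 hS.1 (hL.u i) (hL.s i) h0
  · exact gevB_comb hs hK hm hh hQ.1 hS.2 (hL.s i) (hL.u i) h0
  · refine (hL.di.mul hs hK (hP.2.mul hs hK hQ.2)).mono hK ?_
    have e : Real.exp (48 * h + 3) * Real.exp (48 * h + 3) ≤ Real.exp ((96 * H + 11) * m) := by
      rw [← Real.exp_add]
      exact Real.exp_le_exp.2 (by nlinarith)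
    have p : 0 ≤ Real.exp (48 * h + 3) * Real.exp (48 * h + 3) := by positivity
    nlinarith [mul_le_mul_of_nonneg_left e hX]
  · have := hL.a.add ((hsep.gevB_sum hK hχ (fun _ => 1) (by simp) (fun j => -(j : ℤ))
      (fun i j hij => by omega) fun i hi => by rw [abs_le]; omega).const_mul (h / m))
    rw [abs_of_nonneg (by positivity)] at this
    convert this using 1
    · ring
    · ext y
      simp only [SplitCocycle.step, one_mul]
      push_cast
      simp only [neg_mul, ← sub_eq_add_neg]
  · have := hL.b.add ((hsep.gevB_sum hK hχ (fun _ => 1) (by simp) (fun j => (j : ℤ) + 1)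
      (fun i j hij => by omega) fun i hi => by rw [abs_le]; omega).const_mul (h / m))
    rw [abs_of_nonneg (by positivity)] at this
    convert this using 1
    · ring
    · ext y
      simp only [SplitCocycle.step, one_mul]
      push_cast
      rfl

end SplitCocycle

end

/-- Parameters of the inductive construction: at stage `n` the bump `χ n` is used with height `h n`
along orbit segments of length `m n`, the angle of the splitting on its support being about `σ n`,
and the cocycle moves by `τ n`. The total loss of exponent is at most `H`, and the orbits spend a
proportion at least `η` of their time near the core of the bumps. -/
structure Tower (α s' s H C₁ C₂ η : ℝ) where
  K : ℕ → ℝ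
  σ : ℕ → ℝ
  h : ℕ → ℝ
  τ : ℕ → ℝ
  κ : ℕ → ℝ
  m : ℕ → ℕ
  χ : ℕ → ℝ → ℝ
  K_nonneg : ∀ n, 0 ≤ K n
  K_mono : ∀ n, K n ≤ K (n + 1)
  gevB : ∀ n, GevB s' (K n) 16 (χ n)
  mem_Icc : ∀ n y, 0 ≤ χ n y ∧ χ n y ≤ 1
  periodic : ∀ n y, χ n (y + 1) = χ n y
  separated : ∀ n, OrbitSeparated α (m n) (χ n)
  nested : ∀ n y, χ (n + 1) y ≠ 0 → χ n y = 1
  one_le_m : ∀ n, 1 ≤ m n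
  h_nonneg : ∀ n, 0 ≤ h n
  σ_pos : ∀ n, 0 < σ n
  σ_succ : ∀ n, σ (n + 1) = σ n * Real.exp (-h n)
  sum_h : ∀ n, ∑ k ∈ Finset.range n, h k / m k ≤ H
  sum_m : ∀ n, (∑ k ∈ Finset.range n, m k : ℝ) ≤ C₁ * m n
  σ_le : ∀ n, σ n * Real.exp (48 * h n + 4) ≤ τ n
  exp_le : ∀ n, Real.exp (-(C₂ * m n)) ≤ τ n
  τ_le : ∀ n, τ n ≤ 1
  summable : Summable fun n => τ n * Real.exp ((s - s') * K n ^ (1 / (s - s')))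
  κ_nonneg : ∀ n, 0 ≤ κ n
  κ_le : ∀ n, κ n ≤ 1
  core : ∀ n y, 0 ≤ y → y ≤ κ n → χ n y = 1
  le_core : ∀ n, η ≤ 2 * m n * κ n

/-- The constant hyperbolic cocycle whose contracting direction makes the angle `σ` with the
horizontal axis. -/
def SplitCocycle.base (l σ : ℝ) : SplitCocycle where
  A _ := !![Real.exp l, (Real.exp (-l) - Real.exp l) / σ; 0, Real.exp (-l)]
  u _ := ![1, 0]
  s _ := ![1, σ]
  di _ := σ⁻¹
  a _ := 0
  b _ := 0

lemma SplitCocycle.base_valid (α l : ℝ) {σ : ℝ} (hσ : 0 < σ) :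
    (SplitCocycle.base l σ).Valid α l where
  u_eq y := by
    ext i; fin_cases i <;> simp [SplitCocycle.base, Matrix.mulVec, dotProduct, Fin.sum_univ_two]
  s_eq y := by
    ext i
    fin_cases i <;> simp [SplitCocycle.base, Matrix.mulVec, dotProduct, Fin.sum_univ_two]
    field_simp
    ring
  di_eq y := by simp [SplitCocycle.base, wedge, hσ.ne']
  det_eq y := by simp [SplitCocycle.base, Matrix.det_fin_two, ← Real.exp_add]

lemma SplitCocycle.base_per (l σ : ℝ) : (SplitCocycle.base l σ).Per :=
  ⟨fun _ => rfl, fun _ => rfl, fun _ => rfl, fun _ => rfl, fun _ => rfl, fun _ => rfl⟩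

lemma SplitCocycle.base_gev (l : ℝ) {σ r K : ℝ} (hσ : 0 < σ) (hK : 0 ≤ K) :
    (SplitCocycle.base l σ).Gev r K (16 * (1 + σ + σ⁻¹)) 0
      (16 * (Real.exp |l| + 2 * Real.exp |l| / σ)) := by
  have key : ∀ {c C : ℝ}, |c| ≤ C → GevB r K (16 * C) fun _ => c := fun {c C} h =>
    (GevB.const hK c).mono hK (mul_le_mul_of_nonneg_left h (by norm_num))
  have hσ' := inv_pos.2 hσ
  have e1 : Real.exp l ≤ Real.exp |l| := Real.exp_le_exp.2 (le_abs_self l)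
  have e2 : Real.exp (-l) ≤ Real.exp |l| := Real.exp_le_exp.2 (neg_le_abs l)
  have p1 := Real.exp_pos l
  have p2 := Real.exp_pos (-l)
  have p3 := Real.exp_pos |l|
  have p4 : 0 ≤ 2 * Real.exp |l| / σ := by positivity
  have d0 : |(0 : ℝ)| ≤ 1 + σ + σ⁻¹ := by rw [abs_zero]; positivity
  have d1 : |(1 : ℝ)| ≤ 1 + σ + σ⁻¹ := by rw [abs_one]; linarith
  have d2 : |σ| ≤ 1 + σ + σ⁻¹ := by rw [abs_of_pos hσ]; linarith
  have d3 : |σ⁻¹| ≤ 1 + σ + σ⁻¹ := by rw [abs_of_pos hσ']; linarith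
  refine ⟨fun i j => ?_, fun i => ?_, fun i => ?_, key d3, ?_, ?_⟩
  · fin_cases i <;> fin_cases j
    · exact key (c := Real.exp l) (by rw [abs_of_pos p1]; linarith)
    · refine key (c := (Real.exp (-l) - Real.exp l) / σ) ?_
      rw [abs_div, abs_of_pos hσ]
      have : |Real.exp (-l) - Real.exp l| ≤ 2 * Real.exp |l| := by
        rw [abs_le]; constructor <;> linarith
      have : |Real.exp (-l) - Real.exp l| / σ ≤ 2 * Real.exp |l| / σ := by gcongr
      linarith
    · exact key (c := 0) (by rw [abs_zero]; positivity)
    · exact key (c := Real.exp (-l)) (by rw [abs_of_pos p2]; linarith)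
  · fin_cases i
    · exact key d1
    · exact key d0
  · fin_cases i
    · exact key d1
    · exact key d2
  · exact key (c := 0) (by rw [abs_zero])
  · exact key (c := 0) (by rw [abs_zero])

namespace Tower

variable {α s' s H C₁ C₂ η l : ℝ}

/-- The cocycles produced by the inductive construction. -/
def seq (T : Tower α s' s H C₁ C₂ η) (l : ℝ) : ℕ → SplitCocycle
  | 0 => SplitCocycle.base l (T.σ 0)
  | n + 1 => (T.seq l n).step α l (T.h n) (T.σ n) (T.m n) (T.χ n)

lemma H_nonneg (T : Tower α s' s H C₁ C₂ η) : 0 ≤ H := by simpa using T.sum_h 0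

lemma h_le (T : Tower α s' s H C₁ C₂ η) (n : ℕ) : T.h n ≤ H * T.m n := by
  have hm : (0 : ℝ) < T.m n := by exact_mod_cast T.one_le_m n
  rw [← div_le_iff₀ hm]
  have h1 := T.sum_h (n + 1)
  rw [Finset.sum_range_succ] at h1
  have : 0 ≤ ∑ k ∈ Finset.range n, T.h k / T.m k :=
    Finset.sum_nonneg fun k _ => div_nonneg (T.h_nonneg k) (Nat.cast_nonneg _)
  linarith

lemma τ_nonneg (T : Tower α s' s H C₁ C₂ η) (n : ℕ) : 0 ≤ T.τ n :=
  (Real.exp_pos _).le.trans (T.exp_le n)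

/-- The bound on the frame at stage `n`. -/
def frameBound (T : Tower α s' s H C₁ C₂ η) (n : ℕ) : ℝ :=
  16 * (1 + T.σ 0 + (T.σ 0)⁻¹) * Real.exp ((96 * H + 11) * ∑ k ∈ Finset.range n, (T.m k : ℝ))

/-- The exponents above which the inductive construction works. -/
def threshold (T : Tower α s' s H C₁ C₂ η) : ℝ :=
  3 * (16 * (1 + T.σ 0 + (T.σ 0)⁻¹)) + 3 * ((96 * H + 11) * C₁) + 144 * H + 7 + C₂

lemma frameBound_le (T : Tower α s' s H C₁ C₂ η) (hl : T.threshold ≤ 2 * l) (n : ℕ) :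
    T.frameBound n ^ 3 * Real.exp ((144 * H + 7 - 2 * l) * T.m n) ≤ T.τ n := by
  refine le_trans ?_ (T.exp_le n)
  have hm : (1 : ℝ) ≤ T.m n := by exact_mod_cast T.one_le_m n
  have hσ := T.σ_pos 0
  have hH := T.H_nonneg
  set x := 16 * (1 + T.σ 0 + (T.σ 0)⁻¹) with hx
  have hx0 : 0 ≤ x := by positivity
  have h1 : x ≤ Real.exp (x * T.m n) := by
    have := Real.add_one_le_exp (x * T.m n)
    nlinarith
  have h2 : Real.exp ((96 * H + 11) * ∑ k ∈ Finset.range n, (T.m k : ℝ)) ≤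
      Real.exp ((96 * H + 11) * (C₁ * T.m n)) := by
    have := T.sum_m n
    gcongr
  have h3 : T.frameBound n ≤ Real.exp (x * T.m n) * Real.exp ((96 * H + 11) * (C₁ * T.m n)) := by
    unfold frameBound
    gcongr
  have h0 : 0 ≤ T.frameBound n := by unfold frameBound; positivity
  calc _ ≤ (Real.exp (x * T.m n) * Real.exp ((96 * H + 11) * (C₁ * T.m n))) ^ 3 *
      Real.exp ((144 * H + 7 - 2 * l) * T.m n) := by gcongr
    _ = Real.exp ((T.threshold - C₂ - 2 * l) * T.m n) := by
      rw [← Real.exp_add, ← Real.exp_nat_mul, ← Real.exp_add]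
      congr 1
      simp only [threshold, ← hx]
      push_cast; ring
    _ ≤ _ := Real.exp_le_exp.2 (by nlinarith)

/-- The properties of the cocycles at stage `n`. -/
structure Good (T : Tower α s' s H C₁ C₂ η) (l : ℝ) (n : ℕ) : Prop where
  valid : (T.seq l n).Valid α l
  per : (T.seq l n).Per
  frame : ∀ y, T.χ n y ≠ 0 → (T.seq l n).u y = ![1, 0] ∧ (T.seq l n).s y = ![1, T.σ n]
  a_nonneg : ∀ y, 0 ≤ (T.seq l n).a y
  gev : (T.seq l n).Gev s' (T.K n) (T.frameBound n) (∑ k ∈ Finset.range n, T.h k / T.m k)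
    (16 * (Real.exp |l| + 2 * Real.exp |l| / T.σ 0) *
      Real.exp (7 * ∑ k ∈ Finset.range n, T.τ k))

lemma good (T : Tower α s' s H C₁ C₂ η) (hs' : 1 ≤ s') (hl : T.threshold ≤ 2 * l)
    (hlH : 48 * H ≤ l) (n : ℕ) : T.Good l n := by
  induction n with
  | zero =>
    refine ⟨SplitCocycle.base_valid α l (T.σ_pos 0), SplitCocycle.base_per _ _, fun _ _ =>
      ⟨rfl, rfl⟩, fun _ => le_rfl, ?_⟩
    simpa [frameBound, seq] using SplitCocycle.base_gev l (r := s') (T.σ_pos 0) (T.K_nonneg 0)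
  | succ n ih =>
    have hd := (T.separated n).orbitDisjoint
    refine ⟨ih.valid.step (T.one_le_m n) hd ih.frame, ih.per.step (T.periodic n), fun y hy => ?_,
      fun y => ?_, ?_⟩
    · have := SplitCocycle.step_frame (l := l) (h := T.h n) hd (T.one_le_m n) ih.frame
        (T.nested n y hy)
      rwa [← T.σ_succ] at this
    · have h1 : 0 ≤ ∑ j ∈ Finset.range (T.m n), T.χ n (y - j * α) :=
        Finset.sum_nonneg fun j _ => (T.mem_Icc n _).1
      have h2 := T.h_nonneg n
      have h3 := ih.a_nonneg y
      simp only [seq, SplitCocycle.step]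
      positivity
    · have h := ih.gev.step (l := l) hs' (T.K_nonneg n) (T.gevB n) (T.separated n) (T.h_nonneg n)
        (T.h_le n) (T.sum_h n) hlH (T.one_le_m n) (T.σ_pos n).le (T.σ_le n)
        (T.frameBound_le hl n) (T.τ_le n)
      have h := h.mono_K (T.K_nonneg n) (T.K_mono n)
      have e1 : T.frameBound n * Real.exp ((96 * H + 11) * T.m n) = T.frameBound (n + 1) := by
        simp only [frameBound]
        rw [mul_assoc, ← Real.exp_add, Finset.sum_range_succ]
        ring_nf
      rw [e1, ← Finset.sum_range_succ] at h
      have hσ := T.σ_pos 0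
      refine ⟨h.A.mono (T.K_nonneg _) ?_, h.u, h.s, h.di, h.a, h.b⟩
      rw [Finset.sum_range_succ, mul_add 7, Real.exp_add, mul_assoc _ (Real.exp _) (1 + _)]
      gcongr
      linarith [Real.add_one_le_exp (7 * T.τ n)]

end Tower

lemma mnorm_le_of_abs_le {A : Matrix (Fin 2) (Fin 2) ℝ} {C : ℝ} (h : ∀ i j, |A i j| ≤ C) :
    mnorm A ≤ 4 * C := by
  have hC : 0 ≤ C := (abs_nonneg _).trans (h 0 0)
  refine mnorm_le_of_mulVec (by positivity) fun v => (norm_toLp_le_add _).trans ?_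
  have hv := fun i => abs_apply_le_norm_toLp v i
  have key : ∀ i, |A.mulVec v i| ≤ 2 * C * ‖WithLp.toLp 2 v‖ := fun i => by
    simp only [Matrix.mulVec, dotProduct, Fin.sum_univ_two]
    have h1 : ∀ j, |A i j * v j| ≤ C * ‖WithLp.toLp 2 v‖ := fun j => by
      rw [abs_mul]; exact mul_le_mul (h i j) (hv j) (abs_nonneg _) hC
    linarith [abs_add_le (A i 0 * v 0) (A i 1 * v 1), h1 0, h1 1]
  linarith [key 0, key 1]

lemma tendsto_of_abs_sub_le {F : ℕ → Matrix (Fin 2) (Fin 2) ℝ} {A : Matrix (Fin 2) (Fin 2) ℝ}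
    {c : ℕ → ℝ} (hc : Tendsto c atTop (nhds 0)) (h : ∀ n i j, |F n i j - A i j| ≤ c n) :
    Tendsto F atTop (nhds A) := by
  refine tendsto_pi_nhds.2 fun i => tendsto_pi_nhds.2 fun j => ?_
  rw [← tendsto_sub_nhds_zero_iff]
  exact squeeze_zero_norm (fun n => h n i j) hc

/-- A sequence of matrix valued maps with summable increments converges in the Gevrey topology. -/
lemma MatGevB.exists_limit {s K C : ℝ} {F : ℕ → ℝ → Matrix (Fin 2) (Fin 2) ℝ} {c : ℕ → ℝ}
    (h0 : MatGevB s K C (F 0)) (h : ∀ n, MatGevB s K (c n) fun y => F (n + 1) y - F n y)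
    (hc : Summable c) :
    ∃ A : ℝ → Matrix (Fin 2) (Fin 2) ℝ, MatGevB s K (C + ∑' k, c k) A ∧
      ∀ n, MatGevB s K (∑' k, c (k + n)) fun y => F n y - A y := by
  have hsum : ∀ i j y, Summable fun k => F (k + 1) y i j - F k y i j := fun i j y =>
    Summable.of_norm_bounded (hc.div_const 16) fun k => (h k i j).abs_le y
  refine ⟨fun y => Matrix.of fun i j => F 0 y i j + ∑' k, (F (k + 1) y i j - F k y i j),
    fun i j =>
    (h0 i j).add (GevB.tsum (fun k => h k i j) hc), fun n i j => ?_⟩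
  convert (GevB.tsum (fun k => h (k + n) i j) ((summable_nat_add_iff n).2 hc)).neg using 1
  ext y
  have e1 := (hsum i j y).sum_add_tsum_nat_add n
  have e2 := Finset.sum_range_sub (fun k => F k y i j) n
  simp only [Matrix.sub_apply, Matrix.of_apply]
  rw [e2] at e1
  simp only [add_right_comm _ n 1] at e1 ⊢
  rw [← e1]
  ring

namespace Tower

variable {α s' s H C₁ C₂ η l : ℝ}

lemma summable_τ (T : Tower α s' s H C₁ C₂ η) (hs : s' < s) : Summable T.τ := by
  refine T.summable.of_nonneg_of_le T.τ_nonneg fun n => ?_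
  have := Real.one_le_exp (mul_nonneg (sub_pos.2 hs).le
    (Real.rpow_nonneg (T.K_nonneg n) (1 / (s - s'))))
  nlinarith [T.τ_nonneg n]

lemma matGevB_twist_sub (T : Tower α s' s H C₁ C₂ η) (hs' : 1 ≤ s') (hs : s' < s) {n : ℕ} {C : ℝ}
    (hA : MatGevB s' (T.K n) C (T.seq l n).A) :
    MatGevB s 1 (8 * C * (T.τ n * Real.exp ((s - s') * T.K n ^ (1 / (s - s')))))
      fun y => (T.seq l n).twist (T.σ n) (T.χ n) y - (T.seq l n).A y := by
  have hC := hA.nonneg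
  have hK := T.K_nonneg n
  have hσ := T.σ_pos n
  have hτ := T.τ_nonneg n
  have hστ : T.σ n ≤ T.τ n := by
    refine le_trans ?_ (T.σ_le n)
    have := Real.one_le_exp (show 0 ≤ 48 * T.h n + 4 by linarith [T.h_nonneg n])
    nlinarith
  have key : ∀ i, GevB s 1 (8 * C * (T.τ n * Real.exp ((s - s') * T.K n ^ (1 / (s - s')))))
      fun y => (T.seq l n).A y i 1 * (T.σ n * T.χ n y) := fun i => by
    have := (((hA i 1).mul hs' hK ((T.gevB n).const_mul (T.σ n))).mono hK
      (C₂ := 8 * C * T.τ n) (by rw [abs_of_pos hσ]; nlinarith)).convert hs hK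
    rwa [mul_assoc (8 * C)] at this
  have key0 : GevB s 1 (8 * C * (T.τ n * Real.exp ((s - s') * T.K n ^ (1 / (s - s')))))
      fun _ => 0 := (GevB.const zero_le_one 0).mono zero_le_one (by rw [abs_zero, mul_zero]; positivity)
  intro i j
  fin_cases j
  · convert key i using 1
    ext y
    simp [SplitCocycle.twist, Matrix.mul_apply, Fin.sum_univ_two]
  · convert key0 using 1
    ext y
    simp [SplitCocycle.twist, Matrix.mul_apply, Fin.sum_univ_two]

/-- The limit cocycle of the construction, and its perturbations of smaller exponent. -/
lemma exists_limit (T : Tower α s' s H C₁ C₂ η) (hs' : 1 ≤ s') (hs : s' < s)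
    (hl : T.threshold ≤ 2 * l) (hlH : 48 * H ≤ l) :
    ∃ (A : ℝ → Matrix (Fin 2) (Fin 2) ℝ) (B : ℕ → ℝ → Matrix (Fin 2) (Fin 2) ℝ) (C : ℝ) (c : ℕ → ℝ),
      MatGevB s 1 C A ∧ (∀ y, A (y + 1) = A y) ∧ (∀ y, (A y).det = 1) ∧
      (∀ n y, B n (y + 1) = B n y) ∧ (∀ n y, (B n y).det = 1) ∧
      Tendsto c atTop (nhds 0) ∧ (∀ n, MatGevB s 1 (c n) fun y => B n y - A y) ∧
      l - H ≤ lyapunovExp α (fun x => A (x / (2 * π))) ∧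
      ∀ n, lyapunovExp α (fun x => B n (x / (2 * π))) ≤ H + Real.log 4 + l * (1 - η) := by
  have hg := T.good hs' hl hlH
  have hH := T.H_nonneg
  have hl0 : 0 ≤ l := by linarith
  set W : ℕ → ℝ := fun n => T.τ n * Real.exp ((s - s') * T.K n ^ (1 / (s - s'))) with hW
  set C := 16 * (Real.exp |l| + 2 * Real.exp |l| / T.σ 0) * Real.exp (7 * ∑' k, T.τ k) with hC
  have hσ0 := T.σ_pos 0
  have hC0 : 0 ≤ C := by positivity
  have hA : ∀ n, MatGevB s' (T.K n) C (T.seq l n).A := fun n =>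
    (hg n).gev.A.mono (T.K_nonneg n) (by
      have := (T.summable_τ hs).sum_le_tsum (Finset.range n) fun k _ => T.τ_nonneg k
      exact mul_le_mul_of_nonneg_left (Real.exp_le_exp.2 (by linarith)) (by positivity))
  have hstep : ∀ n, MatGevB s 1 (7 * C * W n)
      fun y => (T.seq l (n + 1)).A y - (T.seq l n).A y := fun n => by
    have h1 := (hg n).gev.step_sub (α := α) (l := l) hs' (T.K_nonneg n) (T.gevB n) (T.h_nonneg n)
        (T.h_le n) (T.sum_h n) (T.one_le_m n) (T.σ_pos n).le (T.σ_le n)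
        (T.frameBound_le hl n) (T.τ_le n)
    have h2 : (16 * (Real.exp |l| + 2 * Real.exp |l| / T.σ 0) *
      Real.exp (7 * ∑ k ∈ Finset.range n, T.τ k)) ≤ C := by
      have := (T.summable_τ hs).sum_le_tsum (Finset.range n) fun k _ => T.τ_nonneg k
      exact mul_le_mul_of_nonneg_left (Real.exp_le_exp.2 (by linarith)) (by positivity)
    intro i j
    have h3 := ((h1 i j).mono (T.K_nonneg n) (C₂ := 7 * C * T.τ n) (by
      have := T.τ_nonneg n
      gcongr)).convert hs (T.K_nonneg n)
    rwa [mul_assoc (7 * C)] at h3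
  obtain ⟨A, hAg, hAt⟩ := MatGevB.exists_limit (F := fun n => (T.seq l n).A)
    (fun i j => (hA 0 i j).convert hs (T.K_nonneg 0)) hstep (T.summable.mul_left (7 * C))
  set d : ℕ → ℝ := fun n => ∑' k, 7 * C * W (k + n) with hd
  have hd0 : Tendsto d atTop (nhds 0) := tendsto_sum_nat_add fun k => 7 * C * W k
  have hlim : ∀ y, Tendsto (fun n => (T.seq l n).A y) atTop (nhds (A y)) := fun y =>
    tendsto_of_abs_sub_le (c := fun n => d n / 16) (by simpa using hd0.div_const 16)
      fun n i j => (hAt n i j).abs_le y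
  have hdet : ∀ y, (A y).det = 1 := fun y => by
    have h1 := (continuous_id.matrix_det.tendsto (A y)).comp (hlim y)
    have h2 : (fun M : Matrix (Fin 2) (Fin 2) ℝ => (id M).det) ∘ (fun n => (T.seq l n).A y) =
        fun _ => 1 := by
      ext n; exact (hg n).valid.det_eq y
    rw [h2] at h1
    exact (tendsto_nhds_unique h1 tendsto_const_nhds)
  have hle : ∀ n, (∑ k ∈ Finset.range n, T.h k / T.m k) ≤ H := T.sum_h
  have ha : ∀ n y, (T.seq l n).a y ≤ H := fun n y => by
    have := (abs_le.1 ((hg n).gev.a.abs_le y)).2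
    linarith [hle n]
  have hb : ∀ n y, (T.seq l n).b y ≤ H := fun n y => by
    have := (abs_le.1 ((hg n).gev.b.abs_le y)).2
    linarith [hle n]
  refine ⟨A, fun n => (T.seq l n).twist (T.σ n) (T.χ n), _, fun n => 8 * C * W n + d n, hAg,
    fun y => ?_, hdet, fun n y => ?_, fun n => (hg n).valid.det_twist, ?_, fun n => ?_, ?_,
    fun n => ?_⟩
  · refine tendsto_nhds_unique (hlim (y + 1)) ?_
    simp only [fun n => (hg n).per.A y]
    exact hlim y
  · simp only [SplitCocycle.twist, (hg n).per.A y, T.periodic n y]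
  · simpa only [mul_zero, add_zero] using (T.summable.tendsto_atTop_zero.const_mul (8 * C)).add hd0
  · have := (T.matGevB_twist_sub hs' hs (hA n)).add (hAt n)
    simpa only [sub_add_sub_cancel] using this
  · exact SplitCocycle.le_lyapunovExp_of_tendsto (C := 4 * (C / 16)) (fun n => (hg n).valid)
      (fun n => (hg n).per) (fun n => (hg n).gev.A.continuous) (fun n => (hg n).gev.u.continuous) ha
      (fun n t => mnorm_le_of_abs_le fun i j => (hA n i j).abs_le t) hdet hlim
  · refine ((hg n).valid.lyapunovExp_twist_le (hg n).per (hg n).gev.A.continuous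
      (hg n).gev.u.continuous (hg n).gev.s.continuous (hg n).gev.di.1.continuous
      (T.separated n).orbitDisjoint (T.gevB n).1.continuous (T.periodic n) (T.mem_Icc n)
      (hg n).frame hl0 hH (hg n).a_nonneg (hb n) (T.κ_nonneg n) (T.κ_le n) (T.core n)).trans ?_
    have := mul_le_mul_of_nonneg_left (T.le_core n) hl0
    linarith

end Tower

lemma exists_rates {d : ℝ} (hd : 1 < d) : ∃ θ Y : ℝ, 1 / 2 ≤ θ ∧ θ < 1 ∧ 1 < Y ∧ Y ≤ 97 / 96 ∧
    Y * θ < 1 ∧ ∀ (c : ℝ) (n : ℕ), 0 ≤ c → (c * (θ ^ n)⁻¹) ^ (1 / d) = c ^ (1 / d) * Y ^ n := by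
  have hd0 : 0 < d := by linarith
  set t := (97 / 96 : ℝ) ^ (-d) with ht
  have ht0 : 0 < t := by positivity
  have ht1 : t < 1 := Real.rpow_lt_one_of_one_lt_of_neg (by norm_num) (by linarith)
  set θ := max (1 / 2) t with hθ
  have hθ0 : 0 < θ := lt_max_of_lt_right ht0
  have hθ1 : θ < 1 := max_lt (by norm_num) ht1
  have hneg : -(1 / d) < 0 := by have := one_div_pos.2 hd0; linarith
  refine ⟨θ, θ ^ (-(1 / d)), le_max_left _ _, hθ1,
    Real.one_lt_rpow_of_pos_of_lt_one_of_neg hθ0 hθ1 hneg, ?_, ?_, fun c n hc => ?_⟩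
  · calc θ ^ (-(1 / d)) ≤ t ^ (-(1 / d)) :=
        Real.rpow_le_rpow_of_nonpos ht0 (le_max_right _ _) hneg.le
      _ = 97 / 96 := by
        rw [ht, ← Real.rpow_mul (by norm_num)]
        rw [show -d * -(1 / d) = 1 by field_simp, Real.rpow_one]
  · calc θ ^ (-(1 / d)) * θ = θ ^ (-(1 / d) + 1) := by
          rw [Real.rpow_add hθ0, Real.rpow_one]
      _ < 1 := by
        refine Real.rpow_lt_one hθ0.le hθ1 ?_
        have : 1 / d < 1 := (div_lt_one hd0).2 hd
        linarith
  · rw [Real.mul_rpow hc (by positivity), Real.inv_rpow (by positivity), ← Real.rpow_natCast θ n,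
      ← Real.rpow_mul hθ0.le, ← Real.rpow_neg hθ0.le, ← Real.rpow_natCast, ← Real.rpow_mul hθ0.le]
    ring_nf

lemma periodize_eventuallyEq_zero {χ : ℝ → ℝ} {ρ : ℝ} (hρ : 0 < ρ) (hρ' : ρ ≤ 1 / 8)
    (h0 : ∀ t, 1 ≤ |t| → χ t = 0) {y : ℝ} (hy : ρ < |y - round y|) :
    periodize χ ρ =ᶠ[nhds y] 0 := by
  refine (periodize_eventuallyEq hρ hρ' h0 y).trans ?_
  have hc : ContinuousAt (fun t : ℝ => |t - round y|) y := by fun_prop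
  filter_upwards [hc.eventually (lt_mem_nhds hy)] with t ht
  refine h0 _ ?_
  rw [abs_mul, abs_of_pos (inv_pos.2 hρ), ← div_eq_inv_mul, le_div_iff₀ hρ, one_mul]
  exact ht.le

lemma BoundedType.orbitSeparated {α M : ℝ} (hα : Irrational α) (hM : 1 ≤ M)
    (hb : BoundedType α M) {χ : ℝ → ℝ} {ρ : ℝ} (hρ : 0 < ρ) (hρ' : ρ ≤ 1 / 8)
    (h0 : ∀ t, 1 ≤ |t| → χ t = 0) {m : ℕ} (hm : 2 * ρ * (2 * m + 1) < 1 / (4 * M)) :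
    OrbitSeparated α m (periodize χ ρ) := by
  intro y k hk hkm
  by_contra! hcon
  have h1 : |y - round y| ≤ ρ := not_lt.1 fun h =>
    hcon.1 (periodize_eventuallyEq_zero hρ hρ' h0 h)
  have h2 : |y + k * α - round (y + k * α)| ≤ ρ := not_lt.1 fun h =>
    hcon.2 (periodize_eventuallyEq_zero hρ hρ' h0 h)
  have hsmall : ∀ p : ℤ, 2 * ρ < |(k.natAbs : ℝ) * α - p| := fun p => by
    refine lt_of_lt_of_le ?_ (hb.lower_bound hα hM (Int.natAbs_pos.2 hk) p)
    have hk0 : (0 : ℝ) < k.natAbs := by exact_mod_cast Int.natAbs_pos.2 hk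
    have hk1 : (k.natAbs : ℝ) ≤ 2 * m + 1 := by
      have : (k.natAbs : ℤ) ≤ 2 * m + 1 := by rw [Int.natCast_natAbs]; exact hkm
      exact_mod_cast this
    rw [show 1 / (4 * M * (k.natAbs : ℝ)) = 1 / (4 * M) / k.natAbs by rw [div_div],
      lt_div_iff₀ hk0]
    refine lt_of_le_of_lt ?_ hm
    gcongr
  have h3 : |k * α - ((round (y + k * α) - round y : ℤ) : ℝ)| ≤ 2 * ρ := by
    push_cast
    rw [abs_le] at h1 h2 ⊢
    constructor <;> linarith
  rcases Int.natAbs_eq k with hk' | hk'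
  · refine absurd h3 (not_le.2 ?_)
    have := hsmall (round (y + k * α) - round y)
    have e : (k : ℝ) = ((k.natAbs : ℤ) : ℝ) := congrArg Int.cast hk'
    rw [Int.cast_natCast] at e
    rwa [← e] at this
  · refine absurd h3 (not_le.2 ?_)
    have := hsmall (-(round (y + k * α) - round y))
    have e : (k : ℝ) = ((-(k.natAbs : ℤ) : ℤ) : ℝ) := congrArg Int.cast hk'
    rw [Int.cast_neg, Int.cast_natCast] at e
    have e' : -((k.natAbs : ℝ) * α - ((-(round (y + k * α) - round y) : ℤ) : ℝ)) =
        k * α - ((round (y + k * α) - round y : ℤ) : ℝ) := by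
      rw [show (k.natAbs : ℝ) = -k by linarith]
      push_cast
      ring
    rwa [← abs_neg, e'] at this

lemma sum_geom_le {q : ℝ} (h0 : 0 ≤ q) (h1 : q < 1) (n : ℕ) :
    ∑ k ∈ Finset.range n, q ^ k ≤ (1 - q)⁻¹ := by
  rw [← tsum_geometric_of_lt_one h0 h1]
  exact (summable_geometric_of_lt_one h0 h1).sum_le_tsum _ fun k _ => by positivity

lemma sum_inv_pow_le {θ : ℝ} (h0 : 0 < θ) (h1 : θ < 1) (n : ℕ) :
    ∑ k ∈ Finset.range n, (θ ^ k)⁻¹ ≤ (θ⁻¹ - 1)⁻¹ * (θ ^ n)⁻¹ := by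
  have h : 0 < θ⁻¹ - 1 := sub_pos.2 ((one_lt_inv₀ h0).2 h1)
  simp_rw [← inv_pow]
  rw [geom_sum_eq (by linarith), div_eq_inv_mul]
  gcongr
  linarith

theorem BoundedType.exists_tower {α M s : ℝ} (hα : Irrational α) (hM : 1 ≤ M)
    (hb : BoundedType α M) (hs : 2 < s) :
    ∃ H C₁ C₂, Nonempty (Tower α (s / 2) s H C₁ C₂ (1 / (40 * M))) := by
  have hd : 1 < s - s / 2 := by linarith
  obtain ⟨θ, Y, hθ, hθ1, hY, hY', hYθ, hrate⟩ := exists_rates hd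
  have hs1 : 1 < s / 2 := by linarith
  obtain ⟨χ, R, hR, hχ, hIcc, hχ1, hχ0⟩ := exists_bump hs1 hθ1
  have hθ0 : 0 < θ := by linarith
  have hM0 : 0 < M := by linarith
  set d := s - s / 2
  set ρ₀ := 1 / (80 * M) with hρ₀
  have hρ₀0 : 0 < ρ₀ := by positivity
  have hρ₀' : ρ₀ ≤ 1 / 80 := by
    rw [hρ₀]
    exact one_div_le_one_div_of_le (by norm_num) (by linarith)
  have hpow : ∀ n : ℕ, 0 < θ ^ n := fun n => by positivity
  have hpow1 : ∀ n : ℕ, θ ^ n ≤ 1 := fun n => pow_le_one₀ hθ0.le hθ1.le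
  have hinv : ∀ n : ℕ, 1 ≤ (θ ^ n)⁻¹ := fun n => (one_le_inv₀ (hpow n)).2 (hpow1 n)
  have hρ : ∀ n : ℕ, 0 < ρ₀ * θ ^ n := fun n => mul_pos hρ₀0 (hpow n)
  have hρ1 : ∀ n : ℕ, ρ₀ * θ ^ n ≤ 1 / 80 := fun n =>
    (mul_le_of_le_one_right hρ₀0.le (hpow1 n)).trans hρ₀'
  have hρ' : ∀ n : ℕ, ρ₀ * θ ^ n ≤ 1 / 8 := fun n => (hρ1 n).trans (by norm_num)
  set Q := d * (R / ρ₀) ^ (1 / d) with hQ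
  have hQ0 : 0 ≤ Q := by positivity
  set B := 2 * Q + 8 with hB
  have hB0 : 8 ≤ B := by linarith
  have hYn : ∀ n : ℕ, 1 ≤ Y ^ n := fun n => one_le_pow₀ hY.le
  have hYθn : ∀ n : ℕ, Y ^ n ≤ (θ ^ n)⁻¹ := fun n => by
    rw [← one_div, le_div_iff₀ (hpow n), ← mul_pow]
    exact pow_le_one₀ (by positivity) hYθ.le
  set m : ℕ → ℕ := fun n => ⌈2 * (θ ^ n)⁻¹⌉₊
  have hm1 : ∀ n, 2 * (θ ^ n)⁻¹ ≤ m n := fun n => Nat.le_ceil _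
  have hm2 : ∀ n, (m n : ℝ) ≤ 3 * (θ ^ n)⁻¹ := fun n => by
    have := Nat.ceil_lt_add_one (a := 2 * (θ ^ n)⁻¹) (by have := hinv n; positivity)
    have := hinv n
    linarith
  have hm3 : ∀ n, (1 : ℝ) ≤ m n := fun n => by have := hinv n; have := hm1 n; linarith
  refine ⟨B * (Y - 1) * (1 - Y * θ)⁻¹, 3 / 2 * (θ⁻¹ - 1)⁻¹, B / 2, ⟨{
    K := fun n => (ρ₀ * θ ^ n)⁻¹ * R
    σ := fun n => Real.exp (-(B * Y ^ n))
    h := fun n => B * (Y - 1) * Y ^ n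
    τ := fun n => Real.exp (-(B / 2 * Y ^ n) + 4)
    κ := fun n => θ * (ρ₀ * θ ^ n)
    m := m
    χ := fun n => periodize χ (ρ₀ * θ ^ n)
    K_nonneg := fun n => by have := hρ n; positivity
    K_mono := fun n => ?_
    gevB := fun n => hχ.periodize (hρ n) (hρ' n) hχ0
    mem_Icc := fun n y => hIcc _
    periodic := fun n y => periodize_periodic _ _ _
    separated := fun n => hb.orbitSeparated hα hM (hρ n) (hρ' n) hχ0 ?_
    nested := fun n y hy => ?_
    one_le_m := fun n => by exact_mod_cast hm3 n
    h_nonneg := fun n => by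
      have := sub_pos.2 hY
      positivity
    σ_pos := fun n => Real.exp_pos _
    σ_succ := fun n => ?_
    sum_h := fun n => ?_
    sum_m := fun n => ?_
    σ_le := fun n => ?_
    exp_le := fun n => ?_
    τ_le := fun n => ?_
    summable := ?_
    κ_nonneg := fun n => by have := hρ n; positivity
    κ_le := fun n => ?_
    core := fun n y hy0 hy => ?_
    le_core := fun n => ?_ }⟩⟩
  · have := hρ (n + 1)
    gcongr ?_⁻¹ * R
    rw [pow_succ]
    exact mul_le_mul_of_nonneg_left (mul_le_of_le_one_right (hpow n).le hθ1.le) hρ₀0.le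
  · calc 2 * (ρ₀ * θ ^ n) * (2 * m n + 1) ≤ 2 * (ρ₀ * θ ^ n) * (7 * (θ ^ n)⁻¹) := by
          have := hρ n
          have := hm2 n
          have := hinv n
          gcongr
          linarith
      _ = 14 * ρ₀ := by
          have := (hpow n).ne'
          field_simp
          norm_num
      _ < 20 * ρ₀ := by linarith
      _ = 1 / (4 * M) := by
          rw [hρ₀]
          field_simp
          norm_num
  · refine periodize_eq_one (hρ n) hχ1 ?_
    have h : ¬ ρ₀ * θ ^ (n + 1) ≤ |y - round y| := fun h =>
      hy (periodize_eq_zero (hρ (n + 1)) hχ0 h)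
    refine (not_le.1 h).le.trans_eq ?_
    rw [pow_succ]
    ring
  · rw [← Real.exp_add]
    congr 1
    rw [pow_succ]
    ring
  · calc ∑ k ∈ Finset.range n, B * (Y - 1) * Y ^ k / m k
        ≤ ∑ k ∈ Finset.range n, B * (Y - 1) * (Y * θ) ^ k := by
          refine Finset.sum_le_sum fun k _ => ?_
          have h1 : 0 < (m k : ℝ) := by linarith [hm3 k]
          have h2 : 1 ≤ θ ^ k * m k := by
            have := mul_le_mul_of_nonneg_left (hm1 k) (hpow k).le
            rw [show θ ^ k * (2 * (θ ^ k)⁻¹) = 2 by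
              have := (hpow k).ne'
              field_simp] at this
            linarith
          have h3 : 0 ≤ B * (Y - 1) * Y ^ k := by
            have := sub_pos.2 hY
            positivity
          rw [div_le_iff₀ h1, mul_pow]
          nlinarith
      _ ≤ B * (Y - 1) * (1 - Y * θ)⁻¹ := by
          rw [← Finset.mul_sum]
          have := sub_pos.2 hY
          gcongr
          exact sum_geom_le (by positivity) hYθ n
  · have h1 := sum_inv_pow_le hθ0 hθ1 n
    have h2 : 0 < (θ⁻¹ - 1)⁻¹ := inv_pos.2 (sub_pos.2 ((one_lt_inv₀ hθ0).2 hθ1))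
    calc (∑ k ∈ Finset.range n, m k : ℝ) ≤ ∑ k ∈ Finset.range n, 3 * (θ ^ k)⁻¹ :=
          Finset.sum_le_sum fun k _ => hm2 k
      _ = 3 * ∑ k ∈ Finset.range n, (θ ^ k)⁻¹ := by rw [Finset.mul_sum]
      _ ≤ 3 * ((θ⁻¹ - 1)⁻¹ * (θ ^ n)⁻¹) := by gcongr
      _ = 3 / 2 * (θ⁻¹ - 1)⁻¹ * (2 * (θ ^ n)⁻¹) := by ring
      _ ≤ 3 / 2 * (θ⁻¹ - 1)⁻¹ * m n := by
          gcongr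
          exact hm1 n
  · rw [← Real.exp_add]
    refine Real.exp_le_exp.2 ?_
    have h1 : 0 ≤ B * Y ^ n := by positivity
    nlinarith [mul_nonneg h1 (sub_nonneg.2 hY')]
  · refine Real.exp_le_exp.2 ?_
    have h1 : Y ^ n ≤ m n := by linarith [hYθn n, hm1 n, hinv n]
    nlinarith
  · refine Real.exp_le_one_iff.2 ?_
    nlinarith [hYn n]
  · have hq : Real.exp (-(4 * (Y - 1))) < 1 := Real.exp_lt_one_iff.2 (by linarith)
    refine Summable.of_nonneg_of_le (fun n => by positivity) (fun n => ?_)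
      (summable_geometric_of_lt_one (Real.exp_pos _).le hq)
    rw [show (ρ₀ * θ ^ n)⁻¹ * R = R / ρ₀ * (θ ^ n)⁻¹ by rw [mul_inv]; ring,
      hrate _ n (by positivity), ← mul_assoc, ← hQ, ← Real.exp_add, ← Real.exp_nat_mul]
    refine Real.exp_le_exp.2 ?_
    have h1 := one_add_mul_sub_le_pow (a := Y) (by linarith) n
    rw [hB]
    nlinarith
  · nlinarith [hρ1 n, hρ n]
  · have h1 := hρ1 n
    have h2 := hρ n
    have h3 : round y = 0 := round_eq_of_abs_sub_lt (by
      rw [Int.cast_zero, sub_zero, abs_of_nonneg hy0]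
      nlinarith)
    refine periodize_eq_one h2 hχ1 ?_
    rw [h3, Int.cast_zero, sub_zero, abs_of_nonneg hy0]
    exact hy
  · calc 1 / (40 * M) = 2 * ρ₀ := by
          rw [hρ₀]
          field_simp
          norm_num
      _ ≤ 4 * θ * ρ₀ := by nlinarith
      _ = 2 * (2 * (θ ^ n)⁻¹) * (θ * (ρ₀ * θ ^ n)) := by
          have := (hpow n).ne'
          field_simp
          norm_num
      _ ≤ 2 * m n * (θ * (ρ₀ * θ ^ n)) := by
          have := hρ n
          gcongr
          exact hm1 n

lemma GevB.gevreyNorm_le {s C : ℝ} {f : ℝ → ℝ} (hf : GevB s 1 C f) :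
    gevreyNorm s 1 f ≤ ENNReal.ofReal (4 * π ^ 2 / 3 * (C / 16)) := by
  refine iSup_le fun k => ?_
  have hw : (0 : ℝ) < (k.factorial : ℝ) ^ s := Real.rpow_pos_of_pos (by positivity) _
  set w := (1 + (k : ℝ)) ^ 2 / (1 ^ k * (k.factorial : ℝ) ^ s) with hw'
  have hw0 : 0 < w := by positivity
  calc _ ≤ ENNReal.ofReal (4 * π ^ 2 / 3 * w) * ENNReal.ofReal (C * gevWeight s 1 k) := by
        gcongr
        exact iSup₂_le fun x _ => ENNReal.ofReal_le_ofReal (hf.2 k x)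
    _ = ENNReal.ofReal (4 * π ^ 2 / 3 * (C / 16)) := by
        rw [← ENNReal.ofReal_mul (by positivity)]
        congr 1
        rw [gevWeight, hw']
        field_simp

lemma MatGevB.comp_div_two_pi {s C : ℝ} {F : ℝ → Matrix (Fin 2) (Fin 2) ℝ} (hF : MatGevB s 1 C F) :
    MatGevB s 1 C fun x => F (x / (2 * π)) := fun i j => by
  have hπ : (2 * π)⁻¹ ≤ 1 := inv_le_one_of_one_le₀ (by linarith [Real.two_le_pi])
  have h0 : 0 ≤ (2 * π)⁻¹ := by positivity
  have : GevB s 1 C fun x => F ((2 * π)⁻¹ * x) i j :=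
    ((hF i j).comp_mul_left h0).mono_K (by positivity) (by rwa [mul_one])
  simpa only [div_eq_inv_mul] using this

lemma periodic_comp_div_two_pi {β : Type*} {F : ℝ → β} (hF : ∀ y, F (y + 1) = F y) :
    Function.Periodic (fun x => F (x / (2 * π))) (2 * π) := fun x => by
  simp only
  rw [add_div, div_self (by positivity), hF]

/-- **Discontinuity of the Lyapunov exponent for `SL(2,ℝ)`-cocycles in `G^s`, `s > 2`**
(Theorem 1.2, quantitative form).  For `α` irrational of bounded type with constant `M` and
`s > 2`, there are a cocycle map `D` with `G^s` entries, constants `K > 0`, `λ > 1`,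
`ε = M⁻¹⁰⁰`, `δ = (1/4)M⁻²⁰`, and cocycle maps `B_n` with entries in `G^{s,K}(𝕊¹)` such that
`|B_n − D|_{s,K} → 0` entrywise, `L(D) ≥ (1 − 4ε) log λ`, and `L(B_n) ≤ (1 − δ) log λ`. -/
theorem lyapunov_discontinuous_SL2_gevrey
    (α M : ℝ) (hα : Irrational α) (hM : 1 ≤ M) (hbdd : BoundedType α M)
    (s : ℝ) (hs : 2 < s) :
    ∃ (D : ℝ → Matrix (Fin 2) (Fin 2) ℝ) (K lam : ℝ)
      (B : ℕ → ℝ → Matrix (Fin 2) (Fin 2) ℝ),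
      0 < K ∧ 1 < lam ∧
      (∀ x, (D x).det = 1) ∧
      (∀ i j, GevreyCircle s (fun x => D x i j)) ∧
      (∀ n x, (B n x).det = 1) ∧
      (∀ n, ∀ i j, ContDiff ℝ (⊤ : ℕ∞) (fun x => B n x i j) ∧
        Function.Periodic (fun x => B n x i j) (2 * π) ∧
        gevreyNorm s K (fun x => B n x i j) < ⊤) ∧
      (∀ i j, Tendsto (fun n => gevreyNorm s K (fun x => B n x i j - D x i j)) atTop
        (nhds 0)) ∧
      (1 - 4 * (M ^ (100 : ℕ))⁻¹) * Real.log lam ≤ lyapunovExp α D ∧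
      (∀ n, lyapunovExp α (B n) ≤ (1 - (1 / 4) * (M ^ (20 : ℕ))⁻¹) * Real.log lam) := by
  obtain ⟨H, C₁, C₂, ⟨T⟩⟩ := hbdd.exists_tower hα hM hs
  have hH := T.H_nonneg
  have hM0 : 0 < M := by linarith
  set η := 1 / (40 * M)
  set δ := 1 / 4 * (M ^ 20)⁻¹ with hδ
  have hgap : 0 < η - δ := by
    have h2 := BoundedType.two_le_sq hα hM hbdd
    have h18 : (2 : ℝ) ^ 9 ≤ (M ^ 2) ^ 9 := pow_le_pow_left₀ (by norm_num) h2 9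
    have h20 : 10 * M < M ^ 20 := by
      rw [← pow_mul] at h18
      have : M ^ 20 = M ^ (2 * 9) * M * M := by ring
      rw [this]
      have : 10 * M < M ^ (2 * 9) * M := by nlinarith
      nlinarith
    rw [sub_pos, hδ, show 1 / 4 * (M ^ 20)⁻¹ = 1 / (4 * M ^ 20) by field_simp]
    exact one_div_lt_one_div_of_lt (by positivity) (by linarith)
  have hε : 0 < 4 * (M ^ 100)⁻¹ := by positivity
  obtain ⟨l, hl⟩ := exists_gt (max (max (max 0 (T.threshold / 2)) (48 * H))
    (max (H / (4 * (M ^ 100)⁻¹)) ((H + Real.log 4) / (η - δ))))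
  simp only [max_lt_iff] at hl
  obtain ⟨⟨⟨hl0, hl1⟩, hl2⟩, hl3, hl4⟩ := hl
  rw [div_lt_iff₀ hε] at hl3
  rw [div_lt_iff₀ hgap] at hl4
  obtain ⟨A, B, C, c, hA, hAp, hAd, hBp, hBd, hc, hBA, hLA, hLB⟩ :=
    T.exists_limit (l := l) (by linarith) (by linarith) (by linarith) hl2.le
  have hB : ∀ n, MatGevB s 1 (c n + C) (B n) := fun n i j => by
    simpa using (hBA n i j).add (hA i j)
  refine ⟨fun x => A (x / (2 * π)), 1, Real.exp l, fun n x => B n (x / (2 * π)), one_pos,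
    Real.one_lt_exp_iff.2 hl0, fun x => hAd _, fun i j => ?_, fun n x => hBd n _, fun n i j => ?_,
    fun i j => ?_, ?_, fun n => ?_⟩
  · have h := hA.comp_div_two_pi i j
    exact ⟨h.1, periodic_comp_div_two_pi (F := fun y => A y i j) fun y => by rw [hAp],
      1, one_pos, h.gevreyNorm_le.trans_lt ENNReal.ofReal_lt_top⟩
  · have h := (hB n).comp_div_two_pi i j
    exact ⟨h.1, periodic_comp_div_two_pi (F := fun y => B n y i j) fun y => by rw [hBp],
      h.gevreyNorm_le.trans_lt ENNReal.ofReal_lt_top⟩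
  · refine tendsto_of_tendsto_of_tendsto_of_le_of_le tendsto_const_nhds ?_
      (fun _ => zero_le) fun n => ((hBA n).comp_div_two_pi i j).gevreyNorm_le
    have := ENNReal.tendsto_ofReal ((hc.div_const 16).const_mul (4 * π ^ 2 / 3))
    simpa using this
  · rw [Real.log_exp]
    linarith
  · rw [Real.log_exp]
    linarith [hLB n]

end
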